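/- Let n ≥ 2, let a ∈ C_c^∞(ℝⁿ×ℝⁿ) and let Φ : ℝⁿ×ℝⁿ → ℝ be smooth, satisfying on supp a: (i) rank ∂²_{xy}Φ(x;y) = n−1 (the rank condition of the n×n Carleson–Sjölin condition); (ii) for each (x₀;y₀) ∈ supp a, letting N(x₀;y₀) ∈ ℝⁿ be a unit vector orthogonal to each of ∂_{y_1}∇_xΦ(x₀;y₀),…,∂_{y_n}∇_xΦ(x₀;y₀), every nonzero vector of the kernel of ∂²_{yy}⟨∇_xΦ(x₀;y), N(x₀;y₀)⟩|_{y=y₀} lies outside the orthogonal complement of the kernel of ∂²_{xy}Φ(x₀;y₀) only in the trivial way, i.e. the matrix ∂²_{yy}⟨∇_xΦ(x₀;y), N(x₀;y₀)⟩|_{y=y₀} has rank n−1 (nonvanishing Gaussian curvature of the hypersurface Σ_{x₀} = {∇_xΦ(x₀;y) : (x₀;y) ∈ supp a}); and (iii) the Monge–Ampère condition: the (n+1)×(n+1) determinant det [[0, ∂_yΦ],[ (∂_xΦ)ᵀ, ∂²_{xy}Φ]](x;y) ≠ 0. For μ > 0 set S_μ f(x) := ∫_{ℝⁿ} e^{iμΦ(x;y)}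 a(x;y) f(y) dy. Then for every p with 2(n+1)/(n−1) ≤ p < ∞ and every ε > 0 there is a constant C_ε such that (∫_{ℝⁿ} sup_{μ∈[λ,2λ]} |S_μ f(x)|^p dx)^{1/p} ≤ C_ε λ^{−n/p+ε} ‖f‖_{L^p(ℝⁿ)} for all λ ≥ 1 and all f ∈ S(ℝⁿ). -/

import Mathlib

open MeasureTheory
open scoped RealInnerProductSpace ENNReal

noncomputable section

/-- `ℝⁿ` as a euclidean space. -/
abbrev V (n : ℕ) := EuclideanSpace ℝ (Fin n)

/-- The gradient `∇_xΦ(x;y) ∈ ℝⁿ`. -/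
def gradX {n m : ℕ} (Φ : V n × V m → ℝ) (x : V n) (y : V m) : V n :=
  (EuclideanSpace.equiv (Fin n) ℝ).symm fun i =>
    fderiv ℝ (fun x' => Φ (x', y)) x (EuclideanSpace.single i 1)

/-- The mixed Hessian `∂²_{xy}Φ(x;y)`. -/
def csMixed {n m : ℕ} (Φ : V n × V m → ℝ) (x : V n) (y : V m) :
    Matrix (Fin n) (Fin m) ℝ :=
  Matrix.of fun i j =>
    fderiv ℝ (fun y' => fderiv ℝ (fun x' => Φ (x', y')) x (EuclideanSpace.single i 1)) y
      (EuclideanSpace.single j 1)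

/-- The curvature matrix `∂²_{yy}⟨∇_xΦ(x₀;y), N⟩|_{y=y₀}`. -/
def csCurv {n m : ℕ} (Φ : V n × V m → ℝ) (x : V n) (y : V m) (N : V n) :
    Matrix (Fin m) (Fin m) ℝ :=
  Matrix.of fun j k =>
    fderiv ℝ (fun y' => fderiv ℝ (fun y'' => (⟪gradX Φ x y'', N⟫ : ℝ)) y'
      (EuclideanSpace.single k 1)) y (EuclideanSpace.single j 1)

/-- The `(n+1) × (n+1)` Monge–Ampère matrix `[[0, ∂_yΦ],[(∂_xΦ)ᵀ, ∂²_{xy}Φ]]`. -/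
def mongeAmpere {n : ℕ} (Φ : V n × V n → ℝ) (x y : V n) :
    Matrix (Fin (n + 1)) (Fin (n + 1)) ℝ :=
  Matrix.of fun i j =>
    if _hi : (i : ℕ) = 0 then
      if _hj : (j : ℕ) = 0 then 0
      else
        fderiv ℝ (fun y' => Φ (x, y')) y
          (EuclideanSpace.single ⟨(j : ℕ) - 1, by have := j.isLt; omega⟩ 1)
    else
      if _hj : (j : ℕ) = 0 then
        fderiv ℝ (fun x' => Φ (x', y)) x
          (EuclideanSpace.single ⟨(i : ℕ) - 1, by have := i.isLt; omega⟩ 1)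
      else
        csMixed Φ x y ⟨(i : ℕ) - 1, by have := i.isLt; omega⟩
          ⟨(j : ℕ) - 1, by have := j.isLt; omega⟩

/-- The oscillatory integral operator `S_μ f(x) = ∫_{ℝⁿ} e^{iμΦ(x;y)} a(x;y) f(y) dy`. -/
def oscIntN {n : ℕ} (μ : ℝ) (Φ : V n × V n → ℝ) (a : V n × V n → ℂ)
    (f : V n → ℂ) (x : V n) : ℂ :=
  ∫ y : V n, Complex.exp (Complex.I * ((μ * Φ (x, y) : ℝ) : ℂ)) * a (x, y) * f y

set_option linter.unusedSectionVars false

theorem contDiff_integral_param {P : Type} [NormedAddCommGroup P] [NormedSpace ℝ P]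
    [FiniteDimensional ℝ P] (n : ℕ) :
    ∀ {F : Type} [NormedAddCommGroup F] [NormedSpace ℝ F] [CompleteSpace F]
      {G : P × ℝ → F}, ContDiff ℝ n G →
      ContDiff ℝ n (fun p => ∫ τ in (0:ℝ)..1, G (p, τ)) := by
  induction n with
  | zero =>
    intro F _ _ _ G hG
    have hc : Continuous G := hG.continuous
    exact_mod_cast contDiff_zero.2
      (intervalIntegral.continuous_parametric_intervalIntegral_of_continuous'
        (f := fun p τ => G (p, τ)) (by fun_prop) 0 1)
  | succ k ih =>
    intro F _ _ _ G hG
    have hG1 : ContDiff ℝ 1 G := hG.of_le (by exact_mod_cast Nat.le_add_left 1 k)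
    have hc : Continuous G := hG.continuous
    have hD : ContDiff ℝ k (fun q : P × ℝ => (fderiv ℝ G q).comp (ContinuousLinearMap.inl ℝ P ℝ)) :=
      (hG.fderiv_right (m := (k : WithTop ℕ∞)) (by exact_mod_cast le_rfl)).clm_comp contDiff_const
    have hDc : Continuous (fun q : P × ℝ =>
        (fderiv ℝ G q).comp (ContinuousLinearMap.inl ℝ P ℝ)) := hD.continuous
    have key : ∀ p₀ : P, HasFDerivAt (fun p => ∫ τ in (0:ℝ)..1, G (p, τ))
        (∫ τ in (0:ℝ)..1, (fderiv ℝ G (p₀, τ)).comp (ContinuousLinearMap.inl ℝ P ℝ)) p₀ := by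
      intro p₀
      obtain ⟨C, hC⟩ := ((isCompact_closedBall p₀ 1).prod
        (isCompact_Icc (a := (0:ℝ)) (b := 1))).exists_bound_of_continuousOn hDc.continuousOn
      refine intervalIntegral.hasFDerivAt_integral_of_dominated_of_fderiv_le
        (F := fun p τ => G (p, τ))
        (F' := fun p τ => (fderiv ℝ G (p, τ)).comp (ContinuousLinearMap.inl ℝ P ℝ))
        (bound := fun _ => C) (Metric.closedBall_mem_nhds p₀ one_pos) ?_ ?_ ?_ ?_ ?_ ?_
      · refine Filter.Eventually.of_forall fun p => ?_
        exact (Continuous.aestronglyMeasurable (by fun_prop))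
      · exact Continuous.intervalIntegrable (by fun_prop) _ _
      · exact (hDc.comp (by fun_prop : Continuous fun τ : ℝ => (p₀, τ))).aestronglyMeasurable
      · refine Filter.Eventually.of_forall fun τ hτ p hp => hC (p, τ) ⟨hp, ?_⟩
        rw [Set.uIoc_of_le zero_le_one] at hτ
        exact ⟨hτ.1.le, hτ.2⟩
      · exact intervalIntegrable_const
      · refine Filter.Eventually.of_forall fun τ _ p _ => ?_
        have h1 : HasFDerivAt G (fderiv ℝ G (p, τ)) (p, τ) :=
          (hG1.differentiable one_ne_zero _).hasFDerivAt
        exact h1.comp p (hasFDerivAt_prodMk_left p τ)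
    have hfd : fderiv ℝ (fun p => ∫ τ in (0:ℝ)..1, G (p, τ)) = fun p₀ =>
        ∫ τ in (0:ℝ)..1, (fderiv ℝ G (p₀, τ)).comp (ContinuousLinearMap.inl ℝ P ℝ) :=
      funext fun p => (key p).fderiv
    have : ((k + 1 : ℕ) : WithTop ℕ∞) = (k : WithTop ℕ∞) + 1 := by push_cast; rfl
    rw [this, contDiff_succ_iff_fderiv]
    refine ⟨fun p => (key p).differentiableAt, fun h => ?_, ?_⟩
    · exact absurd h (by simp)
    · rw [hfd]
      exact ih hD

theorem contDiff_top_integral_param {P F : Type} [NormedAddCommGroup P] [NormedSpace ℝ P]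
    [FiniteDimensional ℝ P] [NormedAddCommGroup F] [NormedSpace ℝ F] [CompleteSpace F]
    {G : P × ℝ → F} (hG : ContDiff ℝ (⊤ : ℕ∞) G) :
    ContDiff ℝ (⊤ : ℕ∞) (fun p => ∫ τ in (0:ℝ)..1, G (p, τ)) :=
  contDiff_infty.2 fun n => contDiff_integral_param n (contDiff_infty.1 hG n)

/-- The smooth extension to `r = 0` of the difference quotient `(g (p + r • v) - g p) / r`. -/
def diffQuot {P : Type} [NormedAddCommGroup P] [NormedSpace ℝ P] (g : P → ℝ) (p : P) (r : ℝ)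
    (v : P) : ℝ :=
  ∫ τ in (0:ℝ)..1, fderiv ℝ g (p + (τ * r) • v) v

section diffQuot

variable {P : Type} [NormedAddCommGroup P] [NormedSpace ℝ P] {g : P → ℝ}

theorem diffQuot_zero (p v : P) : diffQuot g p 0 v = fderiv ℝ g p v := by
  simp [diffQuot]

variable [FiniteDimensional ℝ P]

theorem contDiff_diffQuot (hg : ContDiff ℝ (⊤ : ℕ∞) g) :
    ContDiff ℝ (⊤ : ℕ∞) (fun q : P × ℝ × P => diffQuot g q.1 q.2.1 q.2.2) := by
  have h1 : ContDiff ℝ (⊤ : ℕ∞) (fderiv ℝ g) := hg.fderiv_right (by simp)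
  refine contDiff_top_integral_param
    (G := fun q : (P × ℝ × P) × ℝ => fderiv ℝ g (q.1.1 + (q.2 * q.1.2.1) • q.1.2.2) q.1.2.2) ?_
  exact (h1.comp (by fun_prop)).clm_apply (by fun_prop)

theorem mul_diffQuot (hg : ContDiff ℝ (⊤ : ℕ∞) g) (p : P) (r : ℝ) (v : P) :
    r * diffQuot g p r v = g (p + r • v) - g p := by
  have h1 : Continuous (fderiv ℝ g) := hg.continuous_fderiv (by simp)
  have h2 : ∀ τ ∈ Set.uIcc (0:ℝ) 1, HasDerivAt (fun τ : ℝ => g (p + (τ * r) • v))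
      (r * fderiv ℝ g (p + (τ * r) • v) v) τ := by
    intro τ _
    have h3 : HasFDerivAt g _ (p + (τ * r) • v) :=
      (hg.differentiable (by simp) _).hasFDerivAt
    have h4 : HasDerivAt (fun τ : ℝ => p + (τ * r) • v) (r • v) τ := by
      simpa using (((hasDerivAt_id τ).mul_const r).smul_const v).const_add p
    have h5 := h3.comp_hasDerivAt τ h4
    rw [map_smul, smul_eq_mul] at h5
    exact h5
  have := intervalIntegral.integral_eq_sub_of_hasDerivAt h2
    (Continuous.intervalIntegrable (by fun_prop) _ _)
  rw [diffQuot, ← intervalIntegral.integral_const_mul, this]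
  simp

end diffQuot

theorem contDiff_mul_inv_of_tsupport {X : Type} [NormedAddCommGroup X] [NormedSpace ℝ X]
    {b : X → ℂ} {g : X → ℝ} (hb : ContDiff ℝ (⊤ : ℕ∞) b) (hg : ContDiff ℝ (⊤ : ℕ∞) g)
    (h0 : ∀ x ∈ tsupport b, g x ≠ 0) :
    ContDiff ℝ (⊤ : ℕ∞) (fun x => b x * (((g x)⁻¹ : ℝ) : ℂ)) := by
  rw [contDiff_iff_contDiffAt]
  intro x
  by_cases hx : x ∈ tsupport b
  · exact hb.contDiffAt.mul
      (Complex.ofRealCLM.contDiff.contDiffAt.comp x (hg.contDiffAt.inv (h0 x hx)))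
  · have h1 : b =ᶠ[nhds x] 0 := notMem_tsupport_iff_eventuallyEq.1 hx
    refine (contDiffAt_const (c := (0:ℂ))).congr_of_eventuallyEq ?_
    filter_upwards [h1] with y hy
    simp [hy]

theorem hasFDerivAt_slice {E Θ F : Type} [NormedAddCommGroup E] [NormedSpace ℝ E]
    [NormedAddCommGroup Θ] [NormedSpace ℝ Θ] [NormedAddCommGroup F] [NormedSpace ℝ F]
    {g : E × Θ → F} (hg : Differentiable ℝ g) (z : E) (θ : Θ) :
    HasFDerivAt (fun z => g (z, θ))
      ((fderiv ℝ g (z, θ)).comp (ContinuousLinearMap.inl ℝ E Θ)) z :=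
  HasFDerivAt.comp (g := g) (f := fun z => (z, θ)) z (hg _).hasFDerivAt
    (hasFDerivAt_prodMk_left z θ)

section oscillatory

variable {E Θ : Type} [NormedAddCommGroup E] [NormedSpace ℝ E] [FiniteDimensional ℝ E]
  [MeasureSpace E] [BorelSpace E] [(volume : Measure E).IsAddHaarMeasure]
  [NormedAddCommGroup Θ] [NormedSpace ℝ Θ]

theorem HasCompactSupport.comp_prodMk {b : E × Θ → ℂ} (hb : HasCompactSupport b) (θ : Θ) :
    HasCompactSupport (fun z => b (z, θ)) := by
  refine HasCompactSupport.intro (hb.isCompact.image continuous_fst) fun z hz => ?_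
  by_contra h
  exact hz ⟨(z, θ), subset_tsupport _ h, rfl⟩

theorem exists_bound_integral_slice {b : E × Θ → ℂ} (hb : Continuous b)
    (hbs : HasCompactSupport b) : ∃ C, ∀ θ, ∫ z, ‖b (z, θ)‖ ≤ C := by
  obtain ⟨M, hM⟩ := hbs.exists_bound_of_continuous hb
  have hK := hbs.isCompact.image continuous_fst
  set K := Prod.fst '' tsupport b
  refine ⟨M * volume.real K, fun θ => ?_⟩
  have h1 : ∀ z, z ∉ K → ‖b (z, θ)‖ = 0 := fun z hz => by
    by_contra h
    exact hz ⟨(z, θ), subset_tsupport _ (by simpa using h), rfl⟩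
  have h2 : ∫ z, ‖b (z, θ)‖ = ∫ z in K, ‖b (z, θ)‖ :=
    (setIntegral_eq_integral_of_forall_compl_eq_zero h1).symm
  rw [h2]
  have h3 := norm_setIntegral_le_of_norm_le_const (μ := (volume : Measure E))
      (f := fun z => ‖b (z, θ)‖) (C := M)
    hK.measure_lt_top (fun z _ => by simpa using hM (z, θ))
  exact (Real.le_norm_self _).trans h3

/-- Non-stationary phase, uniformly in a parameter. -/
theorem nonstationary_phase {φ : E × Θ → ℝ} (hφ : ContDiff ℝ (⊤ : ℕ∞) φ) (N : ℕ) :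
    ∀ {b : E × Θ → ℂ}, ContDiff ℝ (⊤ : ℕ∞) b → HasCompactSupport b →
      (∀ q ∈ tsupport b, ∃ ζ : E, fderiv ℝ φ q (ζ, 0) ≠ 0) →
      ∃ C : ℝ, ∀ (θ : Θ) (Λ : ℝ), 0 ≤ Λ →
        Λ ^ N * ‖∫ z, Complex.exp (Complex.I * ((Λ * φ (z, θ) : ℝ) : ℂ)) * b (z, θ)‖ ≤ C := by
  induction N with
  | zero =>
    intro b hb hbs _
    obtain ⟨C, hC⟩ := exists_bound_integral_slice hb.continuous hbs
    refine ⟨C, fun θ Λ _ => ?_⟩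
    rw [pow_zero, one_mul]
    refine (norm_integral_le_integral_norm _).trans ?_
    simpa [Complex.norm_exp] using hC θ
  | succ N ih =>
    intro b hb hbs hne
    let e := Module.finBasis ℝ E
    let d : Fin (Module.finrank ℝ E) → E × Θ → ℝ := fun j q => fderiv ℝ φ q (e j, 0)
    have hd : ∀ j, ContDiff ℝ (⊤ : ℕ∞) (d j) := fun j =>
      (hφ.fderiv_right (m := (⊤ : ℕ∞)) (by simp)).clm_apply contDiff_const
    let D : E × Θ → ℝ := fun q => ∑ j, d j q ^ 2
    have hD : ContDiff ℝ (⊤ : ℕ∞) D := ContDiff.sum fun j _ => (hd j).pow 2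
    have hD0 : ∀ q ∈ tsupport b, D q ≠ 0 := by
      intro q hq h0
      obtain ⟨ζ, hζ⟩ := hne q hq
      have h1 : ∀ j, d j q = 0 := fun j => by
        have := (Finset.sum_eq_zero_iff_of_nonneg (fun j _ => sq_nonneg (d j q))).1 h0 j
          (Finset.mem_univ j)
        exact pow_eq_zero_iff (two_ne_zero) |>.1 this
      apply hζ
      have h2 : (ContinuousLinearMap.inl ℝ E Θ) ζ
          = ∑ j, e.repr ζ j • (ContinuousLinearMap.inl ℝ E Θ) (e j) := by
        conv_lhs => rw [← e.sum_repr ζ]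
        rw [map_sum]; simp only [map_smul]
      have h3 : ((ζ, 0) : E × Θ) = ∑ j, e.repr ζ j • ((e j, 0) : E × Θ) := h2
      rw [h3, map_sum]
      refine Finset.sum_eq_zero fun j _ => ?_
      rw [map_smul]
      have := h1 j
      simp only [d] at this
      rw [this, smul_zero]
    let c : Fin (Module.finrank ℝ E) → E × Θ → ℂ := fun j q =>
      b q * (((D q)⁻¹ : ℝ) : ℂ) * ((d j q : ℝ) : ℂ)
    have hc : ∀ j, ContDiff ℝ (⊤ : ℕ∞) (c j) := fun j =>
      (contDiff_mul_inv_of_tsupport hb hD hD0).mul (Complex.ofRealCLM.contDiff.comp (hd j))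
    have hcs : ∀ j, tsupport (c j) ⊆ tsupport b := fun j => by
      refine closure_mono fun q hq => ?_
      contrapose! hq
      simp only [Function.mem_support, not_not] at hq ⊢
      simp [c, hq]
    have hcc : ∀ j, HasCompactSupport (c j) := fun j =>
      hbs.of_isClosed_subset (isClosed_tsupport _) (hcs j)
    let b₁ : E × Θ → ℂ := fun q => ∑ j, fderiv ℝ (c j) q (e j, 0)
    have hb₁ : ContDiff ℝ (⊤ : ℕ∞) b₁ := ContDiff.sum fun j _ =>
      ((hc j).fderiv_right (m := (⊤ : ℕ∞)) (by simp)).clm_apply contDiff_const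
    have hb₁s : tsupport b₁ ⊆ tsupport b := by
      refine closure_minimal (fun q hq => ?_) (isClosed_tsupport _)
      by_contra hn
      apply hq
      refine Finset.sum_eq_zero fun j _ => ?_
      have : fderiv ℝ (c j) q = 0 := by
        by_contra h
        exact hn (hcs j (support_fderiv_subset ℝ h))
      rw [this]; rfl
    obtain ⟨C, hC⟩ := ih hb₁ (hbs.of_isClosed_subset (isClosed_tsupport _) hb₁s)
      (fun q hq => hne q (hb₁s hq))
    refine ⟨C, fun θ Λ hΛ => ?_⟩
    refine le_trans (le_of_eq ?_) (hC θ Λ hΛ)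
    rw [pow_succ, mul_assoc]
    congr 1
    let u : E → ℂ := fun z => Complex.exp (Complex.I * ((Λ * φ (z, θ) : ℝ) : ℂ))
    have hu : ContDiff ℝ (⊤ : ℕ∞) u := by
      refine Complex.contDiff_exp.comp (contDiff_const.mul (Complex.ofRealCLM.contDiff.comp ?_))
      exact contDiff_const.mul (hφ.comp (by fun_prop))
    have hud : ∀ z j, fderiv ℝ u z (e j) = Complex.I * Λ * d j (z, θ) * u z := by
      intro z j
      have h2 : HasFDerivAt (fun z => φ (z, θ)) ((fderiv ℝ φ (z, θ)).comp
          (ContinuousLinearMap.inl ℝ E Θ)) z := 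
        hasFDerivAt_slice (hφ.differentiable (by simp)) z θ
      have h3 := ((Complex.ofRealCLM.hasFDerivAt.comp z (h2.const_mul Λ)).const_mul
        Complex.I).cexp
      have h4 : fderiv ℝ u z = _ := h3.fderiv
      rw [h4]
      simp only [Function.comp_def, Complex.ofRealCLM_apply, FunLike.coe_smul, Pi.smul_apply,
        ContinuousLinearMap.comp_apply, ContinuousLinearMap.inl_apply, smul_eq_mul, d, u]
      push_cast
      ring
    have hcd : ∀ z j, fderiv ℝ (fun z => c j (z, θ)) z (e j) = fderiv ℝ (c j) (z, θ) (e j, 0) := by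
      intro z j
      have h2 : HasFDerivAt (fun z => c j (z, θ)) ((fderiv ℝ (c j) (z, θ)).comp
          (ContinuousLinearMap.inl ℝ E Θ)) z := 
        hasFDerivAt_slice ((hc j).differentiable (by simp)) z θ
      have h4 : fderiv ℝ (fun z => c j (z, θ)) z = _ := h2.fderiv
      rw [h4]; rfl
    have hcθ : ∀ j, ContDiff ℝ (⊤ : ℕ∞) (fun z => c j (z, θ)) := fun j => (hc j).comp (by fun_prop)
    have hcθs : ∀ j, HasCompactSupport (fun z => c j (z, θ)) := fun j => (hcc j).comp_prodMk θ
    have hdc : ∀ j, Continuous (fun z => fderiv ℝ (fun z => c j (z, θ)) z (e j)) := fun j =>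
      ((hcθ j).continuous_fderiv (by simp)).clm_apply continuous_const
    have hdu : ∀ j, Continuous (fun z => fderiv ℝ u z (e j)) := fun j =>
      (hu.continuous_fderiv (by simp)).clm_apply continuous_const
    have hdcs : ∀ j, HasCompactSupport (fun z => fderiv ℝ (fun z => c j (z, θ)) z (e j)) :=
      fun j => (hcθs j).fderiv_apply ℝ (e j)
    have hi₁ : ∀ j, Integrable (fun z => u z * fderiv ℝ (fun z => c j (z, θ)) z (e j)) := fun j =>
      (hu.continuous.mul (hdc j)).integrable_of_hasCompactSupport ((hdcs j).mul_left)
    have hi₂ : ∀ j, Integrable (fun z => fderiv ℝ u z (e j) * c j (z, θ)) := fun j =>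
      ((hdu j).mul (hcθ j).continuous).integrable_of_hasCompactSupport ((hcθs j).mul_left)
    have ibp : ∀ j, ∫ z, u z * fderiv ℝ (fun z => c j (z, θ)) z (e j)
        = - ∫ z, fderiv ℝ u z (e j) * c j (z, θ) := fun j => by
      refine integral_mul_fderiv_eq_neg_fderiv_mul_of_integrable (hi₂ j) (hi₁ j) ?_ ?_ ?_
      · exact (hu.continuous.mul (hcθ j).continuous).integrable_of_hasCompactSupport
          ((hcθs j).mul_left)
      · exact fun z _ => hu.differentiable (by simp) z
      · exact fun z _ => (hcθ j).differentiable (by simp) z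
    have hsum : ∫ z, u z * b₁ (z, θ) = -(Complex.I * Λ * ∫ z, u z * b (z, θ)) := by
      have h1 : ∀ z, u z * b₁ (z, θ) = ∑ j, u z * fderiv ℝ (fun z => c j (z, θ)) z (e j) := by
        intro z
        rw [← Finset.mul_sum]
        simp only [hcd, b₁]
      simp_rw [h1]
      rw [integral_finsetSum _ fun j _ => hi₁ j]
      simp_rw [ibp]
      rw [Finset.sum_neg_distrib, ← integral_finsetSum _ fun j _ => hi₂ j, ← integral_const_mul]
      congr 2
      ext z
      simp_rw [hud]
      by_cases hz : (z, θ) ∈ tsupport b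
      · have hDz := hD0 _ hz
        have h5 : (∑ j, ((d j (z, θ) : ℝ) : ℂ) ^ 2) = ((D (z, θ) : ℝ) : ℂ) := by
          simp only [D]; push_cast; rfl
        have h6 : ((D (z, θ) : ℝ) : ℂ) ≠ 0 := by exact_mod_cast hDz
        have h7 : ∀ j, Complex.I * Λ * (d j (z, θ) : ℂ) * u z * c j (z, θ) =
            (Complex.I * Λ * u z * b (z, θ) * ((D (z, θ) : ℝ) : ℂ)⁻¹) * (d j (z, θ) : ℂ) ^ 2 := by
          intro j; simp only [c]; push_cast; ring
        simp_rw [h7]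
        rw [← Finset.mul_sum, h5]
        field_simp
      · have : b (z, θ) = 0 := image_eq_zero_of_notMem_tsupport hz
        simp [c, this]
    have := congrArg norm hsum
    simp only [norm_neg, norm_mul, Complex.norm_I, one_mul, Complex.norm_real,
      Real.norm_of_nonneg hΛ] at this
    exact this.symm

end oscillatory

/-- A smooth cutoff to a neighbourhood of the unit sphere, vanishing near the origin. -/
theorem exists_annulus_cutoff (H : Type) [NormedAddCommGroup H] [NormedSpace ℝ H]
    [FiniteDimensional ℝ H] :
    ∃ χ : H → ℝ, ContDiff ℝ (⊤ : ℕ∞) χ ∧ (∀ η, ‖η‖ = 1 → χ η = 1) ∧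
      ∀ η, χ η ≠ 0 → 1 / 4 ≤ ‖η‖ ∧ ‖η‖ ≤ 2 := by
  let f : ContDiffBump (0 : H) := ⟨1, 2, one_pos, one_lt_two⟩
  let g : ContDiffBump (0 : H) := ⟨1 / 4, 1 / 2, by norm_num, by norm_num⟩
  refine ⟨fun η => f η - g η, f.contDiff.sub g.contDiff, fun η hη => ?_, fun η hη => ?_⟩
  · have h1 : f η = 1 := f.one_of_mem_closedBall (by simp [f, hη])
    have h2 : g η = 0 := g.zero_of_le_dist (by simp [g, hη]; norm_num)
    simp only [h1, h2, sub_zero]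
  · constructor
    · by_contra! h
      have h1 : f η = 1 := f.one_of_mem_closedBall (by simp [f]; linarith)
      have h2 : g η = 1 := g.one_of_mem_closedBall (by simp [g]; linarith)
      simp [h1, h2] at hη
    · by_contra! h
      have h1 : f η = 0 := f.zero_of_le_dist (by simp [f]; linarith)
      have h2 : g η = 0 := g.zero_of_le_dist (by simp [g]; linarith)
      simp [h1, h2] at hη

section differenced

variable {E Θ H : Type} [NormedAddCommGroup E] [NormedSpace ℝ E] [FiniteDimensional ℝ E]
  [MeasureSpace E] [BorelSpace E] [(volume : Measure E).IsAddHaarMeasure]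
  [NormedAddCommGroup Θ] [NormedSpace ℝ Θ] [FiniteDimensional ℝ Θ]
  [NormedAddCommGroup H] [NormedSpace ℝ H] [FiniteDimensional ℝ H]

theorem nonstationary_phase_difference_aux {φ : E × Θ → ℝ} (hφ : ContDiff ℝ (⊤ : ℕ∞) φ)
    (J : H →L[ℝ] E × Θ) (p₀ : E × Θ)
    (hne : ∀ h : H, h ≠ 0 → ∃ ζ : E, fderiv ℝ (fun p => fderiv ℝ φ p (J h)) p₀ (ζ, 0) ≠ 0) :
    ∃ δ : ℝ, 0 < δ ∧ ∀ B : (E × Θ) × H → ℂ, ContDiff ℝ (⊤ : ℕ∞) B → HasCompactSupport B →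
      (∀ q ∈ tsupport B, dist q.1 p₀ < δ ∧ ‖q.2‖ < δ) → ∀ N : ℕ,
      ∃ C : ℝ, ∀ (θ : Θ) (h : H) (Λ : ℝ), h ≠ 0 → 0 ≤ Λ →
        (Λ * ‖h‖) ^ N * ‖∫ y, Complex.exp (Complex.I *
          ((Λ * (φ ((y, θ) + J h) - φ (y, θ)) : ℝ) : ℂ)) * B ((y, θ), h)‖ ≤ C := by
  let φ' : E × (Θ × ℝ × H) → ℝ := fun q => diffQuot φ (q.1, q.2.1) q.2.2.1 (J q.2.2.2)
  have hφ' : ContDiff ℝ (⊤ : ℕ∞) φ' := (contDiff_diffQuot hφ).comp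
    (f := fun q : E × (Θ × ℝ × H) => (((q.1, q.2.1), q.2.2.1, J q.2.2.2) : (E × Θ) × ℝ × (E × Θ)))
    (by fun_prop)
  let m : ((E × Θ) × ℝ) × H → E × (Θ × ℝ × H) := fun q => (q.1.1.1, q.1.1.2, q.1.2, q.2)
  let O : Set (((E × Θ) × ℝ) × H) := {q | ∃ ζ : E, fderiv ℝ φ' (m q) (ζ, 0) ≠ 0}
  have hO : IsOpen O := by
    have : O = ⋃ ζ : E, {q | fderiv ℝ φ' (m q) (ζ, 0) ≠ 0} := by ext q; simp [O]
    rw [this]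
    refine isOpen_iUnion fun ζ => isOpen_ne_fun ?_ continuous_const
    exact ((hφ'.continuous_fderiv (by simp)).comp (by fun_prop)).clm_apply continuous_const
  have hcomp : IsCompact {η : H | 1 / 4 ≤ ‖η‖ ∧ ‖η‖ ≤ 2} := by
    refine (isCompact_closedBall (0 : H) 2).of_isClosed_subset ?_ fun η hη => by simpa using hη.2
    exact (isClosed_le continuous_const continuous_norm).inter
      (isClosed_le continuous_norm continuous_const)
  obtain ⟨u, v, hu, -, hsu, htv, huv⟩ := generalized_tube_lemma
    (isCompact_singleton (x := ((p₀, (0:ℝ)) : (E × Θ) × ℝ))) hcomp hO (by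
      rintro ⟨q, η⟩ ⟨rfl, hη⟩
      have hη0 : η ≠ 0 := by
        rintro rfl
        have h4 : (1 : ℝ) / 4 ≤ ‖(0 : H)‖ := hη.1
        rw [norm_zero] at h4
        norm_num at h4
      obtain ⟨ζ, hζ⟩ := hne η hη0
      refine ⟨ζ, ?_⟩
      convert hζ using 1
      have hd : ContDiff ℝ (⊤ : ℕ∞) (fun p => fderiv ℝ φ p (J η)) :=
        (hφ.fderiv_right (m := (⊤ : ℕ∞)) (by simp)).clm_apply contDiff_const
      have h1 := hasFDerivAt_slice (hφ'.differentiable (by simp)) p₀.1 (p₀.2, 0, η)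
      have h2 := hasFDerivAt_slice (hd.differentiable (by simp)) p₀.1 p₀.2
      have h3 : (fun z => φ' (z, (p₀.2, 0, η))) = fun z => fderiv ℝ φ (z, p₀.2) (J η) := by
        funext z
        exact diffQuot_zero _ _
      rw [h3] at h1
      exact congrArg (fun L : E →L[ℝ] ℝ => L ζ) (h1.unique h2))
  obtain ⟨δ₀, hδ₀, hball⟩ := Metric.isOpen_iff.1 hu _ (hsu rfl)
  refine ⟨δ₀ / 4, by positivity, fun B hB hBs hBd N => ?_⟩
  obtain ⟨χ, hχ, hχ1, hχs⟩ := exists_annulus_cutoff H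
  let b : E × (Θ × ℝ × H) → ℂ := fun q => B ((q.1, q.2.1), q.2.2.1 • q.2.2.2) * (χ q.2.2.2 : ℂ)
  have hb : ContDiff ℝ (⊤ : ℕ∞) b :=
    (hB.comp (f := fun q : E × (Θ × ℝ × H) => ((q.1, q.2.1), q.2.2.1 • q.2.2.2))
      (by fun_prop)).mul (Complex.ofRealCLM.contDiff.comp (hχ.comp (by fun_prop)))
  have hcη : Continuous fun q : E × (Θ × ℝ × H) => ‖q.2.2.2‖ := by fun_prop
  have hbs : tsupport b ⊆ {q | ((q.1, q.2.1), q.2.2.1 • q.2.2.2) ∈ tsupport B ∧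
      1 / 4 ≤ ‖q.2.2.2‖ ∧ ‖q.2.2.2‖ ≤ 2} := by
    refine closure_minimal (fun q hq => ?_) ?_
    · have hq' : b q ≠ 0 := hq
      refine ⟨subset_tsupport _ (left_ne_zero_of_mul hq'), hχs _ ?_⟩
      exact_mod_cast right_ne_zero_of_mul hq'
    · refine ((isClosed_tsupport B).preimage (by fun_prop)).inter
        ((isClosed_le continuous_const hcη).inter (isClosed_le hcη continuous_const))
  have hr : ∀ q ∈ tsupport b, |q.2.2.1| < δ₀ := by
    intro q hq
    obtain ⟨h1, h2, h3⟩ := hbs hq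
    have h4 := (hBd _ h1).2
    simp only [norm_smul, Real.norm_eq_abs] at h4
    nlinarith [abs_nonneg q.2.2.1]
  have hbc : HasCompactSupport b := by
    have hK := hBs.isCompact.image (continuous_fst : Continuous (Prod.fst : (E × Θ) × H → E × Θ))
    have hK1 := hK.image continuous_fst
    have hK2 := hK.image continuous_snd
    refine (hK1.prod (hK2.prod ((isCompact_Icc (a := -δ₀) (b := δ₀)).prod
      hcomp))).of_isClosed_subset (isClosed_tsupport _) fun q hq => ?_
    have h1 := hbs hq
    exact ⟨⟨_, ⟨_, h1.1, rfl⟩, rfl⟩, ⟨_, ⟨_, h1.1, rfl⟩, rfl⟩, abs_le.1 (hr q hq).le, h1.2⟩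
  obtain ⟨C, hC⟩ := nonstationary_phase hφ' N hb hbc (fun q hq => by
    have h1 := hbs hq
    have h2 : ((((q.1, q.2.1), q.2.2.1), q.2.2.2) : ((E × Θ) × ℝ) × H) ∈ O := by
      refine huv ⟨hball ?_, htv h1.2⟩
      have h3 := (hBd _ h1.1).1
      rw [Metric.mem_ball, Prod.dist_eq, max_lt_iff]
      refine ⟨by dsimp only at h3 ⊢; linarith, ?_⟩
      simpa using hr q hq
    exact h2)
  refine ⟨C, fun θ h Λ hh hΛ => ?_⟩
  have hn : ‖h‖ ≠ 0 := norm_ne_zero_iff.2 hh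
  have h1 : ‖h‖ • (‖h‖⁻¹ • h) = h := by rw [smul_smul, mul_inv_cancel₀ hn, one_smul]
  have h2 := hC (θ, ‖h‖, ‖h‖⁻¹ • h) (Λ * ‖h‖) (by positivity)
  have h3 : χ (‖h‖⁻¹ • h) = 1 := hχ1 _ (by rw [norm_smul, norm_inv, norm_norm, inv_mul_cancel₀ hn])
  have h4 : ∀ y, Λ * ‖h‖ * φ' (y, (θ, ‖h‖, ‖h‖⁻¹ • h)) = Λ * (φ ((y, θ) + J h) - φ (y, θ)) := by
    intro y
    rw [mul_assoc]
    simp only [φ']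
    rw [mul_diffQuot hφ, ← map_smul, h1]
  simp only [h4, b, h1, h3, Complex.ofReal_one, mul_one] at h2
  exact h2

/-- Non-stationary phase for a differenced phase function, uniformly in the step. -/
theorem nonstationary_phase_difference {φ : E × Θ → ℝ} (hφ : ContDiff ℝ (⊤ : ℕ∞) φ)
    (J : H →L[ℝ] E × Θ) (p₀ : E × Θ)
    (hne : ∀ h : H, h ≠ 0 → ∃ ζ : E, fderiv ℝ (fun p => fderiv ℝ φ p (J h)) p₀ (ζ, 0) ≠ 0) :
    ∃ δ : ℝ, 0 < δ ∧ ∀ B : (E × Θ) × H → ℂ, ContDiff ℝ (⊤ : ℕ∞) B → HasCompactSupport B →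
      (∀ q ∈ tsupport B, dist q.1 p₀ < δ ∧ ‖q.2‖ < δ) → ∀ N : ℕ,
      ∃ C : ℝ, 0 ≤ C ∧ ∀ (θ : Θ) (h : H) (Λ : ℝ), 0 ≤ Λ →
        ‖∫ y, Complex.exp (Complex.I * ((Λ * (φ ((y, θ) + J h) - φ (y, θ)) : ℝ) : ℂ)) *
          B ((y, θ), h)‖ ≤ C * (1 + ‖Λ • h‖) ^ (-(N : ℝ)) := by
  obtain ⟨δ, hδ, key⟩ := nonstationary_phase_difference_aux hφ J p₀ hne
  refine ⟨δ, hδ, fun B hB hBs hBd N => ?_⟩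
  obtain ⟨C, hC⟩ := key B hB hBs hBd N
  let e := (Homeomorph.prodAssoc E Θ H)
  obtain ⟨C', hC'⟩ := exists_bound_integral_slice (E := E) (Θ := Θ × H) (b := B ∘ e.symm)
    (hB.continuous.comp e.symm.continuous) (hBs.comp_homeomorph e.symm)
  have hC'' : ∀ (θ : Θ) (h : H) (Λ : ℝ), ‖∫ y, Complex.exp (Complex.I *
      ((Λ * (φ ((y, θ) + J h) - φ (y, θ)) : ℝ) : ℂ)) * B ((y, θ), h)‖ ≤ C' := by
    intro θ h Λ
    refine (norm_integral_le_integral_norm _).trans ?_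
    have : ∫ y, ‖B ((y, θ), h)‖ ≤ C' := hC' (θ, h)
    simpa [Complex.norm_exp] using this
  refine ⟨2 ^ (N - 1) * (|C'| + (|C'| + |C|)), by positivity, fun θ h Λ hΛ => ?_⟩
  set X := ‖∫ y, Complex.exp (Complex.I *
      ((Λ * (φ ((y, θ) + J h) - φ (y, θ)) : ℝ) : ℂ)) * B ((y, θ), h)‖ with hX
  have hX0 : 0 ≤ X := norm_nonneg _
  have h0 : 0 ≤ ‖Λ • h‖ := norm_nonneg _
  rw [Real.rpow_neg (by positivity), Real.rpow_natCast, ← div_eq_mul_inv,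
    le_div_iff₀ (by positivity)]
  have h1 : (1 + ‖Λ • h‖) ^ N ≤ 2 ^ (N - 1) * (1 ^ N + ‖Λ • h‖ ^ N) :=
    add_pow_le zero_le_one h0 N
  have h2 : X ≤ |C'| := (hC'' θ h Λ).trans (le_abs_self _)
  have h3 : ‖Λ • h‖ ^ N * X ≤ |C'| + |C| := by
    by_cases hh : h = 0
    · have : ‖Λ • h‖ ^ N ≤ 1 := by
        subst hh; simp only [smul_zero, norm_zero]; exact pow_le_one₀ le_rfl zero_le_one
      nlinarith [abs_nonneg C]
    · have h4 := hC θ h Λ hh hΛ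
      rw [norm_smul, Real.norm_of_nonneg hΛ]
      exact h4.trans ((le_abs_self C).trans (by linarith [abs_nonneg C']))
  calc X * (1 + ‖Λ • h‖) ^ N ≤ X * (2 ^ (N - 1) * (1 ^ N + ‖Λ • h‖ ^ N)) := by gcongr
    _ = 2 ^ (N - 1) * (X + ‖Λ • h‖ ^ N * X) := by rw [one_pow]; ring
    _ ≤ _ := by gcongr

end differenced

theorem sq_norm_integral_mul_le {α : Type*} [MeasurableSpace α] {μ : Measure α} {f g : α → ℂ}
    (hf : MemLp f 2 μ) (hg : MemLp g 2 μ) :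
    ‖∫ x, f x * g x ∂μ‖ ^ 2 ≤ (∫ x, ‖f x‖ ^ 2 ∂μ) * ∫ x, ‖g x‖ ^ 2 ∂μ := by
  have h1 := integral_mul_norm_le_Lp_mul_Lq (μ := μ) (f := f) (g := g)
    (p := 2) (q := 2) ⟨by norm_num, by norm_num, by norm_num⟩ (by simpa using hf)
    (by simpa using hg)
  have hf0 : 0 ≤ ∫ x, ‖f x‖ ^ 2 ∂μ := integral_nonneg fun x => by positivity
  have hg0 : 0 ≤ ∫ x, ‖g x‖ ^ 2 ∂μ := integral_nonneg fun x => by positivity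
  have h2 : ‖∫ x, f x * g x ∂μ‖ ≤ ∫ x, ‖f x‖ * ‖g x‖ ∂μ := by
    refine (norm_integral_le_integral_norm _).trans (le_of_eq ?_)
    simp_rw [norm_mul]
  have h3 := h2.trans h1
  simp only [Real.rpow_two, ← Real.sqrt_eq_rpow] at h3
  calc ‖∫ x, f x * g x ∂μ‖ ^ 2 ≤ (√(∫ x, ‖f x‖ ^ 2 ∂μ) * √(∫ x, ‖g x‖ ^ 2 ∂μ)) ^ 2 := by
        gcongr
    _ = _ := by rw [mul_pow, Real.sq_sqrt hf0, Real.sq_sqrt hg0]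

theorem sq_norm_setIntegral_le {α : Type*} [MeasurableSpace α] {μ : Measure α} {f : α → ℂ}
    {S : Set α} (hS : μ S ≠ ⊤) (hf : MemLp f 2 (μ.restrict S)) :
    ‖∫ x in S, f x ∂μ‖ ^ 2 ≤ μ.real S * ∫ x in S, ‖f x‖ ^ 2 ∂μ := by
  have : IsFiniteMeasure (μ.restrict S) := ⟨by simpa using hS.lt_top⟩
  have := sq_norm_integral_mul_le (μ := μ.restrict S) (f := fun _ => (1:ℂ)) (memLp_const 1) hf
  simpa using this

section differencing

variable {E H : Type} [NormedAddCommGroup E] [NormedSpace ℝ E] [FiniteDimensional ℝ E]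
  [MeasureSpace E] [BorelSpace E] [(volume : Measure E).IsAddHaarMeasure]
  [NormedAddCommGroup H] [NormedSpace ℝ H] [FiniteDimensional ℝ H]
  [MeasureSpace H] [BorelSpace H] [(volume : Measure H).IsAddHaarMeasure]

/-- A Weyl–van der Corput differencing inequality along the range of a linear map. -/
theorem sq_norm_integral_le_of_differencing {F : E → ℂ} (hF : Continuous F)
    (A : H →L[ℝ] E) {ρ : H → ℝ} (hρ : Continuous ρ)
    (hρs : HasCompactSupport ρ) (hρ0 : ∀ k, 0 ≤ ρ k) (hρ1 : ∫ k, ρ k = 1)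
    {S : Set E} (hS : IsCompact S) (hSF : ∀ y k, ρ k ≠ 0 → F (y + A k) ≠ 0 → y ∈ S)
    {D : ℝ} (hD : ∀ k', ρ k' ≠ 0 →
      ∫ k, ρ k * ‖∫ y, F (y + A k) * (starRingEnd ℂ) (F (y + A k'))‖ ≤ D) :
    ‖∫ y, F y‖ ^ 2 ≤ volume.real S * D := by
  let f : E → H → ℂ := fun y k => (ρ k : ℂ) * F (y + A k)
  have hfc : Continuous (Function.uncurry f) := by
    simp only [f, Function.uncurry_def]; fun_prop
  have hf0 : ∀ y k, y ∉ S → f y k = 0 := by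
    intro y k hy
    by_contra h
    exact hy (hSF y k (by exact_mod_cast left_ne_zero_of_mul h) (right_ne_zero_of_mul h))
  have hρ' : ∀ k, k ∉ tsupport ρ → ρ k = 0 := fun k hk => image_eq_zero_of_notMem_tsupport hk
  have hfs : HasCompactSupport (Function.uncurry f) := by
    refine HasCompactSupport.intro (hS.prod hρs.isCompact) ?_
    rintro ⟨y, k⟩ hq
    rw [Set.mem_prod, not_and_or] at hq
    rcases hq with hq | hq
    · exact hf0 y k hq
    · simp [f, hρ' k hq]
  let g : E → ℂ := fun y => ∫ k, f y k
  have hg : Continuous g := by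
    have h1 : g = fun y => ∫ k in tsupport ρ, f y k := by
      funext y
      refine (setIntegral_eq_integral_of_forall_compl_eq_zero fun k hk => ?_).symm
      simp [f, hρ' k hk]
    rw [h1]
    exact continuous_parametric_integral_of_continuous hfc hρs.isCompact
  have hg0 : ∀ y, y ∉ S → g y = 0 := fun y hy => by simp [g, hf0 y _ hy]
  have hgs : HasCompactSupport g := HasCompactSupport.intro hS hg0
  have h_integral_eq : ∫ y, g y = ∫ y, F y := by
    simp only [g]
    rw [integral_integral_swap_of_hasCompactSupport hfc hfs]
    have : ∀ k, ∫ y, f y k = (ρ k : ℂ) * ∫ y, F y := fun k => by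
      simp only [f]
      rw [integral_const_mul, integral_add_right_eq_self]
    simp_rw [this]
    rw [integral_mul_const, integral_complex_ofReal, hρ1]
    simp
  have hgm : MemLp g 2 := hg.memLp_of_hasCompactSupport hgs
  have h_support : ‖∫ y, g y‖ ^ 2 ≤ volume.real S * ∫ y, ‖g y‖ ^ 2 := by
    have h1 := sq_norm_setIntegral_le (μ := (volume : Measure E)) (S := S)
      hS.measure_lt_top.ne (hgm.restrict S)
    rw [setIntegral_eq_integral_of_forall_compl_eq_zero hg0,
      setIntegral_eq_integral_of_forall_compl_eq_zero (fun y hy => by simp [hg0 y hy])] at h1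
    exact h1
  have hD0 : 0 ≤ D := by
    by_contra! hneg
    have : ∀ k, ρ k = 0 := fun k => by
      by_contra hk
      refine absurd (hD k hk) (not_le.2 (hneg.trans_le (integral_nonneg fun k => ?_)))
      exact mul_nonneg (hρ0 k) (norm_nonneg _)
    simp [this] at hρ1
  have h_square : ∫ y, ‖g y‖ ^ 2 ≤ D := by
    have h1 : ((∫ y, ‖g y‖ ^ 2 : ℝ) : ℂ) = ∫ y, ∫ k', (starRingEnd ℂ) (f y k') * g y := by
      rw [← integral_complex_ofReal]
      congr 1
      ext y
      rw [integral_mul_const, integral_conj]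
      change _ = (starRingEnd ℂ) (g y) * g y
      rw [mul_comm, Complex.mul_conj, Complex.normSq_eq_norm_sq]
    have h2 : ∫ y, ∫ k', (starRingEnd ℂ) (f y k') * g y
        = ∫ k', ∫ y, (starRingEnd ℂ) (f y k') * g y := by
      refine integral_integral_swap_of_hasCompactSupport ?_ ?_
      · simp only [Function.uncurry_def]
        exact (Complex.continuous_conj.comp hfc).mul (hg.comp continuous_fst)
      · have : HasCompactSupport fun q : E × H => (starRingEnd ℂ) (f q.1 q.2) :=
          hfs.comp_left (g := starRingEnd ℂ) (map_zero _)
        exact this.mul_right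
    have h3 : ∀ k', ∫ y, (starRingEnd ℂ) (f y k') * g y = (ρ k' : ℂ) *
        ∫ k, (ρ k : ℂ) * ∫ y, F (y + A k) * (starRingEnd ℂ) (F (y + A k')) := by
      intro k'
      have h4 : ∀ y, (starRingEnd ℂ) (f y k') * g y =
          ∫ k, (starRingEnd ℂ) (f y k') * f y k := fun y => by rw [integral_const_mul]
      simp_rw [h4]
      rw [integral_integral_swap_of_hasCompactSupport (f := fun y k =>
        (starRingEnd ℂ) (f y k') * f y k), ← integral_const_mul]
      · congr 1
        ext k
        rw [← integral_const_mul, ← integral_const_mul]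
        congr 1
        ext y
        simp only [f, map_mul, Complex.conj_ofReal]
        ring
      · simp only [Function.uncurry_def]
        exact (Complex.continuous_conj.comp (hfc.comp (f := fun q : E × H => (q.1, k'))
          (by fun_prop))).mul hfc
      · exact hfs.mul_left
    have h5 : ((∫ y, ‖g y‖ ^ 2 : ℝ) : ℂ) = ∫ k', (ρ k' : ℂ) *
        ∫ k, (ρ k : ℂ) * ∫ y, F (y + A k) * (starRingEnd ℂ) (F (y + A k')) := by
      rw [h1, h2]; simp_rw [h3]
    have h6 : ∫ y, ‖g y‖ ^ 2 = ‖((∫ y, ‖g y‖ ^ 2 : ℝ) : ℂ)‖ := by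
      rw [Complex.norm_real, Real.norm_of_nonneg (integral_nonneg fun y => by positivity)]
    rw [h6, h5]
    have h7 : ∀ k', ‖(ρ k' : ℂ) * ∫ k, (ρ k : ℂ) *
        ∫ y, F (y + A k) * (starRingEnd ℂ) (F (y + A k'))‖ ≤ ρ k' * D := by
      intro k'
      rw [norm_mul, Complex.norm_real, Real.norm_of_nonneg (hρ0 k')]
      by_cases hk : ρ k' = 0
      · simp [hk]
      · refine mul_le_mul_of_nonneg_left ?_ (hρ0 k')
        refine (norm_integral_le_integral_norm _).trans (le_trans (le_of_eq ?_) (hD k' hk))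
        congr 1
        ext k
        rw [norm_mul, Complex.norm_real, Real.norm_of_nonneg (hρ0 k)]
    refine (norm_integral_le_of_norm_le (g := fun k' => ρ k' * D) ?_
      (Filter.Eventually.of_forall h7)).trans (le_of_eq ?_)
    · exact (hρ.integrable_of_hasCompactSupport hρs).mul_const D
    · rw [integral_mul_const, hρ1, one_mul]
  rw [← h_integral_eq]
  exact h_support.trans (mul_le_mul_of_nonneg_left h_square measureReal_nonneg)

end differencing

section localStationary

variable {E Θ H : Type} [NormedAddCommGroup E] [NormedSpace ℝ E] [FiniteDimensional ℝ E]
  [MeasureSpace E] [BorelSpace E] [(volume : Measure E).IsAddHaarMeasure]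
  [NormedAddCommGroup Θ] [NormedSpace ℝ Θ] [FiniteDimensional ℝ Θ]
  [NormedAddCommGroup H] [NormedSpace ℝ H] [FiniteDimensional ℝ H]
  [MeasureSpace H] [BorelSpace H] [(volume : Measure H).IsAddHaarMeasure]

theorem integral_one_add_norm_smul_sub (k' : H) (N : ℕ) {Λ : ℝ} (hΛ : 0 < Λ) :
    ∫ k : H, (1 + ‖Λ • (k - k')‖) ^ (-(N : ℝ)) =
      (Λ ^ Module.finrank ℝ H)⁻¹ * ∫ k : H, (1 + ‖k‖) ^ (-(N : ℝ)) := by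
  rw [integral_sub_right_eq_self (fun k : H => (1 + ‖Λ • k‖) ^ (-(N : ℝ))) k',
    Measure.integral_comp_smul volume (fun k : H => (1 + ‖k‖) ^ (-(N : ℝ)))]
  rw [abs_of_pos (by positivity), smul_eq_mul]

theorem integrable_one_add_norm_smul_sub (k' : H) {N : ℕ} (hN : Module.finrank ℝ H < N)
    {Λ : ℝ} (hΛ : 0 < Λ) :
    Integrable fun k : H => (1 + ‖Λ • (k - k')‖) ^ (-(N : ℝ)) := by
  have h1 : Integrable fun k : H => (1 + ‖k‖) ^ (-(N : ℝ)) :=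
    integrable_one_add_norm (by exact_mod_cast hN)
  exact (h1.comp_smul hΛ.ne').comp_sub_right k'

/-- A van der Corput type bound in terms of a partially nondegenerate Hessian. -/
theorem stationary_phase_of_hessian {φ : E × Θ → ℝ} (hφ : ContDiff ℝ (⊤ : ℕ∞) φ) (p₀ : E × Θ)
    (A : H →L[ℝ] E)
    (hA : ∀ k : H, k ≠ 0 → ∃ ζ : E, fderiv ℝ (fun p => fderiv ℝ φ p (A k, 0)) p₀ (ζ, 0) ≠ 0) :
    ∃ δ : ℝ, 0 < δ ∧ ∀ b : E × Θ → ℂ, ContDiff ℝ (⊤ : ℕ∞) b → HasCompactSupport b →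
      tsupport b ⊆ Metric.ball p₀ δ → ∃ C : ℝ, ∀ (θ : Θ) (Λ : ℝ), 0 < Λ →
        Λ ^ Module.finrank ℝ H *
          ‖∫ z, Complex.exp (Complex.I * ((Λ * φ (z, θ) : ℝ) : ℂ)) * b (z, θ)‖ ^ 2 ≤ C := by
  let J : H →L[ℝ] E × Θ := (ContinuousLinearMap.inl ℝ E Θ).comp A
  have hJ : ∀ k, J k = (A k, 0) := fun k => rfl
  obtain ⟨δ, hδ, key⟩ := nonstationary_phase_difference hφ J p₀ hA
  refine ⟨δ, hδ, fun b hb hbs hbδ => ?_⟩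
  let κ : ContDiffBump (0 : H) := ⟨δ / 2, 3 * δ / 4, by positivity, by linarith⟩
  let ρ₀ : ContDiffBump (0 : H) := ⟨δ / 8, δ / 4, by positivity, by linarith⟩
  let ρ : H → ℝ := ρ₀.normed volume
  have hρδ : ∀ k, ρ k ≠ 0 → ‖k‖ < δ / 4 := by
    intro k hk
    have h1 : k ∈ Function.support (ρ₀.normed volume) := hk
    rw [ρ₀.support_normed_eq] at h1
    simpa [ρ₀] using h1
  let B : (E × Θ) × H → ℂ := fun q =>
    b (q.1 + J q.2) * ((starRingEnd ℂ) (b q.1) * ((κ q.2 : ℝ) : ℂ))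
  have hBc : ContDiff ℝ (⊤ : ℕ∞) B := by
    refine (hb.comp (by fun_prop)).mul (ContDiff.mul ?_ ?_)
    · exact Complex.conjCLE.contDiff.comp (hb.comp contDiff_fst)
    · exact Complex.ofRealCLM.contDiff.comp (κ.contDiff.comp contDiff_snd)
  have hBsub : tsupport B ⊆ tsupport b ×ˢ Metric.closedBall (0 : H) (3 * δ / 4) := by
    refine closure_minimal (fun q hq => ?_) ((isClosed_tsupport b).prod Metric.isClosed_closedBall)
    have hq' := right_ne_zero_of_mul hq
    refine ⟨subset_tsupport _ ?_, ?_⟩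
    · have := left_ne_zero_of_mul hq'
      simpa using this
    · have h1 : κ q.2 ≠ 0 := by exact_mod_cast right_ne_zero_of_mul hq'
      have h2 : q.2 ∈ Function.support κ := h1
      rw [κ.support_eq] at h2
      exact Metric.ball_subset_closedBall h2
  have hBs : HasCompactSupport B := by
    refine HasCompactSupport.of_support_subset_isCompact
      (hbs.isCompact.prod (isCompact_closedBall (0 : H) (3 * δ / 4)))
      ((subset_tsupport _).trans hBsub)
  obtain ⟨C, hC0, hC⟩ := key B hBc hBs (fun q hq => by
    obtain ⟨h1, h2⟩ := hBsub hq
    refine ⟨hbδ h1, ?_⟩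
    rw [mem_closedBall_zero_iff] at h2
    linarith) (Module.finrank ℝ H + 1)
  set d := Module.finrank ℝ H
  have hρc : Continuous ρ := (ρ₀.contDiff_normed (n := 0)).continuous
  have hρs : HasCompactSupport ρ := ρ₀.hasCompactSupport_normed
  obtain ⟨M, hM⟩ := hρs.exists_bound_of_continuous hρc
  have hM0 : 0 ≤ M := (norm_nonneg _).trans (hM 0)
  let S : Set E := (fun q : E × H => q.1 - A q.2) ''
    ((Prod.fst '' tsupport b) ×ˢ Metric.closedBall (0 : H) (δ / 4))
  have hS : IsCompact S := ((hbs.isCompact.image continuous_fst).prod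
    (isCompact_closedBall _ _)).image (by fun_prop)
  set I₀ := ∫ k : H, (1 + ‖k‖) ^ (-((d + 1 : ℕ) : ℝ))
  refine ⟨volume.real S * (M * C * I₀), fun θ Λ hΛ => ?_⟩
  let F : E → ℂ := fun z => Complex.exp (Complex.I * ((Λ * φ (z, θ) : ℝ) : ℂ)) * b (z, θ)
  have hφc := hφ.continuous
  have hbc := hb.continuous
  have hF : Continuous F := by fun_prop
  have hD : ∀ k', ρ k' ≠ 0 → ∫ k, ρ k * ‖∫ y, F (y + A k) * (starRingEnd ℂ) (F (y + A k'))‖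
      ≤ M * C * ((Λ ^ d)⁻¹ * I₀) := by
    intro k' hk'
    rw [← integral_one_add_norm_smul_sub k' (d + 1) hΛ, ← integral_const_mul]
    refine integral_mono_of_nonneg (Filter.Eventually.of_forall fun k =>
      mul_nonneg (ρ₀.nonneg_normed k) (norm_nonneg _))
      ((integrable_one_add_norm_smul_sub k' (Nat.lt_succ_self d) hΛ).const_mul _)
      (Filter.Eventually.of_forall fun k => ?_)
    simp only
    by_cases hk : ρ k = 0
    · rw [hk]; simp only [zero_mul]; positivity
    have h1 : ∫ y, F (y + A k) * (starRingEnd ℂ) (F (y + A k')) =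
        ∫ y, Complex.exp (Complex.I *
          ((Λ * (φ ((y, θ) + J (k - k')) - φ (y, θ)) : ℝ) : ℂ)) * B ((y, θ), k - k') := by
      rw [← integral_add_right_eq_self (fun y => Complex.exp (Complex.I *
          ((Λ * (φ ((y, θ) + J (k - k')) - φ (y, θ)) : ℝ) : ℂ)) * B ((y, θ), k - k')) (A k')]
      congr 1
      ext y
      have hκ : κ (k - k') = 1 := κ.one_of_mem_closedBall (by
        rw [mem_closedBall_zero_iff]
        have := hρδ k hk; have := hρδ k' hk'; have := norm_sub_le k k'
        simp only [κ]; linarith)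
      have h2 : ((y + A k', θ) : E × Θ) + J (k - k') = (y + A k, θ) := by
        simp [hJ]
      simp only [F, B, hκ, h2, map_mul, ← Complex.exp_conj, Complex.conj_I, Complex.conj_ofReal]
      rw [mul_mul_mul_comm, ← Complex.exp_add]
      congr 2
      · push_cast; ring
      · simp
    rw [h1, mul_assoc]
    refine mul_le_mul ((Real.le_norm_self _).trans (hM k)) (hC θ (k - k') Λ hΛ.le)
      (norm_nonneg _) hM0
  have := sq_norm_integral_le_of_differencing hF A hρc hρs ρ₀.nonneg_normed
    ρ₀.integral_normed hS (fun y k hk hy => by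
      refine ⟨(y + A k, k), ⟨⟨(y + A k, θ), subset_tsupport _ (right_ne_zero_of_mul hy), rfl⟩, ?_⟩,
        by simp⟩
      rw [mem_closedBall_zero_iff]
      exact (hρδ k hk).le) hD
  calc Λ ^ d * ‖∫ z, F z‖ ^ 2 ≤ Λ ^ d * (volume.real S * (M * C * ((Λ ^ d)⁻¹ * I₀))) := by gcongr
    _ = _ := by field_simp

/-- The previous bound also holds near points where the phase is not stationary. -/
theorem stationary_phase_bound {φ : E × Θ → ℝ} (hφ : ContDiff ℝ (⊤ : ℕ∞) φ) (p₀ : E × Θ)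
    (h : (∃ ζ : E, fderiv ℝ φ p₀ (ζ, 0) ≠ 0) ∨ ∃ A : H →L[ℝ] E, ∀ k : H, k ≠ 0 →
      ∃ ζ : E, fderiv ℝ (fun p => fderiv ℝ φ p (A k, 0)) p₀ (ζ, 0) ≠ 0) :
    ∃ δ : ℝ, 0 < δ ∧ ∀ b : E × Θ → ℂ, ContDiff ℝ (⊤ : ℕ∞) b → HasCompactSupport b →
      tsupport b ⊆ Metric.ball p₀ δ → ∃ C : ℝ, ∀ (θ : Θ) (Λ : ℝ), 0 < Λ →
        Λ ^ Module.finrank ℝ H *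
          ‖∫ z, Complex.exp (Complex.I * ((Λ * φ (z, θ) : ℝ) : ℂ)) * b (z, θ)‖ ^ 2 ≤ C := by
  rcases h with ⟨ζ, hζ⟩ | ⟨A, hA⟩
  · have hc : Continuous fun q => fderiv ℝ φ q (ζ, 0) :=
      (hφ.continuous_fderiv (by simp)).clm_apply continuous_const
    obtain ⟨δ, hδ, hball⟩ := Metric.eventually_nhds_iff_ball.1
      (hc.continuousAt.eventually_ne hζ)
    refine ⟨δ, hδ, fun b hb hbs hbδ => ?_⟩
    have hne : ∀ q ∈ tsupport b, ∃ ζ : E, fderiv ℝ φ q (ζ, 0) ≠ 0 :=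
      fun q hq => ⟨ζ, hball q (hbδ hq)⟩
    obtain ⟨C, hC⟩ := nonstationary_phase hφ (Module.finrank ℝ H) hb hbs hne
    obtain ⟨C', hC'⟩ := nonstationary_phase hφ 0 hb hbs hne
    refine ⟨C * C', fun θ Λ hΛ => ?_⟩
    have h1 := hC θ Λ hΛ.le
    have h2 := hC' θ Λ hΛ.le
    rw [pow_zero, one_mul] at h2
    rw [sq, ← mul_assoc]
    exact mul_le_mul h1 h2 (norm_nonneg _) (le_trans (by positivity) h1)
  · exact stationary_phase_of_hessian hφ p₀ A hA

end localStationary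

theorem fderiv_eq_of_slice_eq {E Θ Z F : Type} [NormedAddCommGroup E] [NormedSpace ℝ E]
    [NormedAddCommGroup Θ] [NormedSpace ℝ Θ] [NormedAddCommGroup Z] [NormedSpace ℝ Z]
    [NormedAddCommGroup F] [NormedSpace ℝ F] {f : E × Θ → F} {g : Z × E → F}
    (hf : Differentiable ℝ f) (hg : Differentiable ℝ g) {θ : Θ} {z : Z}
    (h : ∀ y, f (y, θ) = g (z, y)) (y ζ : E) :
    fderiv ℝ f (y, θ) (ζ, 0) = fderiv ℝ g (z, y) (0, ζ) := by
  have h1 : HasFDerivAt (fun y => f (y, θ)) _ y := hasFDerivAt_slice hf y θ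
  have h2 : HasFDerivAt (fun y => g (z, y)) _ y :=
    HasFDerivAt.comp (g := g) y (hg (z, y)).hasFDerivAt (hasFDerivAt_prodMk_right z y)
  have h3 : (fun y => f (y, θ)) = fun y => g (z, y) := funext h
  rw [h3] at h1
  simpa using congrArg (fun L => L ζ) (h1.unique h2)

theorem contDiff_fderiv_apply_const {X F : Type} [NormedAddCommGroup X] [NormedSpace ℝ X]
    [NormedAddCommGroup F] [NormedSpace ℝ F] {g : X → F} (hg : ContDiff ℝ (⊤ : ℕ∞) g) (v : X) :
    ContDiff ℝ (⊤ : ℕ∞) fun q => fderiv ℝ g q v :=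
  (hg.fderiv_right (by simp)).clm_apply contDiff_const

section kernel

variable {Z E H : Type} [NormedAddCommGroup Z] [NormedSpace ℝ Z] [FiniteDimensional ℝ Z]
  [NormedAddCommGroup E] [NormedSpace ℝ E] [FiniteDimensional ℝ E]
  [MeasureSpace E] [BorelSpace E] [(volume : Measure E).IsAddHaarMeasure]
  [NormedAddCommGroup H] [NormedSpace ℝ H] [FiniteDimensional ℝ H]
  [MeasureSpace H] [BorelSpace H] [(volume : Measure H).IsAddHaarMeasure]

/-- Decay of the kernel of `T T*` for an oscillatory integral operator `T`. -/
theorem oscillatory_kernel_bound {ψ : Z × E → ℝ} (hψ : ContDiff ℝ (⊤ : ℕ∞) ψ) (z₀ : Z) (y₀ : E)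
    (h : ∀ u : Z, u ≠ 0 →
      (∃ ζ : E, fderiv ℝ (fun q => fderiv ℝ ψ q (u, 0)) (z₀, y₀) (0, ζ) ≠ 0) ∨
      ∃ A : H →L[ℝ] E, ∀ k : H, k ≠ 0 → ∃ ζ : E,
        fderiv ℝ (fun q => fderiv ℝ (fun q' => fderiv ℝ ψ q' (u, 0)) q (0, A k))
          (z₀, y₀) (0, ζ) ≠ 0) :
    ∃ δ : ℝ, 0 < δ ∧ ∀ A : Z × E → ℂ, ContDiff ℝ (⊤ : ℕ∞) A → HasCompactSupport A →
      tsupport A ⊆ Metric.ball (z₀, y₀) δ → ∃ C : ℝ, 0 ≤ C ∧ ∀ (lam : ℝ) (z w : Z),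
          0 < lam → z ≠ w →
        (lam * ‖w - z‖) ^ Module.finrank ℝ H *
          ‖∫ y, Complex.exp (Complex.I * ((lam * (ψ (w, y) - ψ (z, y)) : ℝ) : ℂ)) *
            (A (w, y) * (starRingEnd ℂ) (A (z, y)))‖ ^ 2 ≤ C := by
  let Ψ : E × (Z × ℝ × Z) → ℝ := fun q => diffQuot ψ (q.2.1, q.1) q.2.2.1 (q.2.2.2, 0)
  have hΨ : ContDiff ℝ (⊤ : ℕ∞) Ψ := (contDiff_diffQuot hψ).comp
    (f := fun q : E × (Z × ℝ × Z) => ((q.2.1, q.1), q.2.2.1, (q.2.2.2, (0 : E)))) (by fun_prop)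
  have hloc : ∀ u ∈ Metric.sphere (0 : Z) 1, ∃ δ : ℝ, 0 < δ ∧ ∀ b : E × (Z × ℝ × Z) → ℂ,
      ContDiff ℝ (⊤ : ℕ∞) b → HasCompactSupport b →
      tsupport b ⊆ Metric.ball (y₀, (z₀, 0, u)) δ → ∃ C : ℝ, ∀ θ (Λ : ℝ), 0 < Λ →
        Λ ^ Module.finrank ℝ H *
          ‖∫ y, Complex.exp (Complex.I * ((Λ * Ψ (y, θ) : ℝ) : ℂ)) * b (y, θ)‖ ^ 2 ≤ C := by
    intro u hu
    have hu0 : u ≠ 0 := ne_zero_of_mem_unit_sphere ⟨u, hu⟩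
    have hg := contDiff_fderiv_apply_const hψ ((u, 0) : Z × E)
    have e1 : ∀ y ζ, fderiv ℝ Ψ (y, (z₀, 0, u)) (ζ, 0) =
        fderiv ℝ (fun q => fderiv ℝ ψ q (u, 0)) (z₀, y) (0, ζ) :=
      fderiv_eq_of_slice_eq (hΨ.differentiable (by simp)) (hg.differentiable (by simp))
        fun y => diffQuot_zero _ _
    refine stationary_phase_bound hΨ _ ((h u hu0).imp ?_ ?_)
    · rintro ⟨ζ, hζ⟩
      exact ⟨ζ, by rwa [e1]⟩
    · rintro ⟨A, hA⟩
      refine ⟨A, fun k hk => (hA k hk).imp fun ζ hζ => ?_⟩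
      rwa [fderiv_eq_of_slice_eq
        ((contDiff_fderiv_apply_const hΨ _).differentiable (by simp))
        ((contDiff_fderiv_apply_const hg _).differentiable (by simp)) (fun y => e1 y (A k))]
  choose! r hr hrb using hloc
  obtain ⟨t, htS, htc⟩ := (isCompact_sphere (0 : Z) 1).elim_nhds_subcover
    (fun u => Metric.ball u (r u / 4)) fun u hu => Metric.ball_mem_nhds u (by linarith [hr u hu])
  obtain ⟨δ, hδ, hδr⟩ : ∃ δ : ℝ, 0 < δ ∧ ∀ u ∈ t, 4 * δ ≤ r u := by
    have : ∀ᶠ δ in nhdsWithin (0 : ℝ) (Set.Ioi 0), ∀ u ∈ t, 4 * δ ≤ r u := by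
      rw [Filter.eventually_all_finset]
      intro u hu
      have := hr u (htS u hu)
      filter_upwards [Ioo_mem_nhdsGT (show (0 : ℝ) < r u / 4 by linarith)] with x hx
      linarith [hx.2]
    obtain ⟨δ, h1, h2⟩ := (this.and self_mem_nhdsWithin).exists
    exact ⟨δ, h2, h1⟩
  refine ⟨δ, hδ, fun A hA hAs hAδ => ?_⟩
  let κ : ContDiffBump (0 : ℝ) := ⟨2 * δ, 3 * δ, by positivity, by linarith⟩
  have hpiece : ∀ u ∈ t, ∃ C : ℝ, 0 ≤ C ∧ ∀ (lam : ℝ) (z w : Z), 0 < lam → z ≠ w →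
      (‖w - z‖⁻¹ • (w - z)) ∈ Metric.ball u (r u / 4) →
        (lam * ‖w - z‖) ^ Module.finrank ℝ H *
          ‖∫ y, Complex.exp (Complex.I * ((lam * (ψ (w, y) - ψ (z, y)) : ℝ) : ℂ)) *
            (A (w, y) * (starRingEnd ℂ) (A (z, y)))‖ ^ 2 ≤ C := by
    intro u hut
    have hru := hr u (htS u hut)
    let χ : ContDiffBump u := ⟨r u / 4, r u / 2, by positivity, by linarith⟩
    let b : E × (Z × ℝ × Z) → ℂ := fun q =>
      (A (q.2.1 + q.2.2.1 • q.2.2.2, q.1) * (starRingEnd ℂ) (A (q.2.1, q.1))) *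
        ((χ q.2.2.2 * κ q.2.2.1 : ℝ) : ℂ)
    have hb : ContDiff ℝ (⊤ : ℕ∞) b := by
      refine ContDiff.mul (ContDiff.mul ?_ ?_) ?_
      · exact hA.comp (by fun_prop)
      · exact Complex.conjCLE.contDiff.comp (hA.comp (by fun_prop))
      · exact Complex.ofRealCLM.contDiff.comp
          ((χ.contDiff.comp (by fun_prop)).mul (κ.contDiff.comp (by fun_prop)))
    let W : Set (E × (Z × ℝ × Z)) := (fun q : (Z × E) × (ℝ × Z) => (q.1.2, (q.1.1, q.2))) ''
      (tsupport A ×ˢ (Metric.closedBall (0 : ℝ) (3 * δ) ×ˢ Metric.closedBall u (r u / 2)))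
    have hW : IsCompact W := (hAs.isCompact.prod
      ((isCompact_closedBall _ _).prod (isCompact_closedBall _ _))).image (by fun_prop)
    have hbW : Function.support b ⊆ W := by
      rintro ⟨y, z, ρ, v⟩ hq
      have h1 := left_ne_zero_of_mul hq
      have h2 : χ v * κ ρ ≠ 0 := by exact_mod_cast right_ne_zero_of_mul hq
      have h3 : v ∈ Function.support χ := left_ne_zero_of_mul h2
      have h4 : ρ ∈ Function.support κ := right_ne_zero_of_mul h2
      rw [χ.support_eq] at h3
      rw [κ.support_eq] at h4
      refine ⟨((z, y), (ρ, v)), ⟨subset_tsupport _ ?_, Metric.ball_subset_closedBall h4,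
        Metric.ball_subset_closedBall h3⟩, rfl⟩
      have := right_ne_zero_of_mul h1
      simpa using this
    have hbs : HasCompactSupport b := HasCompactSupport.of_support_subset_isCompact hW hbW
    have hbt : tsupport b ⊆ Metric.ball (y₀, (z₀, 0, u)) (r u) := by
      refine (closure_minimal hbW hW.isClosed).trans ?_
      rintro _ ⟨⟨⟨z, y⟩, ρ, v⟩, ⟨h1, h2, h3⟩, rfl⟩
      have h4 := hAδ h1
      have := hδr u hut
      simp only [Metric.mem_ball, Metric.mem_closedBall, Prod.dist_eq, max_lt_iff] at h2 h3 h4 ⊢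
      refine ⟨by linarith, by linarith, by linarith, by linarith⟩
    obtain ⟨C, hC⟩ := hrb u (htS u hut) b hb hbs hbt
    refine ⟨|C|, abs_nonneg _, fun lam z w hlam hzw hu => ?_⟩
    have hn : 0 < ‖w - z‖ := norm_pos_iff.2 (sub_ne_zero.2 hzw.symm)
    refine le_trans (le_of_eq ?_) ((hC (z, ‖w - z‖, ‖w - z‖⁻¹ • (w - z)) (lam * ‖w - z‖)
      (by positivity)).trans (le_abs_self C))
    congr 3
    congr 1
    ext y
    have hzw' : z + ‖w - z‖ • ‖w - z‖⁻¹ • (w - z) = w := by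
      rw [smul_inv_smul₀ hn.ne']; simp
    have e1 : lam * ‖w - z‖ * Ψ (y, (z, ‖w - z‖, ‖w - z‖⁻¹ • (w - z))) =
        lam * (ψ (w, y) - ψ (z, y)) := by
      simp only [Ψ]
      rw [mul_assoc, mul_diffQuot hψ]
      simp only [Prod.smul_mk, Prod.mk_add_mk, hzw', smul_zero, add_zero]
    have e2 : A (w, y) * (starRingEnd ℂ) (A (z, y)) =
        b (y, (z, ‖w - z‖, ‖w - z‖⁻¹ • (w - z))) := by
      simp only [b, hzw']
      rw [χ.one_of_mem_closedBall (Metric.ball_subset_closedBall hu), one_mul]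
      by_cases hA0 : A (w, y) * (starRingEnd ℂ) (A (z, y)) = 0
      · rw [hA0, zero_mul]
      · have h1 := hAδ (subset_tsupport _ (left_ne_zero_of_mul hA0))
        have h2 := hAδ (subset_tsupport A (a := (z, y)) (by
          have := right_ne_zero_of_mul hA0
          simpa using this))
        simp only [Metric.mem_ball, Prod.dist_eq, max_lt_iff] at h1 h2
        rw [κ.one_of_mem_closedBall]
        · simp
        · rw [mem_closedBall_zero_iff, norm_norm, ← dist_eq_norm]
          simp only [κ]
          linarith [dist_triangle_right w z z₀, h1.1, h2.1]
    rw [e1, e2]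
  choose! C hC0 hC using hpiece
  refine ⟨∑ u ∈ t, C u, Finset.sum_nonneg hC0, fun lam z w hlam hzw => ?_⟩
  have hn : 0 < ‖w - z‖ := norm_pos_iff.2 (sub_ne_zero.2 hzw.symm)
  have : (‖w - z‖⁻¹ • (w - z)) ∈ Metric.sphere (0 : Z) 1 := by
    simp [norm_smul, hn.ne']
  obtain ⟨u, hut, hu⟩ := Set.mem_iUnion₂.1 (htc this)
  exact (hC u hut lam z w hlam hzw hu).trans (Finset.single_le_sum hC0 hut)

end kernel

section compactSupport

variable {α β F : Type} [TopologicalSpace α] [TopologicalSpace β] [NormedAddCommGroup F]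
  [NormedSpace ℝ F]

theorem HasCompactSupport.integral_right [MeasureSpace β] [T2Space α]
    {f : α × β → F} (hfs : HasCompactSupport f) : HasCompactSupport fun a => ∫ b, f (a, b) := by
  refine HasCompactSupport.intro (hfs.isCompact.image continuous_fst) fun a ha => ?_
  refine integral_eq_zero_of_ae (Filter.Eventually.of_forall fun b => ?_)
  by_contra h
  exact ha ⟨(a, b), subset_tsupport _ h, rfl⟩

theorem Continuous.integral_right [MeasureSpace β] [OpensMeasurableSpace β]
    [IsLocallyFiniteMeasure (volume : Measure β)] [FirstCountableTopology α]
    [LocallyCompactSpace α] [SecondCountableTopologyEither β F] [T2Space β]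
    {f : α × β → F} (hf : Continuous f) (hfs : HasCompactSupport f) :
    Continuous fun a => ∫ b, f (a, b) := by
  have hK := hfs.isCompact.image continuous_snd
  have h1 : (fun a => ∫ b, f (a, b)) = fun a => ∫ b in Prod.snd '' tsupport f, f (a, b) := by
    funext a
    refine (setIntegral_eq_integral_of_forall_compl_eq_zero fun b hb => ?_).symm
    by_contra h
    exact hb ⟨(a, b), subset_tsupport _ h, rfl⟩
  rw [h1]
  exact continuous_parametric_integral_of_continuous (f := fun a b => f (a, b)) hf hK

theorem HasCompactSupport.slice_left {F : Type} [Zero F] [T2Space β] {f : α × β → F}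
    (hfs : HasCompactSupport f) (a : α) : HasCompactSupport fun b => f (a, b) := by
  refine HasCompactSupport.intro (hfs.isCompact.image continuous_snd) fun b hb => ?_
  by_contra h
  exact hb ⟨(a, b), subset_tsupport _ h, rfl⟩

theorem HasCompactSupport.slice_right {F : Type} [Zero F] [T2Space α] {f : α × β → F}
    (hfs : HasCompactSupport f) (b : β) : HasCompactSupport fun a => f (a, b) := by
  refine HasCompactSupport.intro (hfs.isCompact.image continuous_fst) fun a ha => ?_
  by_contra h
  exact ha ⟨(a, b), subset_tsupport _ h, rfl⟩

end compactSupport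

section bilinear

variable {X Y : Type} [NormedAddCommGroup X] [NormedSpace ℝ X] [FiniteDimensional ℝ X]
  [MeasureSpace X] [BorelSpace X] [(volume : Measure X).IsAddHaarMeasure]
  [NormedAddCommGroup Y] [NormedSpace ℝ Y] [FiniteDimensional ℝ Y]
  [MeasureSpace Y] [BorelSpace Y] [(volume : Measure Y).IsAddHaarMeasure]

theorem integral_conj_mul_eq {g₁ g₂ : X → ℂ} (hg₁ : Continuous g₁) (hg₂ : Continuous g₂)
    {K₁ K₂ : X × Y → ℂ} (hK₁ : Continuous K₁) (hKs₁ : HasCompactSupport K₁)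
    (hK₂ : Continuous K₂) (hKs₂ : HasCompactSupport K₂) :
    ∫ y, (starRingEnd ℂ) (∫ x, g₁ x * K₁ (x, y)) * ∫ x', g₂ x' * K₂ (x', y) =
      ∫ x, ∫ x', (starRingEnd ℂ) (g₁ x) * g₂ x' *
        ∫ y, K₂ (x', y) * (starRingEnd ℂ) (K₁ (x, y)) := by
  let R : Y × X × X → ℂ := fun q =>
    (starRingEnd ℂ) (g₁ q.2.1 * K₁ (q.2.1, q.1)) * (g₂ q.2.2 * K₂ (q.2.2, q.1))
  have hR : Continuous R := by
    refine Continuous.mul (Complex.continuous_conj.comp ?_) ?_ <;> fun_prop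
  have hRs : HasCompactSupport R := by
    refine HasCompactSupport.of_support_subset_isCompact
      ((hKs₁.isCompact.prod hKs₂.isCompact).image
        (f := fun q : (X × Y) × (X × Y) => (q.1.2, q.1.1, q.2.1)) (by fun_prop)) ?_
    rintro ⟨y, x, x'⟩ hq
    have h1 : K₁ (x, y) ≠ 0 := by
      have := left_ne_zero_of_mul hq
      exact right_ne_zero_of_mul ((map_ne_zero _).1 this)
    exact ⟨((x, y), (x', y)), ⟨subset_tsupport _ h1,
      subset_tsupport _ (right_ne_zero_of_mul (right_ne_zero_of_mul hq))⟩, rfl⟩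
  have h1 : ∀ y, (starRingEnd ℂ) (∫ x, g₁ x * K₁ (x, y)) * ∫ x', g₂ x' * K₂ (x', y) =
      ∫ x, ∫ x', R (y, x, x') := by
    intro y
    rw [← integral_conj, ← integral_mul_const]
    simp only [R, integral_const_mul]
  simp_rw [h1]
  let R' : (Y × X) × X → ℂ := fun q => R (q.1.1, q.1.2, q.2)
  have hR' : Continuous R' := by fun_prop
  have hRs' : HasCompactSupport R' := hRs.comp_homeomorph (Homeomorph.prodAssoc Y X X)
  rw [integral_integral_swap_of_hasCompactSupport (f := fun y x => ∫ x', R (y, x, x'))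
    (hR'.integral_right hRs') hRs'.integral_right]
  congr 1
  ext x
  have hx : HasCompactSupport fun q : Y × X => R (q.1, x, q.2) := by
    refine HasCompactSupport.of_support_subset_isCompact
      (hRs.isCompact.image (f := fun q : Y × X × X => (q.1, q.2.2)) (by fun_prop)) ?_
    rintro ⟨y, x'⟩ hq
    exact ⟨(y, x, x'), subset_tsupport _ hq, rfl⟩
  rw [integral_integral_swap_of_hasCompactSupport (f := fun y x' => R (y, x, x'))
    (by simp only [Function.uncurry_def]; fun_prop) hx]
  congr 1
  ext x'
  rw [← integral_const_mul]
  congr 1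
  ext y
  simp only [R, map_mul]
  ring

theorem norm_integral_conj_mul_le {g₁ g₂ : X → ℂ} (hg₁ : Continuous g₁) (hg₂ : Continuous g₂)
    (hgs₁ : HasCompactSupport g₁) (hgs₂ : HasCompactSupport g₂)
    {K₁ K₂ : X × Y → ℂ} (hK₁ : Continuous K₁) (hKs₁ : HasCompactSupport K₁)
    (hK₂ : Continuous K₂) (hKs₂ : HasCompactSupport K₂) {D : ℝ}
    (hD : ∀ x x', ‖∫ y, K₂ (x', y) * (starRingEnd ℂ) (K₁ (x, y))‖ ≤ D) :
    ‖∫ y, (starRingEnd ℂ) (∫ x, g₁ x * K₁ (x, y)) * ∫ x', g₂ x' * K₂ (x', y)‖ ≤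
      D * ((∫ x, ‖g₁ x‖) * ∫ x, ‖g₂ x‖) := by
  rw [integral_conj_mul_eq hg₁ hg₂ hK₁ hKs₁ hK₂ hKs₂]
  have hi₁ := (hg₁.integrable_of_hasCompactSupport (μ := volume) hgs₁).norm
  have hi₂ := (hg₂.integrable_of_hasCompactSupport (μ := volume) hgs₂).norm
  have hx : ∀ x, ‖∫ x', (starRingEnd ℂ) (g₁ x) * g₂ x' *
        ∫ y, K₂ (x', y) * (starRingEnd ℂ) (K₁ (x, y))‖ ≤ ‖g₁ x‖ * (D * ∫ x, ‖g₂ x‖) := by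
    intro x
    rw [mul_left_comm, ← integral_const_mul, ← integral_const_mul]
    refine norm_integral_le_of_norm_le ((hi₂.const_mul _).const_mul _)
      (Filter.Eventually.of_forall fun x' => ?_)
    rw [norm_mul, norm_mul, RCLike.norm_conj, mul_comm]
    exact mul_le_mul_of_nonneg_right (hD x x') (by positivity)
  refine (norm_integral_le_of_norm_le (hi₁.mul_const _)
    (Filter.Eventually.of_forall hx)).trans (le_of_eq ?_)
  rw [integral_mul_const]
  ring

/-- Schur's test for the kernel of `T T*`. -/
theorem integral_sq_norm_le_of_schur {g : X → ℂ} (hg : Continuous g) (hgs : HasCompactSupport g)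
    {K : X × Y → ℂ} (hK : Continuous K) (hKs : HasCompactSupport K) {D : ℝ}
    (hD : ∀ x, ∫ x', ‖∫ y, K (x', y) * (starRingEnd ℂ) (K (x, y))‖ ≤ D) :
    ∫ y, ‖∫ x, g x * K (x, y)‖ ^ 2 ≤ D * ∫ x, ‖g x‖ ^ 2 := by
  let k : X → X → ℂ := fun x x' => ∫ y, K (x', y) * (starRingEnd ℂ) (K (x, y))
  let R : (X × X) × Y → ℂ := fun q => K (q.1.2, q.2) * (starRingEnd ℂ) (K (q.1.1, q.2))
  have hR : Continuous R := (hK.comp (by fun_prop)).mul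
    (Complex.continuous_conj.comp (hK.comp (by fun_prop)))
  have hRs : HasCompactSupport R := by
    refine HasCompactSupport.of_support_subset_isCompact
      ((hKs.isCompact.prod hKs.isCompact).image
        (f := fun q : (X × Y) × (X × Y) => ((q.1.1, q.2.1), q.1.2)) (by fun_prop)) ?_
    rintro ⟨⟨x, x'⟩, y⟩ hq
    have h1 : K (x, y) ≠ 0 := (map_ne_zero _).1 (right_ne_zero_of_mul hq)
    exact ⟨((x, y), (x', y)), ⟨subset_tsupport _ h1,
      subset_tsupport _ (left_ne_zero_of_mul hq)⟩, rfl⟩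
  have hk : Continuous (Function.uncurry k) := hR.integral_right hRs
  have hks : HasCompactSupport (Function.uncurry k) := hRs.integral_right
  have hsymm : ∀ x x', ‖k x x'‖ = ‖k x' x‖ := by
    intro x x'
    rw [← RCLike.norm_conj (k x x')]
    simp only [k, ← integral_conj, map_mul, RCLike.conj_conj]
    simp_rw [mul_comm]
  have e1 : ((∫ y, ‖∫ x, g x * K (x, y)‖ ^ 2 : ℝ) : ℂ) =
      ∫ x, ∫ x', (starRingEnd ℂ) (g x) * g x' * k x x' := by
    rw [← integral_conj_mul_eq hg hg hK hKs hK hKs, ← integral_complex_ofReal]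
    congr 1
    ext y
    rw [mul_comm, Complex.mul_conj, Complex.normSq_eq_norm_sq]
  let M : X × X → ℝ := fun q => ‖g q.1‖ ^ 2 * ‖k q.1 q.2‖
  let M' : X × X → ℝ := fun q => ‖g q.2‖ ^ 2 * ‖k q.1 q.2‖
  have hM : Continuous M := (by fun_prop : Continuous fun q : X × X => ‖g q.1‖ ^ 2).mul hk.norm
  have hM' : Continuous M' := (by fun_prop : Continuous fun q : X × X => ‖g q.2‖ ^ 2).mul hk.norm
  have hMs : HasCompactSupport M := hks.norm.mul_left
  have hMs' : HasCompactSupport M' := hks.norm.mul_left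
  have hswap : ∫ x, ∫ x', M' (x, x') = ∫ x, ∫ x', M (x, x') := by
    rw [integral_integral_swap_of_hasCompactSupport (f := fun x x' => M' (x, x')) hM' hMs']
    simp only [M, M', hsymm]
  have hMle : ∫ x, ∫ x', M (x, x') ≤ D * ∫ x, ‖g x‖ ^ 2 := by
    rw [← integral_const_mul]
    refine integral_mono ((hM.integral_right hMs).integrable_of_hasCompactSupport
      hMs.integral_right) (((by fun_prop : Continuous fun x => ‖g x‖ ^ 2
      ).integrable_of_hasCompactSupport 
        (hgs.comp_left (g := fun c => ‖c‖ ^ 2) (by simp))).const_mul _) fun x => ?_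
    simp only [M, integral_const_mul]
    rw [mul_comm]
    exact mul_le_mul_of_nonneg_right (hD x) (by positivity)
  have hi : ∀ x, Integrable fun x' => M (x, x') := fun x =>
    (hM.comp (by fun_prop : Continuous fun x' => (x, x'))).integrable_of_hasCompactSupport
      (hMs.slice_left x)
  have hi' : ∀ x, Integrable fun x' => M' (x, x') := fun x =>
    (hM'.comp (by fun_prop : Continuous fun x' => (x, x'))).integrable_of_hasCompactSupport
      (hMs'.slice_left x)
  calc ∫ y, ‖∫ x, g x * K (x, y)‖ ^ 2
      = ‖((∫ y, ‖∫ x, g x * K (x, y)‖ ^ 2 : ℝ) : ℂ)‖ := by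
        rw [Complex.norm_real, Real.norm_of_nonneg (integral_nonneg fun y => by positivity)]
    _ = ‖∫ x, ∫ x', (starRingEnd ℂ) (g x) * g x' * k x x'‖ := by rw [e1]
    _ ≤ ∫ x, (1 / 2) * ((∫ x', M (x, x')) + ∫ x', M' (x, x')) := by
        refine norm_integral_le_of_norm_le (((((hM.integral_right hMs
          ).integrable_of_hasCompactSupport hMs.integral_right)).add
          ((hM'.integral_right hMs').integrable_of_hasCompactSupport
            hMs'.integral_right)).const_mul _) (Filter.Eventually.of_forall fun x => ?_)
        rw [← integral_add (hi x) (hi' x), ← integral_const_mul]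
        refine norm_integral_le_of_norm_le (((hi x).add (hi' x)).const_mul _)
          (Filter.Eventually.of_forall fun x' => ?_)
        simp only [norm_mul, RCLike.norm_conj, M, M']
        nlinarith [mul_nonneg (sq_nonneg (‖g x‖ - ‖g x'‖)) (norm_nonneg (k x x'))]
    _ = ∫ x, ∫ x', M (x, x') := by
        rw [integral_const_mul, integral_add ((hM.integral_right hMs
          ).integrable_of_hasCompactSupport hMs.integral_right)
          ((hM'.integral_right hMs').integrable_of_hasCompactSupport
            hMs'.integral_right), hswap]
        ring
    _ ≤ _ := hMle

end bilinear

section slab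

variable {X Y : Type} [NormedAddCommGroup X] [NormedSpace ℝ X] [FiniteDimensional ℝ X]
  [MeasureSpace X] [BorelSpace X] [(volume : Measure X).IsAddHaarMeasure]
  [NormedAddCommGroup Y] [NormedSpace ℝ Y] [FiniteDimensional ℝ Y]
  [MeasureSpace Y] [BorelSpace Y] [(volume : Measure Y).IsAddHaarMeasure]

theorem integral_integral_add_mul {l : ℝ → ℝ} (hl : Continuous l) (hls : HasCompactSupport l) :
    Integrable (fun t => ∫ s, l s * l (s + t)) ∧
      ∫ t, ∫ s, l s * l (s + t) = (∫ s, l s) ^ 2 := by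
  let R : ℝ × ℝ → ℝ := fun q => l q.2 * l (q.2 + q.1)
  have hR : Continuous R := by fun_prop
  have hRs : HasCompactSupport R := by
    refine HasCompactSupport.of_support_subset_isCompact
      ((hls.isCompact.prod hls.isCompact).image
        (f := fun q : ℝ × ℝ => (q.2 - q.1, q.1)) (by fun_prop)) ?_
    rintro ⟨t, s⟩ hq
    exact ⟨(s, s + t), ⟨subset_tsupport _ (left_ne_zero_of_mul hq),
      subset_tsupport _ (right_ne_zero_of_mul hq)⟩, by simp⟩
  refine ⟨(hR.integral_right hRs).integrable_of_hasCompactSupport hRs.integral_right, ?_⟩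
  rw [integral_integral_swap_of_hasCompactSupport (f := fun t s => l s * l (s + t)) hR hRs]
  have : ∀ s, ∫ t, l s * l (s + t) = l s * ∫ t, l t := fun s => by
    rw [integral_const_mul, integral_add_left_eq_self]
  simp_rw [this]
  rw [integral_mul_const, sq]

/-- An `L²` bound for an operator whose `T T*` kernel satisfies Schur's test on each slice
`s = const`, and is bounded pointwise away from the slices. -/
theorem integral_sq_norm_le_of_slices {g : ℝ × X → ℂ} (hg : Continuous g)
    (hgs : HasCompactSupport g) {K : (ℝ × X) × Y → ℂ} (hK : Continuous K)
    (hKs : HasCompactSupport K) {D₁ D₂ r : ℝ} (hr : 0 ≤ r)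
    (hD₁ : ∀ s x, ∫ x', ‖∫ y, K ((s, x'), y) * (starRingEnd ℂ) (K ((s, x), y))‖ ≤ D₁)
    (hD₂ : ∀ s s', r ≤ |s' - s| → ∀ x x',
      ‖∫ y, K ((s', x'), y) * (starRingEnd ℂ) (K ((s, x), y))‖ ≤ D₂) :
    ∫ y, ‖∫ s, ∫ x, g (s, x) * K ((s, x), y)‖ ^ 2 ≤
      2 * r * D₁ * (∫ s, ∫ x, ‖g (s, x)‖ ^ 2) + D₂ * (∫ s, ∫ x, ‖g (s, x)‖) ^ 2 := by
  have hD₁0 : 0 ≤ D₁ := (integral_nonneg fun x' => norm_nonneg _).trans (hD₁ 0 0)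
  have hD₂0 : 0 ≤ D₂ := (norm_nonneg _).trans (hD₂ 0 r (by simp [le_abs_self]) 0 0)
  have hgc : ∀ s, Continuous fun x => g (s, x) := fun s => by fun_prop
  have hKc : ∀ s, Continuous fun q : X × Y => K ((s, q.1), q.2) := fun s => by fun_prop
  have hKsc : ∀ s, HasCompactSupport fun q : X × Y => K ((s, q.1), q.2) := by
    intro s
    refine HasCompactSupport.of_support_subset_isCompact
      (hKs.isCompact.image (f := fun q : (ℝ × X) × Y => (q.1.2, q.2)) (by fun_prop)) ?_
    rintro ⟨x, y⟩ hq
    exact ⟨((s, x), y), subset_tsupport _ hq, rfl⟩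
  let P₀ : (ℝ × Y) × X → ℂ := fun q => g (q.1.1, q.2) * K ((q.1.1, q.2), q.1.2)
  have hP₀ : Continuous P₀ := by fun_prop
  have hP₀s : HasCompactSupport P₀ := by
    refine HasCompactSupport.of_support_subset_isCompact
      (hKs.isCompact.image (f := fun q : (ℝ × X) × Y => ((q.1.1, q.2), q.1.2)) (by fun_prop)) ?_
    rintro ⟨⟨s, y⟩, x⟩ hq
    exact ⟨((s, x), y), subset_tsupport _ (right_ne_zero_of_mul hq), rfl⟩
  let P : ℝ × Y → ℂ := fun q => ∫ x, P₀ (q, x)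
  have hP : Continuous P := hP₀.integral_right hP₀s
  have hPs : HasCompactSupport P := hP₀s.integral_right
  let n : ℝ → ℝ := fun s => ∫ x, ‖g (s, x)‖ ^ 2
  let l : ℝ → ℝ := fun s => ∫ x, ‖g (s, x)‖
  have hgns : HasCompactSupport fun q => ‖g q‖ ^ 2 :=
    hgs.comp_left (g := fun c => ‖c‖ ^ 2) (by simp)
  have hn : Continuous n := Continuous.integral_right (f := fun q => ‖g q‖ ^ 2) (by fun_prop) hgns
  have hns : HasCompactSupport n := hgns.integral_right
  have hl : Continuous l := Continuous.integral_right (f := fun q => ‖g q‖) (by fun_prop) hgs.norm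
  have hls : HasCompactSupport l := hgs.norm.integral_right
  let q : ℝ → ℝ := fun s => ∫ y, ‖P (s, y)‖ ^ 2
  have hqs₀ : HasCompactSupport fun p => ‖P p‖ ^ 2 :=
    hPs.comp_left (g := fun c => ‖c‖ ^ 2) (by simp)
  have hq : Continuous q := Continuous.integral_right (f := fun p => ‖P p‖ ^ 2) (by fun_prop) hqs₀
  have hqs : HasCompactSupport q := hqs₀.integral_right
  have hqi : Integrable q := hq.integrable_of_hasCompactSupport hqs
  have hqn : ∫ s, q s ≤ D₁ * ∫ s, n s := by
    rw [← integral_const_mul]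
    refine integral_mono hqi ((hn.integrable_of_hasCompactSupport hns).const_mul _) fun s => ?_
    exact integral_sq_norm_le_of_schur (hgc s) (hgs.slice_left s) (hKc s) (hKsc s) (hD₁ s)
  let R : (ℝ × ℝ) × Y → ℂ := fun p => (starRingEnd ℂ) (P (p.1.2, p.2)) * P (p.1.2 + p.1.1, p.2)
  have hR : Continuous R := (Complex.continuous_conj.comp (hP.comp (by fun_prop))).mul
    (hP.comp (by fun_prop))
  have hRK : IsCompact ((fun p : (ℝ × Y) × (ℝ × Y) => ((p.2.1 - p.1.1, p.1.1), p.1.2)) ''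
      (tsupport P ×ˢ tsupport P)) :=
    (hPs.isCompact.prod hPs.isCompact).image (by fun_prop)
  have hRsub : ∀ t s y, R ((t, s), y) ≠ 0 → ((t, s), y) ∈
      (fun p : (ℝ × Y) × (ℝ × Y) => ((p.2.1 - p.1.1, p.1.1), p.1.2)) ''
      (tsupport P ×ˢ tsupport P) := by
    intro t s y h
    have h1 : P (s, y) ≠ 0 := (map_ne_zero _).1 (left_ne_zero_of_mul h)
    exact ⟨((s, y), (s + t, y)), ⟨subset_tsupport _ h1,
      subset_tsupport _ (right_ne_zero_of_mul h)⟩, by simp⟩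
  have hRs : HasCompactSupport R :=
    HasCompactSupport.of_support_subset_isCompact hRK fun p hp => hRsub p.1.1 p.1.2 p.2 hp
  let W : ℝ × ℝ → ℂ := fun p => ∫ y, R (p, y)
  have hW : Continuous W := hR.integral_right hRs
  have hWs : HasCompactSupport W := hRs.integral_right
  have e1 : ((∫ y, ‖∫ s, P (s, y)‖ ^ 2 : ℝ) : ℂ) = ∫ t, ∫ s, W (t, s) := by
    have e2 : ∀ y, ((‖∫ s, P (s, y)‖ ^ 2 : ℝ) : ℂ) = ∫ t, ∫ s, R ((t, s), y) := by
      intro y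
      have hsl : HasCompactSupport fun p : ℝ × ℝ => R (p, y) := hRs.slice_right y
      rw [integral_integral_swap_of_hasCompactSupport (f := fun t s => R ((t, s), y))
        (by simp only [Function.uncurry_def]; fun_prop) hsl]
      have e3 : ∀ s, ∫ t, R ((t, s), y) = (starRingEnd ℂ) (P (s, y)) * ∫ t, P (t, y) := by
        intro s
        simp only [R]
        rw [integral_const_mul, integral_add_left_eq_self (fun t => P (t, y))]
      simp_rw [e3]
      rw [integral_mul_const, integral_conj, mul_comm, Complex.mul_conj, Complex.normSq_eq_norm_sq]
    rw [← integral_complex_ofReal]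
    simp_rw [e2]
    let R₁ : (Y × ℝ) × ℝ → ℂ := fun p => R ((p.1.2, p.2), p.1.1)
    have hR₁ : Continuous R₁ := by fun_prop
    have hR₁s : HasCompactSupport R₁ := by
      refine HasCompactSupport.of_support_subset_isCompact
        (hRK.image (f := fun p : (ℝ × ℝ) × Y => ((p.2, p.1.1), p.1.2)) (by fun_prop)) ?_
      rintro ⟨⟨y, t⟩, s⟩ h
      exact ⟨((t, s), y), hRsub t s y h, rfl⟩
    rw [integral_integral_swap_of_hasCompactSupport (f := fun y t => ∫ s, R ((t, s), y))
      (hR₁.integral_right hR₁s) hR₁s.integral_right]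
    congr 1
    ext t
    have hR₂s : HasCompactSupport fun p : Y × ℝ => R ((t, p.2), p.1) := by
      refine HasCompactSupport.of_support_subset_isCompact
        (hRK.image (f := fun p : (ℝ × ℝ) × Y => (p.2, p.1.2)) (by fun_prop)) ?_
      rintro ⟨y, s⟩ h
      exact ⟨((t, s), y), hRsub t s y h, rfl⟩
    rw [integral_integral_swap_of_hasCompactSupport (f := fun y s => R ((t, s), y))
      (by simp only [Function.uncurry_def]; fun_prop) hR₂s]
  have hnear : ∀ t, ‖∫ s, W (t, s)‖ ≤ D₁ * ∫ s, n s := by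
    intro t
    refine le_trans (norm_integral_le_of_norm_le (g := fun s => (1 / 2) * (q s + q (s + t)))
      ((hqi.add (hqi.comp_add_right t)).const_mul _) (Filter.Eventually.of_forall fun s => ?_))
      (le_of_eq_of_le ?_ hqn)
    · simp only [q]
      have hi : ∀ s, Integrable fun y => ‖P (s, y)‖ ^ 2 := fun s =>
        (by fun_prop : Continuous fun y => ‖P (s, y)‖ ^ 2).integrable_of_hasCompactSupport
          (hqs₀.slice_left s)
      rw [← integral_add (hi _) (hi _), ← integral_const_mul]
      refine norm_integral_le_of_norm_le (((hi _).add (hi _)).const_mul _)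
        (Filter.Eventually.of_forall fun y => ?_)
      simp only [R, norm_mul, RCLike.norm_conj]
      nlinarith [sq_nonneg (‖P (s, y)‖ - ‖P (s + t, y)‖)]
    · rw [integral_const_mul, integral_add hqi (hqi.comp_add_right t),
        integral_add_right_eq_self q t]
      ring
  have hfar : ∀ t, r ≤ |t| → ‖∫ s, W (t, s)‖ ≤ D₂ * ∫ s, l s * l (s + t) := by
    intro t ht
    rw [← integral_const_mul]
    have hls' : HasCompactSupport fun s => l s * l (s + t) := hls.mul_right
    refine norm_integral_le_of_norm_le (((by fun_prop : Continuous fun s => l s * l (s + t)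
      ).integrable_of_hasCompactSupport hls').const_mul _)
      (Filter.Eventually.of_forall fun s => ?_)
    exact norm_integral_conj_mul_le (hgc s) (hgc (s + t)) (hgs.slice_left s)
      (hgs.slice_left (s + t)) (hKc s) (hKsc s) (hKc (s + t)) (hKsc (s + t))
      (hD₂ s (s + t) (by simpa using ht))
  obtain ⟨hRi, hRe⟩ := integral_integral_add_mul hl hls
  have hn0 : 0 ≤ D₁ * ∫ s, n s :=
    mul_nonneg hD₁0 (integral_nonneg fun s => integral_nonneg fun x => by positivity)
  have hl0 : ∀ s, 0 ≤ l s := fun s => integral_nonneg fun x => norm_nonneg _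
  have hind : Integrable ((Set.Ioo (-r) r).indicator fun _ : ℝ => D₁ * ∫ s, n s) :=
    (integrable_indicator_iff measurableSet_Ioo).2
      (integrableOn_const (by simp))
  have hall : ‖∫ t, ∫ s, W (t, s)‖ ≤ ∫ t, ((Set.Ioo (-r) r).indicator
      (fun _ : ℝ => D₁ * ∫ s, n s) t + D₂ * ∫ s, l s * l (s + t)) := by
    refine norm_integral_le_of_norm_le (hind.add (hRi.const_mul _))
      (Filter.Eventually.of_forall fun t => ?_)
    by_cases ht : t ∈ Set.Ioo (-r) r
    · simp only [Set.indicator_of_mem ht]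
      exact (hnear t).trans (le_add_of_nonneg_right
        (mul_nonneg hD₂0 (integral_nonneg fun s => mul_nonneg (hl0 _) (hl0 _))))
    · simp only [Set.indicator_of_notMem ht, zero_add]
      refine hfar t ?_
      by_contra! h
      exact ht (abs_lt.1 h)
  calc ∫ y, ‖∫ s, ∫ x, g (s, x) * K ((s, x), y)‖ ^ 2
      = ‖((∫ y, ‖∫ s, P (s, y)‖ ^ 2 : ℝ) : ℂ)‖ := by
        rw [Complex.norm_real, Real.norm_of_nonneg (integral_nonneg fun y => by positivity)]
    _ ≤ ∫ t, ((Set.Ioo (-r) r).indicator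
      (fun _ : ℝ => D₁ * ∫ s, n s) t + D₂ * ∫ s, l s * l (s + t)) := e1 ▸ hall
    _ = _ := by
        rw [integral_add hind (hRi.const_mul _), integral_indicator measurableSet_Ioo,
          integral_const_mul D₂, hRe, setIntegral_const, Real.volume_real_Ioo_of_le (by linarith),
          smul_eq_mul]
        ring

end slab

/-- The kernel `e^{iλψ(z,y)} A(z,y)` of an oscillatory integral operator. -/
def oscKernel {Z Y : Type} (ψ : Z × Y → ℝ) (A : Z × Y → ℂ) (lam : ℝ) (q : Z × Y) : ℂ :=
  Complex.exp (Complex.I * ((lam * ψ q : ℝ) : ℂ)) * A q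

theorem oscKernel_mul_conj {Z Y : Type} (ψ : Z × Y → ℝ) (A : Z × Y → ℂ) (lam : ℝ) (z w : Z)
    (y : Y) : oscKernel ψ A lam (w, y) * (starRingEnd ℂ) (oscKernel ψ A lam (z, y)) =
      Complex.exp (Complex.I * ((lam * (ψ (w, y) - ψ (z, y)) : ℝ) : ℂ)) *
        (A (w, y) * (starRingEnd ℂ) (A (z, y))) := by
  simp only [oscKernel, map_mul, ← Complex.exp_conj, Complex.conj_I, Complex.conj_ofReal]
  rw [mul_mul_mul_comm, ← Complex.exp_add]
  congr 2
  push_cast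
  ring

theorem norm_oscKernel {Z Y : Type} (ψ : Z × Y → ℝ) (A : Z × Y → ℂ) (lam : ℝ) (q : Z × Y) :
    ‖oscKernel ψ A lam q‖ = ‖A q‖ := by
  rw [oscKernel, norm_mul, mul_comm Complex.I, Complex.norm_exp_ofReal_mul_I, one_mul]

theorem continuous_oscKernel {Z Y : Type} [TopologicalSpace Z] [TopologicalSpace Y]
    {ψ : Z × Y → ℝ} {A : Z × Y → ℂ} (hψ : Continuous ψ) (hA : Continuous A) (lam : ℝ) :
    Continuous (oscKernel ψ A lam) := by
  unfold oscKernel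
  fun_prop

theorem hasCompactSupport_oscKernel {Z Y : Type} [TopologicalSpace Z] [TopologicalSpace Y]
    {A : Z × Y → ℂ} (ψ : Z × Y → ℝ) (hA : HasCompactSupport A) (lam : ℝ) :
    HasCompactSupport (oscKernel ψ A lam) :=
  HasCompactSupport.mul_left (f := fun q => Complex.exp (Complex.I * ((lam * ψ q : ℝ) : ℂ))) hA

section slabKernel

variable {X Y H : Type} [NormedAddCommGroup X] [NormedSpace ℝ X] [FiniteDimensional ℝ X]
  [MeasureSpace X] [BorelSpace X] [(volume : Measure X).IsAddHaarMeasure]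
  [NormedAddCommGroup Y] [NormedSpace ℝ Y] [FiniteDimensional ℝ Y]
  [MeasureSpace Y] [BorelSpace Y] [(volume : Measure Y).IsAddHaarMeasure]
  [NormedAddCommGroup H] [NormedSpace ℝ H] [FiniteDimensional ℝ H]
  [MeasureSpace H] [BorelSpace H] [(volume : Measure H).IsAddHaarMeasure]

theorem slice_kernel_bound {ψ : (ℝ × X) × Y → ℝ} (hψ : ContDiff ℝ (⊤ : ℕ∞) ψ) (z₀ : ℝ × X) (y₀ : Y)
    (h₁ : ∀ ζ : X, ζ ≠ 0 → ∃ ω : Y,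
      fderiv ℝ (fun q => fderiv ℝ ψ q ((0, ζ), 0)) (z₀, y₀) (0, ω) ≠ 0) :
    ∃ δ : ℝ, 0 < δ ∧ ∀ A : (ℝ × X) × Y → ℂ, ContDiff ℝ (⊤ : ℕ∞) A → HasCompactSupport A →
      tsupport A ⊆ Metric.ball (z₀, y₀) δ → ∃ C : ℝ, 0 ≤ C ∧ ∀ lam : ℝ, 0 < lam → ∀ s x,
        ∫ x', ‖∫ y, oscKernel ψ A lam ((s, x'), y) *
          (starRingEnd ℂ) (oscKernel ψ A lam ((s, x), y))‖ ≤
            C * (lam ^ Module.finrank ℝ X)⁻¹ := by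
  let φ : Y × (ℝ × X) → ℝ := fun p => ψ p.swap
  have hφ : ContDiff ℝ (⊤ : ℕ∞) φ :=
    hψ.comp (contDiff_snd.prodMk contDiff_fst)
  let J : X →L[ℝ] Y × (ℝ × X) :=
    (ContinuousLinearMap.inr ℝ Y (ℝ × X)).comp (ContinuousLinearMap.inr ℝ ℝ X)
  have hJ : ∀ ζ, J ζ = (0, (0, ζ)) := fun ζ => rfl
  have e1 : ∀ p v, fderiv ℝ φ p v = fderiv ℝ ψ p.swap v.swap := by
    intro p v
    have h2 : HasFDerivAt φ _ p := HasFDerivAt.comp (g := ψ) p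
      (hψ.differentiable (by simp) p.swap).hasFDerivAt
      (ContinuousLinearEquiv.prodComm ℝ Y (ℝ × X)).hasFDerivAt
    rw [h2.fderiv]
    rfl
  obtain ⟨δ, hδ, key⟩ := nonstationary_phase_difference hφ J (y₀, z₀) (fun ζ hζ => by
    obtain ⟨ω, hω⟩ := h₁ ζ hζ
    refine ⟨ω, ?_⟩
    rwa [fderiv_eq_of_slice_eq ((contDiff_fderiv_apply_const hφ _).differentiable (by simp))
      ((contDiff_fderiv_apply_const hψ ((0, ζ), 0)).differentiable (by simp))
      (z := z₀) (fun y => e1 _ _)])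
  refine ⟨δ / 4, by positivity, fun A hA hAs hAδ => ?_⟩
  let κ : ContDiffBump (0 : X) := ⟨δ / 2, 3 * δ / 4, by positivity, by linarith⟩
  let B : (Y × (ℝ × X)) × X → ℂ := fun q =>
    (A ((q.1.2.1, q.1.2.2 + q.2), q.1.1) * (starRingEnd ℂ) (A (q.1.2, q.1.1))) * ((κ q.2 : ℝ) : ℂ)
  have hB : ContDiff ℝ (⊤ : ℕ∞) B := by
    refine ContDiff.mul (ContDiff.mul ?_ ?_) ?_
    · exact hA.comp (by fun_prop)
    · exact Complex.conjCLE.contDiff.comp (hA.comp (by fun_prop))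
    · exact Complex.ofRealCLM.contDiff.comp (κ.contDiff.comp (by fun_prop))
  let W : Set ((Y × (ℝ × X)) × X) := (Prod.swap ⁻¹' tsupport A) ×ˢ
    Metric.closedBall (0 : X) (3 * δ / 4)
  have hW : IsCompact W := by
    refine IsCompact.prod ?_ (isCompact_closedBall _ _)
    exact (Homeomorph.prodComm Y (ℝ × X)).isCompact_preimage.2 hAs.isCompact
  have hBW : Function.support B ⊆ W := by
    rintro ⟨⟨y, z⟩, ζ⟩ hq
    have h1 : A (z, y) ≠ 0 :=
      (map_ne_zero _).1 (right_ne_zero_of_mul (left_ne_zero_of_mul hq))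
    have h2 : κ ζ ≠ 0 := by exact_mod_cast right_ne_zero_of_mul hq
    have h3 : ζ ∈ Function.support κ := h2
    rw [κ.support_eq] at h3
    exact ⟨subset_tsupport A h1, Metric.ball_subset_closedBall h3⟩
  obtain ⟨C, hC0, hC⟩ := key B hB (HasCompactSupport.of_support_subset_isCompact hW hBW)
    (fun q hq => by
      obtain ⟨h2, h3⟩ := closure_minimal hBW hW.isClosed hq
      have h4 := hAδ h2
      rw [mem_closedBall_zero_iff] at h3
      simp only [Metric.mem_ball, Prod.dist_eq, max_lt_iff, Prod.fst_swap, Prod.snd_swap] at h4 ⊢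
      refine ⟨⟨by linarith, by linarith, by linarith⟩, by linarith⟩)
    (Module.finrank ℝ X + 1)
  set d := Module.finrank ℝ X
  set I₀ := ∫ k : X, (1 + ‖k‖) ^ (-((d + 1 : ℕ) : ℝ))
  refine ⟨C * I₀, mul_nonneg hC0 (integral_nonneg fun k => by positivity),
    fun lam hlam s x => ?_⟩
  calc ∫ x', ‖∫ y, oscKernel ψ A lam ((s, x'), y) *
          (starRingEnd ℂ) (oscKernel ψ A lam ((s, x), y))‖
      ≤ ∫ x', C * (1 + ‖lam • (x' - x)‖) ^ (-((d + 1 : ℕ) : ℝ)) := by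
        refine integral_mono_of_nonneg (Filter.Eventually.of_forall fun x' => norm_nonneg _)
          ((integrable_one_add_norm_smul_sub x (Nat.lt_succ_self d) hlam).const_mul C)
          (Filter.Eventually.of_forall fun x' => ?_)
        refine le_trans (le_of_eq ?_) (hC (s, x) (x' - x) lam hlam.le)
        beta_reduce
        congr 2
        ext y
        rw [oscKernel_mul_conj]
        have hx : ((y, (s, x)) : Y × (ℝ × X)) + J (x' - x) = (y, (s, x')) := by simp [hJ]
        simp only [φ, B, hx, Prod.swap, add_sub_cancel]
        congr 1
        by_cases hA0 : A ((s, x'), y) * (starRingEnd ℂ) (A ((s, x), y)) = 0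
        · rw [hA0, zero_mul]
        · have h2 := hAδ (subset_tsupport _ (left_ne_zero_of_mul hA0))
          have h3 := hAδ (subset_tsupport A (a := ((s, x), y))
            ((map_ne_zero _).1 (right_ne_zero_of_mul hA0)))
          simp only [Metric.mem_ball, Prod.dist_eq, max_lt_iff] at h2 h3
          rw [κ.one_of_mem_closedBall]
          · simp
          · rw [mem_closedBall_zero_iff, ← dist_eq_norm]
            simp only [κ]
            linarith [dist_triangle_right x' x z₀.2, h2.1.2, h3.1.2]
    _ = _ := by
        rw [integral_const_mul, integral_one_add_norm_smul_sub x (d + 1) hlam]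
        ring

end slabKernel

section weakType

variable {X Y H : Type} [NormedAddCommGroup X] [NormedSpace ℝ X] [FiniteDimensional ℝ X]
  [MeasureSpace X] [BorelSpace X] [(volume : Measure X).IsAddHaarMeasure]
  [NormedAddCommGroup Y] [NormedSpace ℝ Y] [FiniteDimensional ℝ Y]
  [MeasureSpace Y] [BorelSpace Y] [(volume : Measure Y).IsAddHaarMeasure]
  [NormedAddCommGroup H] [NormedSpace ℝ H] [FiniteDimensional ℝ H]
  [MeasureSpace H] [BorelSpace H] [(volume : Measure H).IsAddHaarMeasure]

theorem exists_truncated_phase {α : ℝ} (hα : 0 < α) :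
    ∃ c : ℂ → ℂ, Continuous c ∧ c 0 = 0 ∧ (∀ w, ‖c w‖ ≤ 1) ∧ (∀ w, 2 * α ≤ ‖w‖ → 1 ≤ ‖c w‖) ∧
      ∀ w, ∃ t : ℝ, c w * w = t ∧ α * ‖c w‖ ≤ t := by
  let θ : ℝ → ℝ := fun t => max 0 (min 1 (t / α - 1))
  have hθ0 : ∀ t, 0 ≤ θ t := fun t => le_max_left _ _
  have hθ1 : ∀ t, θ t ≤ 1 := fun t => max_le zero_le_one (min_le_left _ _)
  have hθα : ∀ t, t < α → θ t = 0 := fun t ht => by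
    have : t / α < 1 := (div_lt_one hα).2 ht
    exact max_eq_left ((min_le_right _ _).trans (by linarith))
  have hm : ∀ t : ℝ, 0 < max t α := fun t => lt_max_of_lt_right hα
  let c : ℂ → ℂ := fun w => (starRingEnd ℂ) w * ((θ ‖w‖ / max ‖w‖ α : ℝ) : ℂ)
  have hcn : ∀ w, ‖c w‖ = θ ‖w‖ := by
    intro w
    simp only [c, norm_mul, RCLike.norm_conj, Complex.norm_real,
      Real.norm_of_nonneg (div_nonneg (hθ0 _) (hm _).le)]
    rcases lt_or_ge ‖w‖ α with h | h
    · simp [hθα _ h]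
    · rw [max_eq_left h, mul_div_cancel₀ _ (hα.trans_le h).ne']
  refine ⟨c, ?_, by simp [c], fun w => hcn w ▸ hθ1 _, fun w hw => ?_, fun w => ?_⟩
  · refine Complex.continuous_conj.mul (Complex.continuous_ofReal.comp ?_)
    exact Continuous.div (by fun_prop) (by fun_prop) fun w => (hm _).ne'
  · rw [hcn]
    refine le_max_of_le_right (le_min le_rfl ?_)
    have : 2 ≤ ‖w‖ / α := (le_div_iff₀ hα).2 hw
    linarith
  · refine ⟨‖w‖ * θ ‖w‖, ?_, ?_⟩
    · rcases lt_or_ge ‖w‖ α with h | h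
      · simp [c, hθα _ h]
      · simp only [c, max_eq_left h]
        have h0 : (‖w‖ : ℂ) ≠ 0 := by exact_mod_cast (hα.trans_le h).ne'
        have h1 : (starRingEnd ℂ) w * w = (‖w‖ : ℂ) ^ 2 := by
          rw [mul_comm, Complex.mul_conj, Complex.normSq_eq_norm_sq]; push_cast; rfl
        push_cast
        rw [mul_right_comm, h1]
        field_simp
    · rw [hcn]
      rcases lt_or_ge ‖w‖ α with h | h
      · simp [hθα _ h]
      · exact mul_le_mul_of_nonneg_right h (hθ0 _)

theorem measure_ge_le_of_slices {K : (ℝ × X) × Y → ℂ} (hK : Continuous K)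
    (hKs : HasCompactSupport K) {D₁ D₂ r : ℝ} (hr : 0 ≤ r)
    (hD₁ : ∀ s x, ∫ x', ‖∫ y, K ((s, x'), y) * (starRingEnd ℂ) (K ((s, x), y))‖ ≤ D₁)
    (hD₂ : ∀ s s', r ≤ |s' - s| → ∀ x x',
      ‖∫ y, K ((s', x'), y) * (starRingEnd ℂ) (K ((s, x), y))‖ ≤ D₂)
    {f : Y → ℂ} (hf : Continuous f) (hfs : HasCompactSupport f) {α : ℝ} (hα : 0 < α)
    (hαD : (∫ y, ‖f y‖ ^ 2) * D₂ ≤ α ^ 2 / 2) :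
    volume {z | 2 * α ≤ ‖∫ y, K (z, y) * f y‖} ≤
      ENNReal.ofReal (4 * r * D₁ * (∫ y, ‖f y‖ ^ 2) / α ^ 2) := by
  have hD₁0 : 0 ≤ D₁ := (integral_nonneg fun x' => norm_nonneg _).trans (hD₁ 0 0)
  have : (volume : Measure (ℝ × X)).IsAddHaarMeasure := by
    rw [Measure.volume_eq_prod]; infer_instance
  obtain ⟨c, hc, hc0, hc1, hc2, hcα⟩ := exists_truncated_phase hα
  have hKfs : HasCompactSupport fun q : (ℝ × X) × Y => K q * f q.2 := hKs.mul_right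
  let F : ℝ × X → ℂ := fun z => ∫ y, K (z, y) * f y
  have hF : Continuous F := Continuous.integral_right (f := fun q => K q * f q.2)
    (by fun_prop) hKfs
  have hFs : HasCompactSupport F := hKfs.integral_right
  let g : ℝ × X → ℂ := fun z => c (F z)
  have hg : Continuous g := hc.comp hF
  have hgs : HasCompactSupport g := hFs.comp_left hc0
  have hgi : Integrable fun z => ‖g z‖ := (hg.integrable_of_hasCompactSupport hgs).norm
  set N := ∫ y, ‖f y‖ ^ 2
  have hN0 : 0 ≤ N := integral_nonneg fun y => by positivity
  set M := ∫ z, ‖g z‖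
  have hM0 : 0 ≤ M := integral_nonneg fun z => norm_nonneg _
  let G₀ : Y × (ℝ × X) → ℂ := fun q => g q.2 * K (q.2, q.1)
  have hG₀ : Continuous G₀ := by fun_prop
  have hG₀s : HasCompactSupport G₀ := by
    refine HasCompactSupport.of_support_subset_isCompact
      (hKs.isCompact.image continuous_swap) ?_
    rintro ⟨y, z⟩ hq
    exact ⟨(z, y), subset_tsupport _ (right_ne_zero_of_mul hq), rfl⟩
  let G : Y → ℂ := fun y => ∫ z, G₀ (y, z)
  have hG : Continuous G := hG₀.integral_right hG₀s
  have hGs : HasCompactSupport G := hG₀s.integral_right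
  have e1 : ∫ z, g z * F z = ∫ y, f y * G y := by
    have h1 : ∀ z, g z * F z = ∫ y, g z * (K (z, y) * f y) := fun z => by
      rw [integral_const_mul]
    simp_rw [h1]
    rw [integral_integral_swap_of_hasCompactSupport (f := fun z y => g z * (K (z, y) * f y))
      (by simp only [Function.uncurry_def]; fun_prop) hKfs.mul_left]
    congr 1
    ext y
    simp only [G, G₀]
    rw [← integral_const_mul]
    congr 1
    ext z
    ring
  have h2 : α * M ≤ ‖∫ z, g z * F z‖ := by
    choose t ht1 ht2 using hcα
    have h3 : ∫ z, g z * F z = ((∫ z, t (F z) : ℝ) : ℂ) := by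
      rw [← integral_complex_ofReal]
      congr 1
      ext z
      exact ht1 _
    have hti : Integrable fun z => t (F z) := by
      have h4 : Integrable fun z => (g z * F z).re :=
        ((hg.mul hF).integrable_of_hasCompactSupport hFs.mul_left).re
      refine h4.congr (Filter.Eventually.of_forall fun z => ?_)
      simp only [g, ht1, Complex.ofReal_re]
    rw [h3, Complex.norm_real]
    refine le_trans ?_ (Real.le_norm_self _)
    rw [← integral_const_mul]
    exact integral_mono (hgi.const_mul _) hti fun z => ht2 _
  have h5 : ‖∫ y, f y * G y‖ ^ 2 ≤ N * ∫ y, ‖G y‖ ^ 2 :=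
    sq_norm_integral_mul_le (hf.memLp_of_hasCompactSupport hfs)
      (hG.memLp_of_hasCompactSupport hGs)
  have h6 : ∫ y, ‖G y‖ ^ 2 ≤ 2 * r * D₁ * M + D₂ * M ^ 2 := by
    have h7 := integral_sq_norm_le_of_slices hg hgs hK hKs hr hD₁ hD₂
    have h8 : ∀ y, G y = ∫ s, ∫ x, g (s, x) * K ((s, x), y) := fun y => by
      simp only [G, G₀]
      rw [Measure.volume_eq_prod, integral_prod]
      rw [← Measure.volume_eq_prod]
      exact (by fun_prop : Continuous fun z => g z * K (z, y)).integrable_of_hasCompactSupport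
        (hG₀s.slice_left y)
    have h9 : M = ∫ s, ∫ x, ‖g (s, x)‖ := by
      simp only [M]
      rw [Measure.volume_eq_prod, integral_prod]
      rwa [← Measure.volume_eq_prod]
    have hi : Integrable fun z => ‖g z‖ ^ 2 :=
      (by fun_prop : Continuous fun z => ‖g z‖ ^ 2).integrable_of_hasCompactSupport
        (hgs.comp_left (g := fun c => ‖c‖ ^ 2) (by simp))
    have h10 : ∫ s, ∫ x, ‖g (s, x)‖ ^ 2 ≤ M := by
      have h11 : ∫ z, ‖g z‖ ^ 2 = ∫ s, ∫ x, ‖g (s, x)‖ ^ 2 := by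
        rw [Measure.volume_eq_prod, integral_prod]
        rwa [← Measure.volume_eq_prod]
      rw [← h11]
      refine integral_mono hi hgi fun z => ?_
      have := hc1 (F z)
      have h0 := norm_nonneg (g z)
      simp only [g] at h0 ⊢
      nlinarith
    simp_rw [h8]
    refine h7.trans ?_
    rw [← h9]
    gcongr
  have h12 : M ≤ 4 * r * D₁ * N / α ^ 2 := by
    have h13 : (α * M) ^ 2 ≤ N * (2 * r * D₁ * M + D₂ * M ^ 2) := by
      refine (pow_le_pow_left₀ (by positivity) h2 2).trans ?_
      rw [e1]
      exact h5.trans (mul_le_mul_of_nonneg_left h6 hN0)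
    rcases hM0.eq_or_lt with h0 | h0
    · rw [← h0]; positivity
    · rw [le_div_iff₀ (by positivity)]
      have h14 := mul_le_mul_of_nonneg_right hαD (sq_nonneg M)
      have h15 : M * (M * α ^ 2) ≤ M * (4 * r * D₁ * N) := by nlinarith
      exact le_of_mul_le_mul_left h15 h0
  calc volume {z | 2 * α ≤ ‖F z‖} ≤ volume {z | (1 : ℝ≥0∞) ≤ ENNReal.ofReal ‖g z‖} := by
        refine measure_mono fun z hz => ?_
        exact ENNReal.one_le_ofReal.2 (hc2 _ hz)
    _ ≤ ∫⁻ z, ENNReal.ofReal ‖g z‖ := by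
        simpa using mul_meas_ge_le_lintegral₀ (μ := volume)
          (f := fun z => ENNReal.ofReal ‖g z‖) (by fun_prop) 1
    _ = ENNReal.ofReal M := (ofReal_integral_eq_lintegral_ofReal hgi
        (Filter.Eventually.of_forall fun z => norm_nonneg _)).symm
    _ ≤ _ := ENNReal.ofReal_le_ofReal h12

end weakType

section weakTypeOsc

variable {X Y H : Type} [NormedAddCommGroup X] [NormedSpace ℝ X] [FiniteDimensional ℝ X]
  [MeasureSpace X] [BorelSpace X] [(volume : Measure X).IsAddHaarMeasure]
  [NormedAddCommGroup Y] [NormedSpace ℝ Y] [FiniteDimensional ℝ Y]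
  [MeasureSpace Y] [BorelSpace Y] [(volume : Measure Y).IsAddHaarMeasure]
  [NormedAddCommGroup H] [NormedSpace ℝ H] [FiniteDimensional ℝ H]
  [MeasureSpace H] [BorelSpace H] [(volume : Measure H).IsAddHaarMeasure]

theorem weak_type_bound (hH : 0 < Module.finrank ℝ H)
    {ψ : (ℝ × X) × Y → ℝ} (hψ : ContDiff ℝ (⊤ : ℕ∞) ψ) (z₀ : ℝ × X) (y₀ : Y)
    (h₁ : ∀ ζ : X, ζ ≠ 0 → ∃ ω : Y,
      fderiv ℝ (fun q => fderiv ℝ ψ q ((0, ζ), 0)) (z₀, y₀) (0, ω) ≠ 0)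
    (h₂ : ∀ u : ℝ × X, u ≠ 0 →
      (∃ ζ : Y, fderiv ℝ (fun q => fderiv ℝ ψ q (u, 0)) (z₀, y₀) (0, ζ) ≠ 0) ∨
      ∃ A : H →L[ℝ] Y, ∀ k : H, k ≠ 0 → ∃ ζ : Y,
        fderiv ℝ (fun q => fderiv ℝ (fun q' => fderiv ℝ ψ q' (u, 0)) q (0, A k))
          (z₀, y₀) (0, ζ) ≠ 0) :
    ∃ δ : ℝ, 0 < δ ∧ ∀ A : (ℝ × X) × Y → ℂ, ContDiff ℝ (⊤ : ℕ∞) A → HasCompactSupport A →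
      tsupport A ⊆ Metric.ball (z₀, y₀) δ → ∃ C : ℝ, 0 ≤ C ∧ ∀ lam : ℝ, 0 < lam →
        ∀ f : Y → ℂ, Continuous f → HasCompactSupport f → ∀ α : ℝ, 0 < α →
          volume {z | 2 * α ≤ ‖∫ y, oscKernel ψ A lam (z, y) * f y‖} ≤
            ENNReal.ofReal (C * (lam ^ (Module.finrank ℝ X + 1))⁻¹ *
              ((∫ y, ‖f y‖ ^ 2) / α ^ 2) ^ (1 + 2 / (Module.finrank ℝ H : ℝ))) := by
  obtain ⟨δ₁, hδ₁, key₁⟩ := slice_kernel_bound hψ z₀ y₀ h₁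
  obtain ⟨δ₂, hδ₂, key₂⟩ := oscillatory_kernel_bound hψ z₀ y₀ h₂
  refine ⟨min δ₁ δ₂, lt_min hδ₁ hδ₂, fun A hA hAs hAδ => ?_⟩
  obtain ⟨C₁, hC₁0, hC₁⟩ := key₁ A hA hAs (hAδ.trans (Metric.ball_subset_ball (min_le_left _ _)))
  obtain ⟨C₂', hC₂0', hC₂'⟩ :=
    key₂ A hA hAs (hAδ.trans (Metric.ball_subset_ball (min_le_right _ _)))
  obtain ⟨C₂, hC₂0, hC₂C⟩ : ∃ C₂, 0 < C₂ ∧ C₂' ≤ C₂ := ⟨C₂' + 1, by linarith, by linarith⟩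
  set d := Module.finrank ℝ X
  set m := Module.finrank ℝ H
  have hm : (m : ℝ) ≠ 0 := by exact_mod_cast hH.ne'
  refine ⟨4 * C₁ * (4 * C₂) ^ (1 / (m : ℝ)), by positivity,
    fun lam hlam f hf hfs α hα => ?_⟩
  set N := ∫ y, ‖f y‖ ^ 2
  have hN0 : 0 ≤ N := integral_nonneg fun y => by positivity
  have hK := continuous_oscKernel hψ.continuous hA.continuous lam
  have hKs := hasCompactSupport_oscKernel ψ hAs lam
  have hfar : ∀ ρ : ℝ, 0 < ρ → ∀ s s' : ℝ, ρ / lam ≤ |s' - s| → ∀ x x',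
      ‖∫ y, oscKernel ψ A lam ((s', x'), y) *
        (starRingEnd ℂ) (oscKernel ψ A lam ((s, x), y))‖ ≤ √(C₂ / ρ ^ m) := by
    intro ρ hρ s s' hs x x'
    have hr : 0 < ρ / lam := by positivity
    have hne : ((s, x) : ℝ × X) ≠ (s', x') := fun h => by
      have : s = s' := congrArg Prod.fst h
      simp [this] at hs
      linarith
    have h3 := hC₂' lam (s, x) (s', x') hlam hne
    refine Real.le_sqrt_of_sq_le ?_
    rw [le_div_iff₀ (by positivity), mul_comm]
    simp_rw [oscKernel_mul_conj]
    refine le_trans ?_ (h3.trans hC₂C)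
    have h4 : ρ ≤ lam * ‖((s', x') : ℝ × X) - (s, x)‖ := by
      rw [div_le_iff₀' hlam] at hs
      have h5 : |s' - s| ≤ ‖((s', x') : ℝ × X) - (s, x)‖ :=
        norm_fst_le (((s', x') : ℝ × X) - (s, x))
      exact hs.trans (mul_le_mul_of_nonneg_left h5 hlam.le)
    gcongr
  obtain ⟨x, hx⟩ : ∃ x, x = N / α ^ 2 := ⟨_, rfl⟩
  have hx0 : 0 ≤ x := hx ▸ by positivity
  rw [← hx]
  rcases hN0.eq_or_lt with h0 | h0
  · have := measure_ge_le_of_slices hK hKs (by positivity) (hC₁ lam hlam)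
      (hfar 1 one_pos) hf hfs hα (by rw [show ∫ y, ‖f y‖ ^ 2 = 0 from h0.symm]; simp; positivity)
    rw [show ∫ y, ‖f y‖ ^ 2 = 0 from h0.symm] at this
    refine this.trans (by simp)
  · have hxp : 0 < x := hx ▸ by positivity
    obtain ⟨ρ, hρ⟩ : ∃ ρ, ρ = (4 * C₂ * x ^ 2) ^ (1 / (m : ℝ)) := ⟨_, rfl⟩
    have hρ0 : 0 < ρ := hρ ▸ by positivity
    have hρm : ρ ^ m = 4 * C₂ * x ^ 2 := by
      rw [hρ, ← Real.rpow_natCast, ← Real.rpow_mul (by positivity), one_div_mul_cancel hm,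
        Real.rpow_one]
    have hD : √(C₂ / ρ ^ m) = 1 / (2 * x) := by
      rw [hρm, show C₂ / (4 * C₂ * x ^ 2) = (1 / (2 * x)) ^ 2 by field_simp; norm_num]
      exact Real.sqrt_sq (by positivity)
    have := measure_ge_le_of_slices hK hKs (by positivity) (hC₁ lam hlam) (hfar ρ hρ0) hf hfs hα
      (by
        rw [hD, hx]
        change N * _ ≤ _
        refine le_of_eq ?_
        field_simp)
    refine this.trans (le_of_eq ?_)
    congr 1
    change 4 * (ρ / lam) * (C₁ * (lam ^ d)⁻¹) * N / α ^ 2 = _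
    have h5 : ρ = (4 * C₂) ^ (1 / (m : ℝ)) * x ^ (2 / (m : ℝ)) := by
      rw [hρ, Real.mul_rpow (by positivity) (by positivity), ← Real.rpow_natCast x 2,
        ← Real.rpow_mul hx0]
      congr 2
      push_cast
      ring
    rw [Real.rpow_add hxp, Real.rpow_one, mul_div_assoc, ← hx, h5, pow_succ]
    field_simp

theorem lintegral_rpow_le_of_weak_type {Z : Type} [MeasurableSpace Z] {μ : Measure Z} {u : Z → ℝ}
    (hu : Measurable u) (hu0 : ∀ z, 0 ≤ u z) (hu1 : ∀ z, u z ≤ 1) {q θ W κ : ℝ} (hq : 0 < q)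
    (hθ : 0 < θ) (hθ1 : θ < 1) (hW0 : 0 ≤ W) (hκ0 : 0 ≤ κ)
    (hW : ∀ t, 0 < t → μ {z | t ≤ u z} ≤ ENNReal.ofReal W)
    (hκ : ∀ t, 0 < t → μ {z | t ≤ u z} ≤ ENNReal.ofReal (κ * t ^ (-q))) :
    ∫⁻ z, ENNReal.ofReal (u z ^ q) ∂μ ≤ ENNReal.ofReal (W ^ θ * κ ^ (1 - θ) / θ) := by
  rw [lintegral_rpow_eq_lintegral_meas_le_mul μ (Filter.Eventually.of_forall hu0)
      hu.aemeasurable hq]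
  have hpt : ∀ t ∈ Set.Ioi (0 : ℝ), μ {z | t ≤ u z} * ENNReal.ofReal (t ^ (q - 1)) ≤
      (Set.Ioc (0 : ℝ) 1).indicator
        (fun t => ENNReal.ofReal (W ^ θ * κ ^ (1 - θ) * t ^ (q * θ - 1))) t := by
    intro t ht
    have ht0 : (0 : ℝ) < t := ht
    by_cases h1 : t ≤ 1
    · rw [Set.indicator_of_mem (show t ∈ Set.Ioc (0 : ℝ) 1 from ⟨ht, h1⟩)]
      have h2 : μ {z | t ≤ u z} ≤ ENNReal.ofReal (W ^ θ * (κ * t ^ (-q)) ^ (1 - θ)) := by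
        have h3 : μ {z | t ≤ u z} = μ {z | t ≤ u z} ^ θ * μ {z | t ≤ u z} ^ (1 - θ) := by
          rw [← ENNReal.rpow_add_of_nonneg _ _ hθ.le (by linarith), add_sub_cancel,
            ENNReal.rpow_one]
        rw [h3, ENNReal.ofReal_mul (by positivity), ← ENNReal.ofReal_rpow_of_nonneg hW0 hθ.le,
          ← ENNReal.ofReal_rpow_of_nonneg (by positivity) (by linarith)]
        exact mul_le_mul' (ENNReal.rpow_le_rpow (hW t ht0) hθ.le)
          (ENNReal.rpow_le_rpow (hκ t ht0) (by linarith))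
      refine (mul_le_mul_left h2 _).trans (le_of_eq ?_)
      rw [← ENNReal.ofReal_mul (by positivity)]
      congr 1
      rw [Real.mul_rpow hκ0 (by positivity), ← Real.rpow_mul ht0.le,
          ← mul_assoc, mul_assoc _ (t ^ _),
        ← Real.rpow_add ht0]
      congr 2
      ring
    · have : {z | t ≤ u z} = ∅ := by
        ext z
        simp only [Set.mem_ofPred_eq, Set.mem_empty_iff_false, iff_false, not_le]
        exact (hu1 z).trans_lt (not_le.1 h1)
      simp [this]
  have hqθ : 0 < q * θ := by positivity
  have h_int : ∫ t in Set.Ioc (0:ℝ) 1, W ^ θ * κ ^ (1 - θ) * t ^ (q * θ - 1) =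
      W ^ θ * κ ^ (1 - θ) / (q * θ) := by
    rw [integral_const_mul, ← intervalIntegral.integral_of_le zero_le_one,
      integral_rpow (Or.inl (by linarith))]
    simp [hqθ.ne']
    ring
  have hii : IntegrableOn (fun t : ℝ => W ^ θ * κ ^ (1 - θ) * t ^ (q * θ - 1)) (Set.Ioc 0 1) :=
    ((intervalIntegrable_iff_integrableOn_Ioc_of_le zero_le_one).1
      (intervalIntegral.intervalIntegrable_rpow' (by linarith))).const_mul _
  calc _ ≤ ENNReal.ofReal q * ∫⁻ t in Set.Ioi (0 : ℝ), (Set.Ioc (0 : ℝ) 1).indicator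
        (fun t => ENNReal.ofReal (W ^ θ * κ ^ (1 - θ) * t ^ (q * θ - 1))) t := by
        gcongr 1
        exact setLIntegral_mono' measurableSet_Ioi hpt
    _ ≤ ENNReal.ofReal q * ∫⁻ t in Set.Ioc (0 : ℝ) 1,
          ENNReal.ofReal (W ^ θ * κ ^ (1 - θ) * t ^ (q * θ - 1)) := by
        gcongr 1
        rw [← lintegral_indicator measurableSet_Ioc]
        exact setLIntegral_le_lintegral _ _
    _ = _ := by
        rw [← ofReal_integral_eq_lintegral_ofReal hii
          (ae_restrict_of_forall_mem measurableSet_Ioc fun t ht => by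
            have := ht.1
            exact mul_nonneg (by positivity) (Real.rpow_nonneg ht.1.le _)), h_int,
          ← ENNReal.ofReal_mul hq.le]
        congr 1
        field_simp

end weakTypeOsc

instance isAddHaarMeasure_volume_prod {X W : Type} [NormedAddCommGroup X] [NormedSpace ℝ X]
    [FiniteDimensional ℝ X] [MeasureSpace X] [BorelSpace X]
    [(volume : Measure X).IsAddHaarMeasure] [NormedAddCommGroup W] [NormedSpace ℝ W]
    [FiniteDimensional ℝ W] [MeasureSpace W] [BorelSpace W]
    [(volume : Measure W).IsAddHaarMeasure] : (volume : Measure (X × W)).IsAddHaarMeasure :=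
  Measure.prod.instIsAddHaarMeasure _ _

section strongTypeOsc

variable {Z Y : Type} [NormedAddCommGroup Z] [NormedSpace ℝ Z] [FiniteDimensional ℝ Z]
  [MeasureSpace Z] [BorelSpace Z] [(volume : Measure Z).IsAddHaarMeasure]
  [NormedAddCommGroup Y] [NormedSpace ℝ Y] [FiniteDimensional ℝ Y]
  [MeasureSpace Y] [BorelSpace Y] [(volume : Measure Y).IsAddHaarMeasure]

theorem continuous_integral_oscKernel {ψ : Z × Y → ℝ} (hψ : Continuous ψ) {A : Z × Y → ℂ}
    (hA : Continuous A) (hAs : HasCompactSupport A) (lam : ℝ) {f : Y → ℂ} (hf : Continuous f) :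
    Continuous fun z => ∫ y, oscKernel ψ A lam (z, y) * f y :=
  Continuous.integral_right (f := fun q : Z × Y => oscKernel ψ A lam q * f q.2)
    ((continuous_oscKernel hψ hA lam).mul (hf.comp continuous_snd))
    (hasCompactSupport_oscKernel ψ hAs lam).mul_right

theorem integral_oscKernel_eq_zero {ψ : Z × Y → ℝ} {A : Z × Y → ℂ} {lam : ℝ} {f : Y → ℂ} {z : Z}
    (hz : z ∉ Prod.fst '' tsupport A) : ∫ y, oscKernel ψ A lam (z, y) * f y = 0 := by
  rw [← integral_zero Y ℂ (μ := volume)]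
  congr 1
  ext y
  have : A (z, y) = 0 := image_eq_zero_of_notMem_tsupport fun h => hz ⟨_, h, rfl⟩
  simp [oscKernel, this]

theorem strong_type_of_weak_type {ψ : Z × Y → ℝ} (hψ : Continuous ψ) {A : Z × Y → ℂ}
    (hA : Continuous A) (hAs : HasCompactSupport A) {k : ℕ} {r C : ℝ} (hr : 0 < r) (hC : 0 ≤ C)
    (hweak : ∀ lam : ℝ, 0 < lam → ∀ f : Y → ℂ, Continuous f → HasCompactSupport f →
      ∀ α : ℝ, 0 < α → volume {z | 2 * α ≤ ‖∫ y, oscKernel ψ A lam (z, y) * f y‖} ≤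
        ENNReal.ofReal (C * (lam ^ k)⁻¹ * ((∫ y, ‖f y‖ ^ 2) / α ^ 2) ^ r))
    {p θ : ℝ} (hp : 2 * r ≤ p) (hθ : 0 < θ) (hθ1 : θ < 1) :
    ∃ C' : ℝ, 0 ≤ C' ∧ ∀ lam : ℝ, 0 < lam → ∀ f : Y → ℂ, Continuous f → HasCompactSupport f →
      ∀ N : ℝ, 0 < N → ∫ y, ‖f y‖ ^ 2 ≤ N ^ 2 → ∫ y, ‖f y‖ ≤ N →
        ∫⁻ z, ENNReal.ofReal (‖∫ y, oscKernel ψ A lam (z, y) * f y‖ ^ p) ≤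
          ENNReal.ofReal (C' * ((lam ^ k)⁻¹) ^ (1 - θ) * N ^ p) := by
  obtain ⟨B₀, hB₀⟩ := hA.bounded_above_of_compact_support hAs
  obtain ⟨B, hB0, hB⟩ : ∃ B, 0 < B ∧ ∀ q, ‖A q‖ ≤ B :=
    ⟨max B₀ 1, by positivity, fun q => (hB₀ q).trans (le_max_left _ _)⟩
  have hKc : IsCompact (Prod.fst '' tsupport A) := IsCompact.image hAs continuous_fst
  obtain ⟨W, hW⟩ : ∃ W, W = (volume (Prod.fst '' tsupport A)).toReal := ⟨_, rfl⟩
  have hW0 : 0 ≤ W := hW ▸ ENNReal.toReal_nonneg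
  refine ⟨B ^ p * (W ^ θ * (C * (4 / B ^ 2) ^ r) ^ (1 - θ) / θ), by positivity,
    fun lam hlam f hf hfs N hN hN2 hN1 => ?_⟩
  set F : Z → ℂ := fun z => ∫ y, oscKernel ψ A lam (z, y) * f y with hF
  have hFc : Continuous F := continuous_integral_oscKernel hψ hA hAs lam hf
  have hBN : 0 < B * N := by positivity
  have hFB : ∀ z, ‖F z‖ ≤ B * N := fun z => by
    refine (norm_integral_le_integral_norm _).trans ?_
    refine le_trans ?_ (mul_le_mul_of_nonneg_left hN1 hB0.le)
    rw [← integral_const_mul]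
    refine integral_mono_of_nonneg (Filter.Eventually.of_forall fun y => norm_nonneg _)
      ((hf.norm.integrable_of_hasCompactSupport hfs.norm).const_mul _)
      (Filter.Eventually.of_forall fun y => ?_)
    simp only [norm_mul, norm_oscKernel]
    exact mul_le_mul_of_nonneg_right (hB _) (norm_nonneg _)
  have key := lintegral_rpow_le_of_weak_type (μ := volume) (u := fun z => ‖F z‖ / (B * N))
    (q := 2 * r) (θ := θ) (W := W) (κ := C * (lam ^ k)⁻¹ * (4 / B ^ 2) ^ r)
    (hFc.norm.div_const _).measurable (fun z => by positivity)
    (fun z => (div_le_one hBN).2 (hFB z)) (by positivity) hθ hθ1 hW0 (by positivity)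
    (fun t ht => by
      rw [hW, ENNReal.ofReal_toReal hKc.measure_lt_top.ne]
      refine measure_mono fun z hz => ?_
      by_contra h
      have h0 : F z = 0 := integral_oscKernel_eq_zero h
      have : t ≤ ‖F z‖ / (B * N) := hz
      rw [h0] at this
      simp at this
      linarith)
    (fun t ht => by
      have h1 := hweak lam hlam f hf hfs (t * (B * N) / 2) (by positivity)
      refine (measure_mono fun z hz => ?_).trans (h1.trans (ENNReal.ofReal_le_ofReal ?_))
      · have h2 : t ≤ ‖F z‖ / (B * N) := hz
        rw [le_div_iff₀ hBN] at h2
        change 2 * (t * (B * N) / 2) ≤ ‖F z‖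
        linarith
      · rw [mul_assoc _ _ (t ^ _)]
        refine mul_le_mul_of_nonneg_left ?_ (by positivity)
        have h3 : (4 / B ^ 2) ^ r * t ^ (-(2 * r)) = (4 / B ^ 2 / t ^ 2) ^ r := by
          have h4 : t ^ (2 * r) = (t ^ 2) ^ r := by
            rw [← Real.rpow_natCast t 2, ← Real.rpow_mul ht.le]
            norm_num
          rw [Real.rpow_neg ht.le, ← div_eq_mul_inv, h4,
            ← Real.div_rpow (by positivity) (by positivity)]
        rw [h3]
        refine Real.rpow_le_rpow (div_nonneg (integral_nonneg fun y => by positivity)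
          (by positivity)) ?_ hr.le
        rw [div_le_iff₀ (by positivity)]
        refine hN2.trans (le_of_eq ?_)
        field_simp
        norm_num)
  calc ∫⁻ z, ENNReal.ofReal (‖F z‖ ^ p)
      ≤ ∫⁻ z, ENNReal.ofReal ((B * N) ^ p) * ENNReal.ofReal ((‖F z‖ / (B * N)) ^ (2 * r)) := by
        refine lintegral_mono fun z => ?_
        rw [← ENNReal.ofReal_mul (by positivity)]
        refine ENNReal.ofReal_le_ofReal ?_
        have h1 : ‖F z‖ ^ p = (B * N) ^ p * (‖F z‖ / (B * N)) ^ p := by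
          rw [← Real.mul_rpow hBN.le (by positivity), mul_div_cancel₀ _ hBN.ne']
        rw [h1]
        refine mul_le_mul_of_nonneg_left ?_ (by positivity)
        exact Real.rpow_le_rpow_of_exponent_ge' (by positivity) ((div_le_one hBN).2 (hFB z))
          (by positivity) hp
    _ = ENNReal.ofReal ((B * N) ^ p) * ∫⁻ z, ENNReal.ofReal ((‖F z‖ / (B * N)) ^ (2 * r)) :=
        lintegral_const_mul' _ _ ENNReal.ofReal_ne_top
    _ ≤ _ := by
        refine (mul_le_mul_right key _).trans (le_of_eq ?_)
        rw [← ENNReal.ofReal_mul (by positivity)]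
        congr 1
        rw [Real.mul_rpow hB0.le hN.le,
          show C * (lam ^ k)⁻¹ * (4 / B ^ 2) ^ r = (C * (4 / B ^ 2) ^ r) * (lam ^ k)⁻¹ by ring,
          Real.mul_rpow (by positivity) (by positivity)]
        ring

end strongTypeOsc

section strongTypeClass

variable {Z Y : Type} [NormedAddCommGroup Z] [NormedSpace ℝ Z] [FiniteDimensional ℝ Z]
  [MeasureSpace Z] [BorelSpace Z] [(volume : Measure Z).IsAddHaarMeasure]
  [NormedAddCommGroup Y] [NormedSpace ℝ Y] [FiniteDimensional ℝ Y]
  [MeasureSpace Y] [BorelSpace Y] [(volume : Measure Y).IsAddHaarMeasure]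

/-- The oscillatory integral operators with phase `ψ` and amplitude `A` satisfy the `Lᵖ` estimate
with decay `lam ^ (-k)`, up to an arbitrarily small loss in the exponent. -/
def HasStrongType (ψ : Z × Y → ℝ) (A : Z × Y → ℂ) (k : ℕ) (p : ℝ) : Prop :=
  ∀ θ : ℝ, 0 < θ → θ < 1 → ∃ C : ℝ, 0 ≤ C ∧ ∀ lam : ℝ, 0 < lam →
    ∀ f : Y → ℂ, Continuous f → HasCompactSupport f →
      ∀ N : ℝ, 0 < N → ∫ y, ‖f y‖ ^ 2 ≤ N ^ 2 → ∫ y, ‖f y‖ ≤ N →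
        ∫⁻ z, ‖∫ y, oscKernel ψ A lam (z, y) * f y‖ₑ ^ p ≤
          ENNReal.ofReal (C * ((lam ^ k)⁻¹) ^ (1 - θ) * N ^ p)

theorem HasStrongType.zero {ψ : Z × Y → ℝ} {k : ℕ} {p : ℝ} (hp : 0 < p) :
    HasStrongType ψ (0 : Z × Y → ℂ) k p := fun θ _ _ =>
  ⟨0, le_rfl, fun lam _ f _ _ N _ _ _ => by simp [oscKernel, hp]⟩

theorem integrable_oscKernel_mul {ψ : Z × Y → ℝ} (hψ : Continuous ψ) {A : Z × Y → ℂ}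
    (hA : Continuous A) (hAs : HasCompactSupport A) (lam : ℝ) {f : Y → ℂ} (hf : Continuous f)
    (z : Z) : Integrable fun y => oscKernel ψ A lam (z, y) * f y := by
  have h1 : Continuous fun y => oscKernel ψ A lam (z, y) * f y :=
    ((continuous_oscKernel hψ hA lam).comp (by fun_prop : Continuous fun y : Y => (z, y))).mul hf
  exact h1.integrable_of_hasCompactSupport
    (((hasCompactSupport_oscKernel ψ hAs lam).slice_left z).mul_right)

theorem HasStrongType.add {ψ : Z × Y → ℝ} (hψ : Continuous ψ) {A₁ A₂ : Z × Y → ℂ}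
    (hA₁ : Continuous A₁) (hAs₁ : HasCompactSupport A₁)
    (hA₂ : Continuous A₂) (hAs₂ : HasCompactSupport A₂) {k : ℕ} {p : ℝ} (hp : 1 ≤ p)
    (h₁ : HasStrongType ψ A₁ k p) (h₂ : HasStrongType ψ A₂ k p) :
    HasStrongType ψ (A₁ + A₂) k p := fun θ hθ hθ1 => by
  obtain ⟨C₁, hC₁, key₁⟩ := h₁ θ hθ hθ1
  obtain ⟨C₂, hC₂, key₂⟩ := h₂ θ hθ hθ1
  refine ⟨2 ^ (p - 1) * (C₁ + C₂), by positivity, fun lam hlam f hf hfs N hN hN2 hN1 => ?_⟩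
  have k₁ := key₁ lam hlam f hf hfs N hN hN2 hN1
  have k₂ := key₂ lam hlam f hf hfs N hN hN2 hN1
  have hm : Measurable fun z => ‖∫ y, oscKernel ψ A₁ lam (z, y) * f y‖ₑ ^ p :=
    ((continuous_integral_oscKernel hψ hA₁ hAs₁ lam hf).enorm.measurable).pow_const p
  calc ∫⁻ z, ‖∫ y, oscKernel ψ (A₁ + A₂) lam (z, y) * f y‖ₑ ^ p
      ≤ ∫⁻ z, 2 ^ (p - 1) * (‖∫ y, oscKernel ψ A₁ lam (z, y) * f y‖ₑ ^ p +
          ‖∫ y, oscKernel ψ A₂ lam (z, y) * f y‖ₑ ^ p) := by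
        refine lintegral_mono fun z => ?_
        refine le_trans ?_ (ENNReal.rpow_add_le_mul_rpow_add_rpow _ _ hp)
        refine ENNReal.rpow_le_rpow ?_ (by linarith)
        have : ∫ y, oscKernel ψ (A₁ + A₂) lam (z, y) * f y =
            (∫ y, oscKernel ψ A₁ lam (z, y) * f y) + ∫ y, oscKernel ψ A₂ lam (z, y) * f y := by
          rw [← integral_add (integrable_oscKernel_mul hψ hA₁ hAs₁ lam hf z)
            (integrable_oscKernel_mul hψ hA₂ hAs₂ lam hf z)]
          congr 1
          ext y
          simp only [oscKernel, Pi.add_apply]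
          ring
        rw [this]
        exact enorm_add_le _ _
    _ = 2 ^ (p - 1) * ((∫⁻ z, ‖∫ y, oscKernel ψ A₁ lam (z, y) * f y‖ₑ ^ p) +
          ∫⁻ z, ‖∫ y, oscKernel ψ A₂ lam (z, y) * f y‖ₑ ^ p) := by
        rw [lintegral_const_mul' _ _ (ENNReal.rpow_ne_top_of_nonneg (by linarith) (by simp)),
          lintegral_add_left hm]
    _ ≤ 2 ^ (p - 1) * (ENNReal.ofReal (C₁ * ((lam ^ k)⁻¹) ^ (1 - θ) * N ^ p) +
          ENNReal.ofReal (C₂ * ((lam ^ k)⁻¹) ^ (1 - θ) * N ^ p)) := by gcongr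
    _ = _ := by
        rw [← ENNReal.ofReal_add (by positivity) (by positivity),
          show (2 : ℝ≥0∞) = ENNReal.ofReal 2 by simp,
          ENNReal.ofReal_rpow_of_nonneg (by norm_num) (by linarith),
          ← ENNReal.ofReal_mul (by positivity)]
        congr 1
        ring

theorem HasStrongType.of_comp_equiv {Z' : Type} [NormedAddCommGroup Z'] [NormedSpace ℝ Z']
    [FiniteDimensional ℝ Z'] [MeasureSpace Z'] [BorelSpace Z']
    [(volume : Measure Z').IsAddHaarMeasure] (e : Z' ≃L[ℝ] Z) {ψ : Z × Y → ℝ} {A : Z × Y → ℂ}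
    {k : ℕ} {p : ℝ}
    (h : HasStrongType (fun q : Z' × Y => ψ (e q.1, q.2)) (fun q : Z' × Y => A (e q.1, q.2)) k p) :
    HasStrongType ψ A k p := fun θ hθ hθ1 => by
  obtain ⟨C, hC, key⟩ := h θ hθ hθ1
  have : (Measure.map e (volume : Measure Z')).IsAddHaarMeasure := e.isAddHaarMeasure_map _
  obtain ⟨c, hc⟩ : ∃ c : NNReal, (volume : Measure Z) = c • Measure.map e (volume : Measure Z') :=
    ⟨_, Measure.isAddLeftInvariant_eq_smul _ _⟩
  refine ⟨c * C, by positivity, fun lam hlam f hf hfs N hN hN2 hN1 => ?_⟩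
  have k₁ := key lam hlam f hf hfs N hN hN2 hN1
  rw [hc, lintegral_smul_measure,
    show ∫⁻ z, ‖∫ y, oscKernel ψ A lam (z, y) * f y‖ₑ ^ p ∂(Measure.map e volume) =
      ∫⁻ z, ‖∫ y, oscKernel ψ A lam (e z, y) * f y‖ₑ ^ p from
      lintegral_map_equiv _ e.toHomeomorph.toMeasurableEquiv]
  rw [ENNReal.smul_def, smul_eq_mul]
  refine (mul_le_mul_right k₁ _).trans (le_of_eq ?_)
  rw [← ENNReal.ofReal_coe_nnreal, ← ENNReal.ofReal_mul (by positivity)]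
  congr 1
  ring

theorem HasStrongType.of_locally {ψ : Z × Y → ℝ} (hψ : Continuous ψ) {k : ℕ} {p : ℝ} (hp : 1 ≤ p)
    {K : Set (Z × Y)} (hK : IsCompact K)
    (hloc : ∀ q ∈ K, ∃ U : Set (Z × Y), IsOpen U ∧ q ∈ U ∧ ∀ A : Z × Y → ℂ,
      ContDiff ℝ (⊤ : ℕ∞) A → HasCompactSupport A → tsupport A ⊆ U → HasStrongType ψ A k p) :
    ∀ A : Z × Y → ℂ, ContDiff ℝ (⊤ : ℕ∞) A → HasCompactSupport A → tsupport A ⊆ K →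
      HasStrongType ψ A k p := by
  suffices h : ∃ U : Set (Z × Y), IsOpen U ∧ K ⊆ U ∧ ∀ A : Z × Y → ℂ,
      ContDiff ℝ (⊤ : ℕ∞) A → HasCompactSupport A → tsupport A ⊆ U → HasStrongType ψ A k p by
    obtain ⟨U, -, hKU, hU⟩ := h
    exact fun A hA hAs hAK => hU A hA hAs (hAK.trans hKU)
  refine IsCompact.induction_on (p := fun K => ∃ U : Set (Z × Y), IsOpen U ∧ K ⊆ U ∧
    ∀ A : Z × Y → ℂ, ContDiff ℝ (⊤ : ℕ∞) A → HasCompactSupport A → tsupport A ⊆ U →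
      HasStrongType ψ A k p) hK ?_ ?_ ?_ ?_
  · refine ⟨∅, isOpen_empty, subset_rfl, fun A _ _ hA => ?_⟩
    rw [Set.subset_empty_iff, tsupport_eq_empty_iff] at hA
    rw [hA]
    exact HasStrongType.zero (by linarith)
  · rintro s t hst ⟨U, hU, hsU, h⟩
    exact ⟨U, hU, hst.trans hsU, h⟩
  · rintro s t ⟨U₁, hU₁, hsU₁, h₁⟩ ⟨U₂, hU₂, htU₂, h₂⟩
    refine ⟨U₁ ∪ U₂, hU₁.union hU₂, Set.union_subset_union hsU₁ htU₂, fun A hA hAs hAU => ?_⟩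
    have hc : IsCompact (tsupport A \ U₂) := IsCompact.diff hAs hU₂
    obtain ⟨L, hL, hcL, hLU⟩ := exists_compact_between hc hU₁ (fun q hq =>
      (hAU hq.1).resolve_right hq.2)
    obtain ⟨φ, hφ1, hφ0, -⟩ := exists_contMDiffMap_one_nhds_of_subset_interior
      (n := (⊤ : ℕ∞)) (modelWithCornersSelf ℝ (Z × Y)) hc.isClosed hcL
    have hφ : ContDiff ℝ (⊤ : ℕ∞) (φ : Z × Y → ℝ) := φ.contMDiff.contDiff
    have hφC : ContDiff ℝ (⊤ : ℕ∞) fun q => ((φ q : ℝ) : ℂ) :=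
      Complex.ofRealCLM.contDiff.comp hφ
    have e : A = (fun q => ((φ q : ℝ) : ℂ) * A q) + fun q => (1 - ((φ q : ℝ) : ℂ)) * A q := by
      ext q
      simp only [Pi.add_apply]
      ring
    have s₁ : HasCompactSupport fun q => ((φ q : ℝ) : ℂ) * A q :=
      HasCompactSupport.mul_left (f := fun q => ((φ q : ℝ) : ℂ)) hAs
    have s₂ : HasCompactSupport fun q => (1 - ((φ q : ℝ) : ℂ)) * A q :=
      HasCompactSupport.mul_left (f := fun q => 1 - ((φ q : ℝ) : ℂ)) hAs
    rw [e]
    refine HasStrongType.add hψ (hφC.mul hA).continuous s₁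
      ((contDiff_const.sub hφC).mul hA).continuous s₂ hp (h₁ _ (hφC.mul hA) s₁ ?_)
      (h₂ _ ((contDiff_const.sub hφC).mul hA) s₂ ?_)
    · refine (closure_minimal (fun q hq => ?_) hL.isClosed).trans hLU
      by_contra h
      exact hq (by simp [hφ0 q h])
    · intro q hq
      by_contra h
      have hqA : q ∈ tsupport A := tsupport_mul_subset_right hq
      have h1 : ∀ᶠ x in nhds q, φ x = 1 := (eventually_nhdsSet_iff_forall.1 hφ1) q ⟨hqA, h⟩
      refine (notMem_tsupport_iff_eventuallyEq.2 ?_) hq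
      filter_upwards [h1] with x hx
      simp [hx]
  · intro q hq
    obtain ⟨U, hU, hqU, h⟩ := hloc q hq
    exact ⟨U, mem_nhdsWithin_of_mem_nhds (hU.mem_nhds hqU), U, hU, subset_rfl, h⟩

end strongTypeClass

section maximal

theorem enorm_rpow_le_integral_add_integral_deriv {g g' : ℝ → ℂ}
    (hg : ∀ t, HasDerivAt g (g' t) t) (hg' : Continuous g') {p : ℝ} (hp : 1 < p) {lam : ℝ}
    (hlam : 0 < lam) (t : ℝ) :
    ‖g t‖ₑ ^ p ≤ 2 ^ (p - 1) * (ENNReal.ofReal lam * (∫⁻ s, ‖g s‖ₑ ^ p) +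
      ENNReal.ofReal (1 / lam) ^ (p - 1) * ∫⁻ s, ‖g' s‖ₑ ^ p) := by
  have hgc : Continuous g := continuous_iff_continuousAt.2 fun t => (hg t).continuousAt
  obtain ⟨J, hJ⟩ : ∃ J, J = Set.Ioc t (t + 1 / lam) := ⟨_, rfl⟩
  have hJv : volume J = ENNReal.ofReal (1 / lam) := by rw [hJ, Real.volume_Ioc, add_sub_cancel_left]
  have hJm : MeasurableSet J := hJ ▸ measurableSet_Ioc
  obtain ⟨G, hG⟩ : ∃ G, G = ∫⁻ s in J, ‖g' s‖ₑ := ⟨_, rfl⟩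
  have hp0 : (2 : ℝ≥0∞) ^ (p - 1) ≠ ⊤ := ENNReal.rpow_ne_top_of_nonneg (by linarith) (by simp)
  have h1 : ∀ s ∈ J, ‖g t‖ₑ ^ p ≤ 2 ^ (p - 1) * (‖g s‖ₑ ^ p + G ^ p) := fun s hs => by
    rw [hJ] at hs
    refine le_trans ?_ (ENNReal.rpow_add_le_mul_rpow_add_rpow _ _ hp.le)
    refine ENNReal.rpow_le_rpow ?_ (by linarith)
    have h2 : g t = g s - ∫ u in t..s, g' u := by
      rw [intervalIntegral.integral_eq_sub_of_hasDerivAt (fun u _ => hg u)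
        (hg'.intervalIntegrable _ _)]
      ring
    rw [h2, sub_eq_add_neg]
    refine (enorm_add_le _ _).trans (add_le_add_right ?_ _)
    rw [enorm_neg, intervalIntegral.integral_of_le hs.1.le, hG, hJ]
    exact (enorm_integral_le_lintegral_enorm _).trans
      (lintegral_mono_set (Set.Ioc_subset_Ioc_right hs.2))
  have hGp : G ^ p ≤ ENNReal.ofReal (1 / lam) ^ (p - 1) * ∫⁻ s, ‖g' s‖ₑ ^ p := by
    have hpq := Real.HolderConjugate.conjExponent hp
    have h3 := ENNReal.lintegral_mul_le_Lp_mul_Lq (volume.restrict J) hpq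
      (f := fun s => ‖g' s‖ₑ) (g := fun _ => 1) hg'.enorm.aemeasurable aemeasurable_const
    simp only [Pi.mul_apply, mul_one, ENNReal.one_rpow, lintegral_const,
      Measure.restrict_apply_univ, one_mul, hJv] at h3
    rw [← hG] at h3
    calc G ^ p ≤ _ := ENNReal.rpow_le_rpow h3 (by linarith)
      _ = (∫⁻ s in J, ‖g' s‖ₑ ^ p) * ENNReal.ofReal (1 / lam) ^ (p - 1) := by
        rw [ENNReal.mul_rpow_of_nonneg _ _ (by linarith), ← ENNReal.rpow_mul, ← ENNReal.rpow_mul,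
          one_div_mul_cancel (by linarith), ENNReal.rpow_one]
        congr 2
        rw [Real.conjExponent]
        field_simp
      _ ≤ _ := by
        rw [mul_comm]
        exact mul_le_mul_right (setLIntegral_le_lintegral _ _) _
  have h4 : ENNReal.ofReal (1 / lam) * ‖g t‖ₑ ^ p ≤
      2 ^ (p - 1) * ((∫⁻ s in J, ‖g s‖ₑ ^ p) + G ^ p * ENNReal.ofReal (1 / lam)) := by
    calc ENNReal.ofReal (1 / lam) * ‖g t‖ₑ ^ p = ∫⁻ s in J, ‖g t‖ₑ ^ p := by
          rw [setLIntegral_const, hJv, mul_comm]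
      _ ≤ ∫⁻ s in J, 2 ^ (p - 1) * (‖g s‖ₑ ^ p + G ^ p) := setLIntegral_mono' hJm h1
      _ = _ := by
          rw [lintegral_const_mul' _ _ hp0, lintegral_add_right _ measurable_const,
            setLIntegral_const, hJv]
  have h5 : ENNReal.ofReal lam * ENNReal.ofReal (1 / lam) = 1 := by
    rw [← ENNReal.ofReal_mul hlam.le, mul_one_div_cancel hlam.ne', ENNReal.ofReal_one]
  calc ‖g t‖ₑ ^ p = ENNReal.ofReal lam * (ENNReal.ofReal (1 / lam) * ‖g t‖ₑ ^ p) := by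
        rw [← mul_assoc, h5, one_mul]
    _ ≤ ENNReal.ofReal lam *
        (2 ^ (p - 1) * ((∫⁻ s in J, ‖g s‖ₑ ^ p) + G ^ p * ENNReal.ofReal (1 / lam))) :=
        mul_le_mul_right h4 _
    _ = 2 ^ (p - 1) * (ENNReal.ofReal lam * (∫⁻ s in J, ‖g s‖ₑ ^ p) +
          (ENNReal.ofReal lam * ENNReal.ofReal (1 / lam)) * G ^ p) := by ring
    _ ≤ _ := by
        rw [h5, one_mul]
        gcongr
        exact Measure.restrict_le_self

variable {X Y : Type} [NormedAddCommGroup X] [NormedSpace ℝ X] [FiniteDimensional ℝ X]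
  [MeasureSpace X] [BorelSpace X] [(volume : Measure X).IsAddHaarMeasure]
  [NormedAddCommGroup Y] [NormedSpace ℝ Y] [FiniteDimensional ℝ Y]
  [MeasureSpace Y] [BorelSpace Y] [(volume : Measure Y).IsAddHaarMeasure]

/-- The phase `t * Φ (x, y)`, with the dilation parameter `t` as an additional variable. -/
def dilatedPhase (Φ : X × Y → ℝ) (q : (X × ℝ) × Y) : ℝ := q.1.2 * Φ (q.1.1, q.2)

theorem contDiff_dilatedPhase {Φ : X × Y → ℝ} (hΦ : ContDiff ℝ (⊤ : ℕ∞) Φ) :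
    ContDiff ℝ (⊤ : ℕ∞) (dilatedPhase Φ) :=
  (contDiff_snd.comp contDiff_fst).mul
    (hΦ.comp ((contDiff_fst.comp contDiff_fst).prodMk contDiff_snd))

theorem hasDerivAt_integral_oscKernel {Φ : X × Y → ℝ} (hΦ : ContDiff ℝ (⊤ : ℕ∞) Φ)
    {A : (X × ℝ) × Y → ℂ} (hA : ContDiff ℝ (⊤ : ℕ∞) A) (hAs : HasCompactSupport A) (lam : ℝ)
    {f : Y → ℂ} (hf : Continuous f) (hfs : HasCompactSupport f) (x : X) (t : ℝ) :
    HasDerivAt (fun t => ∫ y, oscKernel (dilatedPhase Φ) A lam ((x, t), y) * f y)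
      (lam * (∫ y, oscKernel (dilatedPhase Φ)
          (fun q => Complex.I * (Φ (q.1.1, q.2) : ℂ) * A q) lam ((x, t), y) * f y) +
        ∫ y, oscKernel (dilatedPhase Φ) (fun q => fderiv ℝ A q ((0, 1), 0)) lam ((x, t), y) * f y)
      t := by
  set A₁ : (X × ℝ) × Y → ℂ := fun q => Complex.I * (Φ (q.1.1, q.2) : ℂ) * A q
  set A₂ : (X × ℝ) × Y → ℂ := fun q => fderiv ℝ A q ((0, 1), 0)
  have hψ : Continuous (dilatedPhase Φ) := (contDiff_dilatedPhase hΦ).continuous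
  have hΦc := hΦ.continuous
  have hA₁ : Continuous A₁ := by
    have := hA.continuous
    fun_prop
  have hA₂ : Continuous A₂ := (contDiff_fderiv_apply_const hA _).continuous
  have hs₁ : HasCompactSupport A₁ :=
    hAs.mono fun q hq => right_ne_zero_of_mul hq
  have hs₂ : HasCompactSupport A₂ := hAs.fderiv_apply ℝ _
  obtain ⟨B₁, hB₁⟩ := hA₁.bounded_above_of_compact_support hs₁
  obtain ⟨B₂, hB₂⟩ := hA₂.bounded_above_of_compact_support hs₂
  have e : lam * (∫ y, oscKernel (dilatedPhase Φ) A₁ lam ((x, t), y) * f y) +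
      ∫ y, oscKernel (dilatedPhase Φ) A₂ lam ((x, t), y) * f y =
      ∫ y, (lam * (oscKernel (dilatedPhase Φ) A₁ lam ((x, t), y) * f y) +
        oscKernel (dilatedPhase Φ) A₂ lam ((x, t), y) * f y) := by
    rw [integral_add ((integrable_oscKernel_mul hψ hA₁ hs₁ lam hf _).const_mul _)
      (integrable_oscKernel_mul hψ hA₂ hs₂ lam hf _), integral_const_mul]
  rw [e]
  refine (hasDerivAt_integral_of_dominated_loc_of_deriv_le (μ := volume)
    (bound := fun y => (|lam| * B₁ + B₂) * ‖f y‖)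
    (F := fun t y => oscKernel (dilatedPhase Φ) A lam ((x, t), y) * f y)
    (F' := fun t y => lam * (oscKernel (dilatedPhase Φ) A₁ lam ((x, t), y) * f y) +
        oscKernel (dilatedPhase Φ) A₂ lam ((x, t), y) * f y) Filter.univ_mem
    (Filter.Eventually.of_forall fun t =>
      (integrable_oscKernel_mul hψ hA.continuous hAs lam hf _).aestronglyMeasurable)
    (integrable_oscKernel_mul hψ hA.continuous hAs lam hf _)
    (((integrable_oscKernel_mul hψ hA₁ hs₁ lam hf _).const_mul _).add
      (integrable_oscKernel_mul hψ hA₂ hs₂ lam hf _)).aestronglyMeasurable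
    (Filter.Eventually.of_forall fun y t _ => ?_)
    ((hf.norm.integrable_of_hasCompactSupport hfs.norm).const_mul _)
    (Filter.Eventually.of_forall fun y t _ => ?_)).2
  · rw [add_mul]
    refine (norm_add_le _ _).trans (add_le_add ?_ ?_)
    · rw [norm_mul, norm_mul, norm_oscKernel, Complex.norm_real, Real.norm_eq_abs, mul_assoc]
      exact mul_le_mul_of_nonneg_left (mul_le_mul_of_nonneg_right (hB₁ _) (norm_nonneg _))
        (abs_nonneg _)
    · rw [norm_mul, norm_oscKernel]
      exact mul_le_mul_of_nonneg_right (hB₂ _) (norm_nonneg _)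
  · have h1 : HasDerivAt (fun t : ℝ => (((x, t), y) : (X × ℝ) × Y)) ((0, 1), 0) t :=
      ((hasDerivAt_const t x).prodMk (hasDerivAt_id t)).prodMk (hasDerivAt_const t y)
    have h2 : HasDerivAt (fun t : ℝ => A ((x, t), y)) (A₂ ((x, t), y)) t :=
      ((hA.differentiable (by simp)) _).hasFDerivAt.comp_hasDerivAt t h1
    have h3 : HasDerivAt (fun t : ℝ => ((lam * (t * Φ (x, y)) : ℝ) : ℂ))
        ((lam * (1 * Φ (x, y)) : ℝ) : ℂ) t :=
      (((hasDerivAt_id t).mul_const _).const_mul lam).ofReal_comp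
    have h4 := (((h3.const_mul Complex.I).cexp.mul h2).mul_const (f y))
    refine h4.congr_deriv ?_
    simp only [oscKernel, dilatedPhase, A₁]
    push_cast
    ring

theorem lintegral_iSup_le_of_hasStrongType {Φ : X × Y → ℝ} (hΦ : ContDiff ℝ (⊤ : ℕ∞) Φ)
    {A : (X × ℝ) × Y → ℂ} (hA : ContDiff ℝ (⊤ : ℕ∞) A) (hAs : HasCompactSupport A)
    {k : ℕ} {p : ℝ} (hp : 1 < p) (h₀ : HasStrongType (dilatedPhase Φ) A k p)
    (h₁ : HasStrongType (dilatedPhase Φ) (fun q => Complex.I * (Φ (q.1.1, q.2) : ℂ) * A q) k p)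
    (h₂ : HasStrongType (dilatedPhase Φ) (fun q => fderiv ℝ A q ((0, 1), 0)) k p)
    {θ : ℝ} (hθ : 0 < θ) (hθ1 : θ < 1) : ∃ C : ℝ, 0 ≤ C ∧ ∀ lam : ℝ, 1 ≤ lam →
    ∀ f : Y → ℂ, Continuous f → HasCompactSupport f →
      ∀ N : ℝ, 0 < N → ∫ y, ‖f y‖ ^ 2 ≤ N ^ 2 → ∫ y, ‖f y‖ ≤ N →
        ∫⁻ x, ⨆ t : ℝ, ‖∫ y, oscKernel (dilatedPhase Φ) A lam ((x, t), y) * f y‖ₑ ^ p ≤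
          ENNReal.ofReal (C * (lam * ((lam ^ k)⁻¹) ^ (1 - θ)) * N ^ p) := by
  obtain ⟨C₀, hC₀, key₀⟩ := h₀ θ hθ hθ1
  obtain ⟨C₁, hC₁, key₁⟩ := h₁ θ hθ hθ1
  obtain ⟨C₂, hC₂, key₂⟩ := h₂ θ hθ hθ1
  set A₁ : (X × ℝ) × Y → ℂ := fun q => Complex.I * (Φ (q.1.1, q.2) : ℂ) * A q
  set A₂ : (X × ℝ) × Y → ℂ := fun q => fderiv ℝ A q ((0, 1), 0)
  have hψ : Continuous (dilatedPhase Φ) := (contDiff_dilatedPhase hΦ).continuous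
  have hΦc := hΦ.continuous
  have hA₁ : Continuous A₁ := by
    have := hA.continuous
    fun_prop
  have hA₂ : Continuous A₂ := (contDiff_fderiv_apply_const hA _).continuous
  have hs₁ : HasCompactSupport A₁ :=
    hAs.mono fun q hq => right_ne_zero_of_mul hq
  have hs₂ : HasCompactSupport A₂ := hAs.fderiv_apply ℝ _
  obtain ⟨c, hc⟩ : ∃ c : ℝ, c = 2 ^ (p - 1) := ⟨_, rfl⟩
  have hc0 : 0 ≤ c := hc ▸ by positivity
  have hcE : (2 : ℝ≥0∞) ^ (p - 1) = ENNReal.ofReal c := by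
    rw [hc, ← ENNReal.ofReal_rpow_of_nonneg (by norm_num) (by linarith)]
    simp
  refine ⟨c * (C₀ + c * (C₁ + C₂)), by positivity, fun lam hlam f hf hfs N hN hN2 hN1 => ?_⟩
  have hlam0 : 0 < lam := by linarith
  have k₀ := key₀ lam hlam0 f hf hfs N hN hN2 hN1
  have k₁ := key₁ lam hlam0 f hf hfs N hN hN2 hN1
  have k₂ := key₂ lam hlam0 f hf hfs N hN hN2 hN1
  set F : X × ℝ → ℂ := fun z => ∫ y, oscKernel (dilatedPhase Φ) A lam (z, y) * f y
  set F₁ : X × ℝ → ℂ := fun z => ∫ y, oscKernel (dilatedPhase Φ) A₁ lam (z, y) * f y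
  set F₂ : X × ℝ → ℂ := fun z => ∫ y, oscKernel (dilatedPhase Φ) A₂ lam (z, y) * f y
  have hF : Continuous F := continuous_integral_oscKernel hψ hA.continuous hAs lam hf
  have hF₁ : Continuous F₁ := continuous_integral_oscKernel hψ hA₁ hs₁ lam hf
  have hF₂ : Continuous F₂ := continuous_integral_oscKernel hψ hA₂ hs₂ lam hf
  have hm : Measurable fun z => ‖F z‖ₑ ^ p := hF.enorm.measurable.pow_const p
  have hm₁ : Measurable fun z => ‖F₁ z‖ₑ ^ p := hF₁.enorm.measurable.pow_const p
  have hm₂ : Measurable fun z => ‖F₂ z‖ₑ ^ p := hF₂.enorm.measurable.pow_const p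
  let G : X × ℝ → ℝ≥0∞ := fun z =>
    ‖F z‖ₑ ^ p + ENNReal.ofReal c * (‖F₁ z‖ₑ ^ p + ‖F₂ z‖ₑ ^ p)
  have hG : Measurable G := hm.add ((hm₁.add hm₂).const_mul _)
  have hpt : ∀ x, ⨆ t : ℝ, ‖F (x, t)‖ₑ ^ p ≤
      ENNReal.ofReal c * ENNReal.ofReal lam * ∫⁻ t, G (x, t) := fun x => by
    refine iSup_le fun t => ?_
    have h := enorm_rpow_le_integral_add_integral_deriv (g := fun t => F (x, t))
      (g' := fun t => lam * F₁ (x, t) + F₂ (x, t))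
      (fun t => hasDerivAt_integral_oscKernel hΦ hA hAs lam hf hfs x t) (by fun_prop) hp hlam0 t
    rw [hcE] at h
    refine h.trans ?_
    rw [mul_assoc]
    refine mul_le_mul_right ?_ _
    have h5 : ENNReal.ofReal (1 / lam) ≤ 1 := by
      rw [ENNReal.ofReal_le_one, div_le_one hlam0]
      exact hlam
    have h6 : 1 ≤ ENNReal.ofReal lam := by simpa using hlam
    have h7 : ENNReal.ofReal (1 / lam) ^ (p - 1) * ENNReal.ofReal lam ^ p = ENNReal.ofReal lam := by
      rw [ENNReal.ofReal_rpow_of_pos hlam0, ENNReal.ofReal_rpow_of_pos (by positivity),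
        ← ENNReal.ofReal_mul (by positivity)]
      congr 1
      rw [one_div, Real.inv_rpow hlam0.le, Real.rpow_sub_one hlam0.ne']
      field_simp
    have h8 : ENNReal.ofReal (1 / lam) ^ (p - 1) *
        ∫⁻ s, ‖(lam : ℂ) * F₁ (x, s) + F₂ (x, s)‖ₑ ^ p ≤
        ENNReal.ofReal lam * ∫⁻ s, ENNReal.ofReal c * (‖F₁ (x, s)‖ₑ ^ p + ‖F₂ (x, s)‖ₑ ^ p) := by
      rw [← lintegral_const_mul' _ _ (ENNReal.rpow_ne_top_of_nonneg (by linarith) (by simp)),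
        ← lintegral_const_mul' _ _ ENNReal.ofReal_ne_top]
      refine lintegral_mono fun s => ?_
      calc ENNReal.ofReal (1 / lam) ^ (p - 1) * ‖(lam : ℂ) * F₁ (x, s) + F₂ (x, s)‖ₑ ^ p
          ≤ ENNReal.ofReal (1 / lam) ^ (p - 1) *
            (ENNReal.ofReal c * (ENNReal.ofReal lam ^ p * ‖F₁ (x, s)‖ₑ ^ p +
              ‖F₂ (x, s)‖ₑ ^ p)) := by
            refine mul_le_mul_right ?_ _
            rw [← hcE, ← ENNReal.mul_rpow_of_nonneg _ _ (by linarith)]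
            refine le_trans ?_ (ENNReal.rpow_add_le_mul_rpow_add_rpow _ _ hp.le)
            refine ENNReal.rpow_le_rpow ((enorm_add_le _ _).trans (le_of_eq ?_)) (by linarith)
            rw [enorm_mul, ← ofReal_norm (lam : ℂ), Complex.norm_real,
              Real.norm_of_nonneg hlam0.le]
        _ = ENNReal.ofReal c * ((ENNReal.ofReal (1 / lam) ^ (p - 1) * ENNReal.ofReal lam ^ p) *
              ‖F₁ (x, s)‖ₑ ^ p + ENNReal.ofReal (1 / lam) ^ (p - 1) * ‖F₂ (x, s)‖ₑ ^ p) := by ring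
        _ ≤ ENNReal.ofReal c * (ENNReal.ofReal lam * ‖F₁ (x, s)‖ₑ ^ p +
              ENNReal.ofReal lam * ‖F₂ (x, s)‖ₑ ^ p) := by
            rw [h7]
            gcongr
            exact (ENNReal.rpow_le_one h5 (by linarith)).trans h6
        _ = _ := by ring
    refine (add_le_add_right h8 _).trans (le_of_eq ?_)
    have h9 : Measurable fun t : ℝ => ‖F (x, t)‖ₑ ^ p :=
      hm.comp (by fun_prop : Measurable fun t : ℝ => (x, t))
    rw [← mul_add, ← lintegral_add_left h9]
  calc ∫⁻ x, ⨆ t : ℝ, ‖F (x, t)‖ₑ ^ p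
      ≤ ∫⁻ x, ENNReal.ofReal c * ENNReal.ofReal lam * ∫⁻ t, G (x, t) := lintegral_mono hpt
    _ = ENNReal.ofReal c * ENNReal.ofReal lam * ∫⁻ z, G z := by
        rw [lintegral_const_mul' _ _ (ENNReal.mul_ne_top ENNReal.ofReal_ne_top
          ENNReal.ofReal_ne_top), Measure.volume_eq_prod, lintegral_prod _ hG.aemeasurable]
    _ = ENNReal.ofReal c * ENNReal.ofReal lam * ((∫⁻ z, ‖F z‖ₑ ^ p) +
          ENNReal.ofReal c * ((∫⁻ z, ‖F₁ z‖ₑ ^ p) + ∫⁻ z, ‖F₂ z‖ₑ ^ p)) := by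
        rw [lintegral_add_left hm, lintegral_const_mul' _ _ ENNReal.ofReal_ne_top,
          lintegral_add_left hm₁]
    _ ≤ ENNReal.ofReal c * ENNReal.ofReal lam *
        (ENNReal.ofReal (C₀ * ((lam ^ k)⁻¹) ^ (1 - θ) * N ^ p) + ENNReal.ofReal c *
          (ENNReal.ofReal (C₁ * ((lam ^ k)⁻¹) ^ (1 - θ) * N ^ p) +
            ENNReal.ofReal (C₂ * ((lam ^ k)⁻¹) ^ (1 - θ) * N ^ p))) := by gcongr
    _ = _ := by
        rw [← ENNReal.ofReal_add (by positivity) (by positivity), ← ENNReal.ofReal_mul hc0,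
          ← ENNReal.ofReal_mul hc0, ← ENNReal.ofReal_add (by positivity) (by positivity),
          ← ENNReal.ofReal_mul (by positivity)]
        congr 1
        ring

end maximal

section assembly

theorem integral_norm_pow_le_of_compact_support {Y : Type} [TopologicalSpace Y] [T2Space Y]
    [MeasureSpace Y] [BorelSpace Y] [IsFiniteMeasureOnCompacts (volume : Measure Y)]
    {K : Set Y} (hK : IsCompact K) {p : ℝ} (q : ℕ) (hq : q ≠ 0) (hqp : (q : ℝ) ≤ p) :
    ∃ M : ℝ, 0 ≤ M ∧ ∀ f g : Y → ℂ, Continuous g → (∀ y, ‖g y‖ ≤ ‖f y‖) →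
      Function.support g ⊆ K → eLpNorm f (ENNReal.ofReal p) volume ≠ ⊤ →
      ∫ y, ‖g y‖ ^ q ≤ (M * (eLpNorm f (ENNReal.ofReal p) volume).toReal) ^ q := by
  obtain ⟨M, hM⟩ : ∃ M, M = volume K ^ (1 / (q : ℝ) - 1 / p) := ⟨_, rfl⟩
  have hq0 : (0 : ℝ) < q := by positivity
  have hMtop : M ≠ ⊤ := hM ▸ ENNReal.rpow_ne_top_of_nonneg
    (sub_nonneg.2 (one_div_le_one_div_of_le hq0 hqp)) hK.measure_lt_top.ne
  refine ⟨M.toReal, ENNReal.toReal_nonneg, fun f g hg hgf hgK hf => ?_⟩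
  have hgs : HasCompactSupport g := HasCompactSupport.of_support_subset_isCompact hK hgK
  have h1 : eLpNorm g q volume ≤ M * eLpNorm f (ENNReal.ofReal p) volume := by
    rw [← eLpNorm_restrict_eq_of_support_subset hgK]
    have := eLpNorm_le_eLpNorm_mul_rpow_measure_univ (μ := volume.restrict K)
      (p := (q : ℝ≥0∞)) (q := ENNReal.ofReal p) (f := g)
      (by rw [← ENNReal.ofReal_natCast]; exact ENNReal.ofReal_le_ofReal hqp)
      hg.aestronglyMeasurable
    rw [Measure.restrict_apply_univ, ENNReal.toReal_natCast,
      ENNReal.toReal_ofReal (by linarith), ← hM, mul_comm] at this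
    refine this.trans (mul_le_mul_right ?_ _)
    exact (eLpNorm_restrict_le _ _ _ _).trans (eLpNorm_mono hgf)
  have h2 :=
      (hg.memLp_of_hasCompactSupport (μ := volume) (p := q) hgs).eLpNorm_eq_integral_rpow_norm
    (by exact_mod_cast hq) (by simp)
  rw [h2, ← ENNReal.ofReal_toReal (ENNReal.mul_ne_top hMtop hf),
    ENNReal.ofReal_le_ofReal_iff ENNReal.toReal_nonneg, ENNReal.toReal_mul] at h1
  simp only [ENNReal.toReal_natCast, Real.rpow_natCast] at h1
  calc ∫ y, ‖g y‖ ^ q = ((∫ y, ‖g y‖ ^ q) ^ (q : ℝ)⁻¹) ^ q := by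
        rw [← Real.rpow_natCast, ← Real.rpow_mul (integral_nonneg fun y => by positivity),
          inv_mul_cancel₀ hq0.ne', Real.rpow_one]
    _ ≤ _ := pow_le_pow_left₀ (Real.rpow_nonneg (integral_nonneg fun y => by positivity) _) h1 q

theorem isCompact_dilated {X Y : Type} [TopologicalSpace X] [TopologicalSpace Y] {K : Set (X × Y)}
    (hK : IsCompact K) {I : Set ℝ} (hI : IsCompact I) :
    IsCompact {q : (X × ℝ) × Y | (q.1.1, q.2) ∈ K ∧ q.1.2 ∈ I} := by
  convert (hK.prod hI).image (f := fun w : (X × Y) × ℝ => ((w.1.1, w.2), w.1.2))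
    (by fun_prop) using 1
  ext q
  constructor
  · exact fun h => ⟨((q.1.1, q.2), q.1.2), h, rfl⟩
  · rintro ⟨w, h, rfl⟩
    exact h

theorem maximal_bound_of_hasStrongType {n : ℕ} {Φ : V n × V n → ℝ} {a : V n × V n → ℂ}
    (hΦ : ContDiff ℝ (⊤ : ℕ∞) Φ) (ha : ContDiff ℝ (⊤ : ℕ∞) a) (has : HasCompactSupport a)
    {p : ℝ} (hp : 2 ≤ p)
    (hS : ∀ A : (V n × ℝ) × V n → ℂ, ContDiff ℝ (⊤ : ℕ∞) A → HasCompactSupport A →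
      tsupport A ⊆ {q | (q.1.1, q.2) ∈ tsupport a ∧ q.1.2 ∈ Set.Icc (1 / 2) (5 / 2)} →
        HasStrongType (dilatedPhase Φ) A (n + 1) p) {ε : ℝ} (hε : 0 < ε) :
    ∃ C : ℝ, ∀ lam : ℝ, 1 ≤ lam → ∀ f : SchwartzMap (V n) ℂ,
        (∫⁻ x : V n,
            (⨆ μ : (Set.Icc lam (2 * lam)), (‖oscIntN (μ : ℝ) Φ a (⇑f) x‖₊ : ℝ≥0∞)) ^ p)
          ^ (1 / p)
          ≤ ENNReal.ofReal (C * lam ^ (-(n : ℝ) / p + ε)) *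
              eLpNorm (⇑f) (ENNReal.ofReal p) volume := by
  have hp0 : 0 < p := by linarith
  let χ : ContDiffBump (3 / 2 : ℝ) := ⟨1 / 2, 1, by norm_num, by norm_num⟩
  have hχ : ContDiff ℝ (⊤ : ℕ∞) fun t => ((χ t : ℝ) : ℂ) :=
    Complex.ofRealCLM.contDiff.comp χ.contDiff
  let A : (V n × ℝ) × V n → ℂ := fun q => a (q.1.1, q.2) * ((χ q.1.2 : ℝ) : ℂ)
  have hA : ContDiff ℝ (⊤ : ℕ∞) A :=
    (ha.comp ((contDiff_fst.comp contDiff_fst).prodMk contDiff_snd)).mul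
      (hχ.comp (contDiff_snd.comp contDiff_fst))
  have hK := isCompact_dilated has.isCompact (isCompact_Icc (a := (1 / 2 : ℝ)) (b := 5 / 2))
  have hAK : Function.support A ⊆
      {q | (q.1.1, q.2) ∈ tsupport a ∧ q.1.2 ∈ Set.Icc (1 / 2) (5 / 2)} := fun q hq => by
    refine ⟨subset_tsupport _ (left_ne_zero_of_mul hq), ?_⟩
    have h1 : χ q.1.2 ≠ 0 := fun h => right_ne_zero_of_mul hq (by simp [h])
    have h2 : q.1.2 ∈ Metric.ball (3 / 2 : ℝ) 1 := by
      rw [← χ.support_eq]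
      exact h1
    rw [Real.ball_eq_Ioo] at h2
    exact ⟨by linarith [h2.1], by linarith [h2.2]⟩
  have hAs : HasCompactSupport A := HasCompactSupport.of_support_subset_isCompact hK hAK
  have hAt := closure_minimal hAK hK.isClosed
  obtain ⟨θ, hθ0, hθ1, hθ⟩ : ∃ θ : ℝ, 0 < θ ∧ θ < 1 ∧ (n + 1) * θ ≤ p * ε := by
    refine ⟨min (1 / 2) (p * ε / (n + 1)), by positivity,
      (min_le_left _ _).trans_lt (by norm_num), ?_⟩
    rw [← le_div_iff₀' (by positivity)]
    exact min_le_right _ _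
  obtain ⟨C, hC0, hC⟩ := lintegral_iSup_le_of_hasStrongType hΦ hA hAs (by linarith : 1 < p)
    (hS A hA hAs hAt)
    (hS _ (by
        have : ContDiff ℝ (⊤ : ℕ∞) fun q : (V n × ℝ) × V n => (Φ (q.1.1, q.2) : ℂ) :=
          Complex.ofRealCLM.contDiff.comp
            (hΦ.comp ((contDiff_fst.comp contDiff_fst).prodMk contDiff_snd))
        exact (contDiff_const.mul this).mul hA)
      (hAs.mono fun q hq => right_ne_zero_of_mul hq)
      ((closure_mono fun q hq => right_ne_zero_of_mul hq).trans hAt))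
    (hS _ (contDiff_fderiv_apply_const hA _) (hAs.fderiv_apply ℝ _)
      ((tsupport_fderiv_apply_subset ℝ _).trans hAt)) hθ0 hθ1
  have hLc : IsCompact (Prod.snd '' tsupport a) := has.isCompact.image continuous_snd
  obtain ⟨L, hL, hLL⟩ := exists_compact_superset hLc
  obtain ⟨η, hη1, hη0, hη⟩ := exists_contMDiffMap_one_nhds_of_subset_interior
    (n := (⊤ : ℕ∞)) (modelWithCornersSelf ℝ (V n)) hLc.isClosed hLL
  obtain ⟨M₁, hM₁0, hM₁⟩ := integral_norm_pow_le_of_compact_support hL (p := p) 1 one_ne_zero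
    (by push_cast; linarith)
  obtain ⟨M₂, hM₂0, hM₂⟩ := integral_norm_pow_le_of_compact_support hL (p := p) 2 two_ne_zero
    (by push_cast; linarith)
  obtain ⟨M, hM0, hMM₁, hMM₂⟩ : ∃ M, 0 < M ∧ M₁ ≤ M ∧ M₂ ≤ M :=
    ⟨M₁ + M₂ + 1, by positivity, by linarith, by linarith⟩
  refine ⟨C ^ (1 / p) * M, fun lam hlam f => ?_⟩
  have hlam0 : 0 < lam := by linarith
  have hftop : eLpNorm f (ENNReal.ofReal p) volume ≠ ⊤ := (f.memLp _ _).eLpNorm_ne_top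
  rcases eq_or_ne (eLpNorm f (ENNReal.ofReal p) volume) 0 with hf0 | hf0
  · have h1 : (f : V n → ℂ) =ᵐ[volume] 0 :=
      (eLpNorm_eq_zero_iff f.continuous.aestronglyMeasurable (by simpa using hp0)).1 hf0
    have h2 : ∀ μ x, oscIntN μ Φ a f x = 0 := fun μ x => by
      refine integral_eq_zero_of_ae ?_
      filter_upwards [h1] with y hy
      simp [hy]
    simp [h2, hp0]
  · obtain ⟨E, hE⟩ : ∃ E, E = (eLpNorm f (ENNReal.ofReal p) volume).toReal := ⟨_, rfl⟩
    have hE0 : 0 < E := hE ▸ ENNReal.toReal_pos hf0 hftop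
    have hηc : Continuous fun y => ((η y : ℝ) : ℂ) :=
      Complex.continuous_ofReal.comp η.contMDiff.continuous
    let g : V n → ℂ := fun y => ((η y : ℝ) : ℂ) * f y
    have hg : Continuous g := hηc.mul f.continuous
    have hgf : ∀ y, ‖g y‖ ≤ ‖f y‖ := fun y => by
      rw [norm_mul, Complex.norm_real, Real.norm_of_nonneg (hη y).1]
      exact mul_le_of_le_one_left (norm_nonneg _) (hη y).2
    have hgL : Function.support g ⊆ L := fun y hy => by
      by_contra h
      exact hy (by simp [g, hη0 y h])
    have hgs : HasCompactSupport g := HasCompactSupport.of_support_subset_isCompact hL hgL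
    have key := hC lam hlam g hg hgs (M * E) (by positivity)
      ((hM₂ f g hg hgf hgL hftop).trans (by rw [← hE]; gcongr))
      (by
        have := hM₁ f g hg hgf hgL hftop
        simp only [pow_one, ← hE] at this
        exact this.trans (by gcongr))
    have hosc : ∀ μ ∈ Set.Icc lam (2 * lam), ∀ x, oscIntN μ Φ a f x =
        ∫ y, oscKernel (dilatedPhase Φ) A lam ((x, μ / lam), y) * g y := fun μ hμ x => by
      have h1 : χ (μ / lam) = 1 := by
        refine χ.one_of_mem_closedBall ?_
        rw [Real.closedBall_eq_Icc]
        refine ⟨?_, ?_⟩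
        · rw [le_div_iff₀ hlam0]
          change (3 / 2 - 1 / 2 : ℝ) * lam ≤ μ
          linarith [hμ.1]
        · rw [div_le_iff₀ hlam0]
          change μ ≤ (3 / 2 + 1 / 2 : ℝ) * lam
          linarith [hμ.2]
      unfold oscIntN
      congr 1
      ext y
      simp only [oscKernel, dilatedPhase, A, g, h1]
      rw [show lam * (μ / lam * Φ (x, y)) = μ * Φ (x, y) by field_simp]
      by_cases h2 : a (x, y) = 0
      · simp [h2]
      · have h3 : η y = 1 :=
          hη1.self_of_nhdsSet y ⟨(x, y), subset_tsupport _ h2, rfl⟩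
        simp [h3]
    calc (∫⁻ x : V n,
            (⨆ μ : (Set.Icc lam (2 * lam)), (‖oscIntN (μ : ℝ) Φ a (⇑f) x‖₊ : ℝ≥0∞)) ^ p)
          ^ (1 / p)
        ≤ (∫⁻ x, ⨆ t : ℝ, ‖∫ y, oscKernel (dilatedPhase Φ) A lam ((x, t), y) * g y‖ₑ ^ p)
            ^ (1 / p) := by
          refine ENNReal.rpow_le_rpow (lintegral_mono fun x => ?_) (by positivity)
          rw [← ENNReal.le_rpow_inv_iff hp0]
          refine iSup_le fun μ => ?_
          rw [ENNReal.le_rpow_inv_iff hp0, hosc μ μ.2 x]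
          exact le_iSup (fun t : ℝ =>
            ‖∫ y, oscKernel (dilatedPhase Φ) A lam ((x, t), y) * g y‖ₑ ^ p) (μ / lam)
      _ ≤ ENNReal.ofReal (C * (lam * ((lam ^ (n + 1))⁻¹) ^ (1 - θ)) * (M * E) ^ p) ^ (1 / p) :=
          ENNReal.rpow_le_rpow key (by positivity)
      _ ≤ ENNReal.ofReal (C * (lam ^ (-(n : ℝ) / p + ε)) ^ p * (M * E) ^ p) ^ (1 / p) := by
          refine ENNReal.rpow_le_rpow (ENNReal.ofReal_le_ofReal ?_) (by positivity)
          gcongr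
          rw [← Real.rpow_natCast, ← Real.rpow_neg hlam0.le, ← Real.rpow_mul hlam0.le,
            ← Real.rpow_mul hlam0.le]
          nth_rw 1 [← Real.rpow_one lam]
          rw [← Real.rpow_add hlam0]
          refine Real.rpow_le_rpow_of_exponent_le hlam ?_
          have : (-(n : ℝ) / p + ε) * p = -n + p * ε := by field_simp
          rw [this]
          push_cast
          linarith
      _ = ENNReal.ofReal (C ^ (1 / p) * M * lam ^ (-(n : ℝ) / p + ε)) * ENNReal.ofReal E := by
          rw [ENNReal.ofReal_rpow_of_nonneg (by positivity) (by positivity),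
            ← ENNReal.ofReal_mul (by positivity), mul_assoc C, ← Real.mul_rpow (by positivity)
            (by positivity), Real.mul_rpow hC0 (by positivity), ← Real.rpow_mul (by positivity),
            mul_one_div_cancel hp0.ne', Real.rpow_one]
          congr 1
          ring
      _ = _ := by rw [hE, ENNReal.ofReal_toReal hftop]

end assembly

section carlesonSjolin

theorem apply_eq_sum_single {n : ℕ} {F : Type} [NormedAddCommGroup F] [NormedSpace ℝ F]
    (f : V n →L[ℝ] F) (w : V n) : f w = ∑ i, w i • f (EuclideanSpace.single i 1) := by
  conv_lhs => rw [← (EuclideanSpace.basisFun (Fin n) ℝ).sum_repr w]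
  simp

theorem fderiv_slice_left {X Y F : Type} [NormedAddCommGroup X] [NormedSpace ℝ X]
    [NormedAddCommGroup Y] [NormedSpace ℝ Y] [NormedAddCommGroup F] [NormedSpace ℝ F]
    {g : X × Y → F} (hg : Differentiable ℝ g) (x : X) (y : Y) (v : X) :
    fderiv ℝ (fun x' => g (x', y)) x v = fderiv ℝ g (x, y) (v, 0) := by
  have h := ((hg (x, y)).hasFDerivAt.comp (f := fun x' => (x', y)) x
    (hasFDerivAt_prodMk_left x y)).fderiv
  exact congrArg (· v) h

theorem fderiv_slice_right {X Y F : Type} [NormedAddCommGroup X] [NormedSpace ℝ X]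
    [NormedAddCommGroup Y] [NormedSpace ℝ Y] [NormedAddCommGroup F] [NormedSpace ℝ F]
    {g : X × Y → F} (hg : Differentiable ℝ g) (x : X) (y : Y) (w : Y) :
    fderiv ℝ (fun y' => g (x, y')) y w = fderiv ℝ g (x, y) (0, w) := by
  have h := ((hg (x, y)).hasFDerivAt.comp y (hasFDerivAt_prodMk_right x y)).fderiv
  exact congrArg (· w) h

theorem fderiv_fderiv_apply_const {E F : Type} [NormedAddCommGroup E] [NormedSpace ℝ E]
    [NormedAddCommGroup F] [NormedSpace ℝ F] {g : E → F} (hg : ContDiff ℝ (⊤ : ℕ∞) g) (q v w : E) :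
    fderiv ℝ (fun q => fderiv ℝ g q v) q w = fderiv ℝ (fderiv ℝ g) q w v := by
  have h : DifferentiableAt ℝ (fderiv ℝ g) q :=
    ((hg.fderiv_right (m := (⊤ : ℕ∞)) (by simp)).differentiable (by simp)) q
  rw [(h.hasFDerivAt.clm_apply (hasFDerivAt_const v q)).fderiv]
  simp

theorem csMixed_apply {n : ℕ} {Φ : V n × V n → ℝ} (hΦ : ContDiff ℝ (⊤ : ℕ∞) Φ) (x y : V n)
    (i j : Fin n) : csMixed Φ x y i j = fderiv ℝ (fderiv ℝ Φ) (x, y)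
      (0, EuclideanSpace.single j 1) (EuclideanSpace.single i 1, 0) := by
  have hd := hΦ.differentiable (by simp)
  simp only [csMixed, Matrix.of_apply]
  simp_rw [fderiv_slice_left hd]
  rw [fderiv_slice_right (g := fun q => fderiv ℝ Φ q (EuclideanSpace.single i 1, 0))
    ((contDiff_fderiv_apply_const hΦ _).differentiable (by simp)), fderiv_fderiv_apply_const hΦ]

theorem csMixed_mulVec {n : ℕ} {Φ : V n × V n → ℝ} (hΦ : ContDiff ℝ (⊤ : ℕ∞) Φ) (x y w : V n)
    (i : Fin n) : (csMixed Φ x y).mulVec w i = fderiv ℝ (fderiv ℝ Φ) (x, y)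
      (0, w) (EuclideanSpace.single i 1, 0) := by
  have := apply_eq_sum_single ((ContinuousLinearMap.apply ℝ ℝ
    ((EuclideanSpace.single i 1, 0) : V n × V n)).comp ((fderiv ℝ (fderiv ℝ Φ) (x, y)).comp
      (ContinuousLinearMap.inr ℝ (V n) (V n)))) w
  simp only [ContinuousLinearMap.comp_apply, ContinuousLinearMap.inr_apply,
    ContinuousLinearMap.apply_apply] at this
  rw [this]
  simp only [Matrix.mulVec, dotProduct, csMixed_apply hΦ, smul_eq_mul, mul_comm]

theorem csCurv_apply {n : ℕ} {Φ : V n × V n → ℝ} (hΦ : ContDiff ℝ (⊤ : ℕ∞) Φ) (x y N : V n)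
    (j k : Fin n) : csCurv Φ x y N j k = fderiv ℝ (fderiv ℝ fun q => fderiv ℝ Φ q (N, 0)) (x, y)
      (0, EuclideanSpace.single j 1) (0, EuclideanSpace.single k 1) := by
  have hd := hΦ.differentiable (by simp)
  have hN := contDiff_fderiv_apply_const hΦ ((N, 0) : V n × V n)
  have h1 : ∀ y', (⟪gradX Φ x y', N⟫ : ℝ) = fderiv ℝ Φ (x, y') (N, 0) := fun y' => by
    rw [← fderiv_slice_left hd, apply_eq_sum_single]
    simp [gradX, PiLp.inner_apply]
  simp only [csCurv, Matrix.of_apply]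
  simp_rw [h1]
  have h2 : ∀ y', fderiv ℝ (fun y'' => fderiv ℝ Φ (x, y'') (N, 0)) y' (EuclideanSpace.single k 1) =
      fderiv ℝ (fun q => fderiv ℝ Φ q (N, 0)) (x, y') (0, EuclideanSpace.single k 1) := fun y' =>
    fderiv_slice_right (hN.differentiable (by simp)) _ _ _
  simp_rw [h2]
  rw [fderiv_slice_right
    (g := fun q => fderiv ℝ (fun q => fderiv ℝ Φ q (N, 0)) q (0, EuclideanSpace.single k 1))
    ((contDiff_fderiv_apply_const hN _).differentiable (by simp)), fderiv_fderiv_apply_const hN]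

theorem csCurv_mulVec {n : ℕ} {Φ : V n × V n → ℝ} (hΦ : ContDiff ℝ (⊤ : ℕ∞) Φ) (x y N w : V n)
    (j : Fin n) : (csCurv Φ x y N).mulVec w j =
      fderiv ℝ (fderiv ℝ fun q => fderiv ℝ Φ q (N, 0)) (x, y)
        (0, EuclideanSpace.single j 1) (0, w) := by
  have := apply_eq_sum_single ((fderiv ℝ (fderiv ℝ fun q => fderiv ℝ Φ q (N, 0)) (x, y)
    (0, EuclideanSpace.single j 1)).comp (ContinuousLinearMap.inr ℝ (V n) (V n))) w
  simp only [ContinuousLinearMap.comp_apply, ContinuousLinearMap.inr_apply] at this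
  rw [this]
  simp only [Matrix.mulVec, dotProduct, csCurv_apply hΦ, smul_eq_mul, mul_comm]

theorem eq_zero_of_mongeAmpere {n : ℕ} {Φ : V n × V n → ℝ} (hΦ : ContDiff ℝ (⊤ : ℕ∞) Φ) {x y : V n}
    (hMA : (mongeAmpere Φ x y).det ≠ 0) {w : V n}
    (h₁ : ∀ ξ : V n, fderiv ℝ (fderiv ℝ Φ) (x, y) (0, w) (ξ, 0) = 0)
    (h₂ : fderiv ℝ Φ (x, y) (0, w) = 0) : w = 0 := by
  by_contra hw
  have hd := hΦ.differentiable (by simp)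
  refine hMA (Matrix.exists_mulVec_eq_zero_iff.1 ⟨Fin.cons 0 w, fun h => hw ?_, ?_⟩)
  · ext i
    have := congrFun h i.succ
    simpa using this
  · ext i
    simp only [Matrix.mulVec, dotProduct, Fin.sum_univ_succ, Fin.cons_zero, mul_zero, zero_add,
      Fin.cons_succ, Pi.zero_apply]
    refine Fin.cases ?_ (fun i => ?_) i
    · have := apply_eq_sum_single (fderiv ℝ (fun y' => Φ (x, y')) y) w
      rw [fderiv_slice_right hd, h₂] at this
      rw [this]
      simp [mongeAmpere, mul_comm]
    · have := csMixed_mulVec hΦ x y w i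
      rw [h₁] at this
      rw [← this]
      simp [mongeAmpere, Matrix.mulVec, dotProduct]

theorem exists_injective_on_complement {E F : Type} [NormedAddCommGroup E] [NormedSpace ℝ E]
    [FiniteDimensional ℝ E] [AddCommGroup F] [Module ℝ F] (L : E →ₗ[ℝ] F) {r : ℕ}
    (hr : Module.finrank ℝ (LinearMap.range L) = r) :
    ∃ A : V r →L[ℝ] E, ∀ k, k ≠ 0 → L (A k) ≠ 0 := by
  obtain ⟨W, hW⟩ := Submodule.exists_isCompl (LinearMap.ker L)
  have h1 := LinearMap.finrank_range_add_finrank_ker L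
  have h2 := Submodule.finrank_add_eq_of_isCompl hW
  have e : V r ≃ₗ[ℝ] W := LinearEquiv.ofFinrankEq _ _ (by
    rw [finrank_euclideanSpace_fin]
    omega)
  refine ⟨LinearMap.toContinuousLinearMap (W.subtype ∘ₗ e.toLinearMap), fun k hk h => hk ?_⟩
  have h3 : ((e k : W) : E) ∈ LinearMap.ker L ⊓ W := ⟨h, (e k).2⟩
  rw [hW.inf_eq_bot, Submodule.mem_bot, ZeroMemClass.coe_eq_zero] at h3
  exact (LinearEquiv.map_eq_zero_iff e).1 h3

theorem exists_equiv_of_injective {E F : Type} [NormedAddCommGroup E] [NormedSpace ℝ E]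
    [FiniteDimensional ℝ E] [NormedAddCommGroup F] [NormedSpace ℝ F] [FiniteDimensional ℝ F]
    (M : E →ₗ[ℝ] F) (hM : Function.Injective M)
    (hEF : Module.finrank ℝ F = Module.finrank ℝ E + 1) :
    ∃ e : (ℝ × E) ≃L[ℝ] F, ∀ ζ, e (0, ζ) = M ζ := by
  obtain ⟨ν, hν⟩ : ∃ ν, ν ∉ LinearMap.range M := by
    by_contra! h
    have h1 := LinearMap.finrank_range_of_inj hM
    rw [(Submodule.eq_top_iff'.2 h), finrank_top] at h1
    omega
  let f : (ℝ × E) →ₗ[ℝ] F := (LinearMap.toSpanSingleton ℝ F ν).coprod M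
  have hf : ∀ s ζ, f (s, ζ) = s • ν + M ζ := fun s ζ => by simp [f]
  have hinj : Function.Injective f := by
    rw [← LinearMap.ker_eq_bot, LinearMap.ker_eq_bot']
    rintro ⟨s, ζ⟩ h
    rw [hf] at h
    have hs : s = 0 := by
      by_contra hs
      refine hν ⟨-s⁻¹ • ζ, ?_⟩
      rw [map_smul, eq_neg_of_add_eq_zero_right h, smul_neg, neg_smul, neg_neg, smul_smul,
        inv_mul_cancel₀ hs, one_smul]
    rw [hs, zero_smul, zero_add] at h
    rw [hs, hM (h.trans (map_zero M).symm)]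
    rfl
  refine ⟨(LinearEquiv.ofInjectiveOfFinrankEq f hinj
      (by simp [hEF, add_comm])).toContinuousLinearEquiv,
    fun ζ => ?_⟩
  change f (0, ζ) = M ζ
  rw [hf, zero_smul, zero_add]

end carlesonSjolin

section dilatedPhase

variable {X Y Z : Type} [NormedAddCommGroup X] [NormedSpace ℝ X]
  [NormedAddCommGroup Y] [NormedSpace ℝ Y] [NormedAddCommGroup Z] [NormedSpace ℝ Z]

theorem fderiv_add_mul_comp {g₁ g₂ : X × Y → ℝ} (hg₁ : Differentiable ℝ g₁)
    (hg₂ : Differentiable ℝ g₂) (e : Z →L[ℝ] X × ℝ) (τ : ℝ) (q : Z × Y) (u : Z) (w : Y) :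
    fderiv ℝ (fun q : Z × Y => τ * g₁ ((e q.1).1, q.2) + (e q.1).2 * g₂ ((e q.1).1, q.2)) q (u, w) =
      τ * fderiv ℝ g₁ ((e q.1).1, q.2) ((e u).1, w) +
        ((e q.1).2 * fderiv ℝ g₂ ((e q.1).1, q.2) ((e u).1, w) +
          g₂ ((e q.1).1, q.2) * (e u).2) := by
  let P : Z × Y →L[ℝ] X × Y := (((ContinuousLinearMap.fst ℝ X ℝ).comp e).comp
    (ContinuousLinearMap.fst ℝ Z Y)).prod (ContinuousLinearMap.snd ℝ Z Y)
  let T : Z × Y →L[ℝ] ℝ := ((ContinuousLinearMap.snd ℝ X ℝ).comp e).comp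
    (ContinuousLinearMap.fst ℝ Z Y)
  have h₁ : HasFDerivAt (fun q => g₁ (P q)) _ q := (hg₁ (P q)).hasFDerivAt.comp q P.hasFDerivAt
  have h₂ : HasFDerivAt (fun q => g₂ (P q)) _ q := (hg₂ (P q)).hasFDerivAt.comp q P.hasFDerivAt
  have h := ((h₁.const_mul τ).add (T.hasFDerivAt.mul h₂)).fderiv
  exact congrArg (· (u, w)) h


theorem fderiv_dilatedPhase {Φ : X × Y → ℝ} (hΦ : ContDiff ℝ (⊤ : ℕ∞) Φ) (e : Z →L[ℝ] X × ℝ)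
    (q : Z × Y) (u : Z) :
    fderiv ℝ (fun q : Z × Y => dilatedPhase Φ (e q.1, q.2)) q (u, 0) =
      (e u).2 * Φ ((e q.1).1, q.2) + (e q.1).2 * fderiv ℝ Φ ((e q.1).1, q.2) ((e u).1, 0) := by
  have h := fderiv_add_mul_comp (hΦ.differentiable (by simp))
      (hΦ.differentiable (by simp)) e 0 q u 0
  simp only [zero_mul, zero_add] at h
  simp only [dilatedPhase]
  rw [h]
  ring

theorem fderiv_fderiv_dilatedPhase {Φ : X × Y → ℝ} (hΦ : ContDiff ℝ (⊤ : ℕ∞) Φ) (e : Z →L[ℝ] X × ℝ)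
    (q : Z × Y) (u : Z) (k : Y) :
    fderiv ℝ (fun q => fderiv ℝ (fun q : Z × Y => dilatedPhase Φ (e q.1, q.2)) q (u, 0)) q (0, k) =
      (e u).2 * fderiv ℝ Φ ((e q.1).1, q.2) (0, k) +
        (e q.1).2 * fderiv ℝ (fun q => fderiv ℝ Φ q ((e u).1, 0)) ((e q.1).1, q.2) (0, k) := by
  simp_rw [fderiv_dilatedPhase hΦ e]
  have h := fderiv_add_mul_comp (hΦ.differentiable (by simp))
    ((contDiff_fderiv_apply_const hΦ ((e u).1, 0)).differentiable (by simp)) e (e u).2 q 0 k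
  simpa using h

theorem fderiv_fderiv_fderiv_dilatedPhase {Φ : X × Y → ℝ} (hΦ : ContDiff ℝ (⊤ : ℕ∞) Φ)
    (e : Z →L[ℝ] X × ℝ)
    (q : Z × Y) (u : Z) (k l : Y) :
    fderiv ℝ (fun q => fderiv ℝ (fun q' => fderiv ℝ (fun q : Z × Y => dilatedPhase Φ (e q.1, q.2))
        q' (u, 0)) q (0, k)) q (0, l) =
      (e u).2 * fderiv ℝ (fun q => fderiv ℝ Φ q (0, k)) ((e q.1).1, q.2) (0, l) +
        (e q.1).2 * fderiv ℝ (fun q => fderiv ℝ (fun q => fderiv ℝ Φ q ((e u).1, 0)) q (0, k))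
          ((e q.1).1, q.2) (0, l) := by
  simp_rw [fderiv_fderiv_dilatedPhase hΦ e]
  have h := fderiv_add_mul_comp
    ((contDiff_fderiv_apply_const hΦ (0, k)).differentiable (by simp))
    ((contDiff_fderiv_apply_const (contDiff_fderiv_apply_const hΦ ((e u).1, 0))
      (0, k)).differentiable (by simp)) e (e u).2 q 0 l
  simpa using h

end dilatedPhase

section localEstimate

variable {n : ℕ} {Φ : V n × V n → ℝ}

/-- Linear coordinates adapted to the phase `dilatedPhase Φ`: in the directions `(0, ζ)` its mixed
Hessian is nondegenerate. -/
theorem exists_adapted_coordinates (hΦ : ContDiff ℝ (⊤ : ℕ∞) Φ) {x₀ y₀ : V n} {t₀ : ℝ}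
    (ht₀ : t₀ ≠ 0) (hMA : (mongeAmpere Φ x₀ y₀).det ≠ 0) :
    ∃ e : (ℝ × V n) ≃L[ℝ] V n × ℝ, ∀ ζ, ζ ≠ 0 →
      (e (0, ζ)).2 * fderiv ℝ Φ (x₀, y₀) (0, ζ) +
        t₀ * fderiv ℝ (fderiv ℝ Φ) (x₀, y₀) (0, ζ) ((e (0, ζ)).1, 0) ≠ 0 := by
  let D : V n → V n → ℝ := fun ζ ξ => fderiv ℝ (fderiv ℝ Φ) (x₀, y₀) (0, ζ) (ξ, 0)
  let Lv : V n →ₗ[ℝ] V n := (WithLp.linearEquiv 2 ℝ (Fin n → ℝ)).symm.toLinearMap ∘ₗ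
    LinearMap.pi fun i => t₀ • ((ContinuousLinearMap.apply ℝ ℝ
      ((EuclideanSpace.single i 1, 0) : V n × V n)).comp ((fderiv ℝ (fderiv ℝ Φ) (x₀, y₀)).comp
        (ContinuousLinearMap.inr ℝ (V n) (V n)))).toLinearMap
  have hLv : ∀ ζ i, Lv ζ i = t₀ * D ζ (EuclideanSpace.single i 1) := fun ζ i => by
    simp [Lv, D]
  let M : V n →ₗ[ℝ] V n × ℝ := Lv.prod
    ((fderiv ℝ Φ (x₀, y₀)).comp (ContinuousLinearMap.inr ℝ (V n) (V n))).toLinearMap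
  have hM : ∀ ζ, M ζ = (Lv ζ, fderiv ℝ Φ (x₀, y₀) (0, ζ)) := fun ζ => rfl
  have hD : ∀ ζ ξ, D ζ ξ = ∑ i, ξ i * D ζ (EuclideanSpace.single i 1) := fun ζ ξ =>
    apply_eq_sum_single ((fderiv ℝ (fderiv ℝ Φ) (x₀, y₀) (0, ζ)).comp
      (ContinuousLinearMap.inl ℝ (V n) (V n))) ξ
  have h0 : ∀ ζ, Lv ζ = 0 → fderiv ℝ Φ (x₀, y₀) (0, ζ) = 0 → ζ = 0 := fun ζ h1 h2 =>
    eq_zero_of_mongeAmpere hΦ hMA (fun ξ => by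
      change D ζ ξ = 0
      rw [hD]
      refine Finset.sum_eq_zero fun i _ => ?_
      have := hLv ζ i
      rw [h1] at this
      rw [(mul_eq_zero.1 this.symm).resolve_left ht₀, mul_zero]) h2
  obtain ⟨e, he⟩ := exists_equiv_of_injective M (by
    rw [← LinearMap.ker_eq_bot, LinearMap.ker_eq_bot']
    intro ζ h
    rw [hM, Prod.mk_eq_zero] at h
    exact h0 ζ h.1 h.2) (by simp)
  refine ⟨e, fun ζ hζ h => hζ ?_⟩
  rw [he, hM] at h
  change _ + t₀ * D ζ (Lv ζ) = 0 at h
  have h3 : t₀ * D ζ (Lv ζ) = ∑ i, Lv ζ i ^ 2 := by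
    rw [hD, Finset.mul_sum]
    refine Finset.sum_congr rfl fun i _ => ?_
    rw [hLv]
    ring
  have h4 : 0 ≤ ∑ i, Lv ζ i ^ 2 := Finset.sum_nonneg fun i _ => sq_nonneg _
  rw [h3] at h
  have h5 : ∑ i, Lv ζ i ^ 2 = 0 := by nlinarith [mul_self_nonneg (fderiv ℝ Φ (x₀, y₀) (0, ζ))]
  refine h0 ζ ?_ (mul_self_eq_zero.1 (by linarith))
  ext i
  exact pow_eq_zero_iff two_ne_zero |>.1
    ((Finset.sum_eq_zero_iff_of_nonneg fun i _ => sq_nonneg _).1 h5 i (Finset.mem_univ i))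

/-- In a direction annihilated by the mixed Hessian of `dilatedPhase Φ`, the curvature condition
provides nondegeneracy in `n - 1` directions. -/
theorem exists_curved_directions (hn : 2 ≤ n) (hΦ : ContDiff ℝ (⊤ : ℕ∞) Φ) {x₀ y₀ : V n} {t₀ : ℝ}
    (ht₀ : t₀ ≠ 0) (hrank : (csMixed Φ x₀ y₀).rank = n - 1)
    (hcurv : ∀ N : V n, ‖N‖ = 1 →
      (∀ j : Fin n,
        (⟪N, (EuclideanSpace.equiv (Fin n) ℝ).symm fun i => csMixed Φ x₀ y₀ i j⟫ : ℝ) = 0) →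
      (csCurv Φ x₀ y₀ N).rank = n - 1)
    (hMA : (mongeAmpere Φ x₀ y₀).det ≠ 0) {ξ : V n} {τ : ℝ} (hξτ : (ξ, τ) ≠ 0)
    (hdeg : ∀ ζ, τ * fderiv ℝ Φ (x₀, y₀) (0, ζ) +
      t₀ * fderiv ℝ (fderiv ℝ Φ) (x₀, y₀) (0, ζ) (ξ, 0) = 0) :
    τ = 0 ∧ ∃ A : V (n - 1) →L[ℝ] V n, ∀ k, k ≠ 0 → ∃ ζ,
      fderiv ℝ (fderiv ℝ fun q => fderiv ℝ Φ q (ξ, 0)) (x₀, y₀) (0, ζ) (0, A k) ≠ 0 := by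
  let D : V n → V n → ℝ := fun ζ ξ => fderiv ℝ (fderiv ℝ Φ) (x₀, y₀) (0, ζ) (ξ, 0)
  have hD : ∀ ζ ξ, D ζ ξ = ∑ i, ξ i * D ζ (EuclideanSpace.single i 1) := fun ζ ξ =>
    apply_eq_sum_single ((fderiv ℝ (fderiv ℝ Φ) (x₀, y₀) (0, ζ)).comp
      (ContinuousLinearMap.inl ℝ (V n) (V n))) ξ
  have hdet : (csMixed Φ x₀ y₀).det = 0 := by
    by_contra h
    have := Matrix.rank_of_isUnit _ ((Matrix.isUnit_iff_isUnit_det _).2 (isUnit_iff_ne_zero.2 h))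
    rw [hrank, Fintype.card_fin] at this
    omega
  obtain ⟨w, hw0, hw⟩ := Matrix.exists_mulVec_eq_zero_iff.2 hdet
  have hw' : ∀ ξ, D (WithLp.toLp 2 w) ξ = 0 := fun ξ => by
    rw [hD]
    refine Finset.sum_eq_zero fun i _ => ?_
    have := csMixed_mulVec hΦ x₀ y₀ (WithLp.toLp 2 w) i
    change (csMixed Φ x₀ y₀).mulVec w i = D _ _ at this
    rw [← this, hw, Pi.zero_apply, mul_zero]
  have hτ : τ = 0 := by
    have h1 := hdeg (WithLp.toLp 2 w)
    change _ + t₀ * D _ _ = 0 at h1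
    rw [hw', mul_zero, add_zero] at h1
    refine (mul_eq_zero.1 h1).resolve_right fun h2 => hw0 ?_
    have := eq_zero_of_mongeAmpere hΦ hMA hw' h2
    ext i
    exact congrArg (fun v : V n => v i) this
  refine ⟨hτ, ?_⟩
  have hξ : ξ ≠ 0 := fun h => hξτ (by rw [h, hτ]; rfl)
  have hξ' : ‖ξ‖ ≠ 0 := norm_ne_zero_iff.2 hξ
  have hDξ : ∀ ζ, D ζ ξ = 0 := fun ζ => by
    have h1 := hdeg ζ
    rw [hτ, zero_mul, zero_add] at h1
    exact (mul_eq_zero.1 h1).resolve_left ht₀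
  have hr := hcurv (‖ξ‖⁻¹ • ξ) (by rw [norm_smul, norm_inv, norm_norm, inv_mul_cancel₀ hξ'])
    fun j => by
      rw [inner_smul_left, PiLp.inner_apply]
      have h1 := hDξ (EuclideanSpace.single j 1)
      rw [hD] at h1
      rw [show ∑ i, (⟪ξ i, ((EuclideanSpace.equiv (Fin n) ℝ).symm
        fun i => csMixed Φ x₀ y₀ i j) i⟫ : ℝ) = 0 from h1 ▸ Finset.sum_congr rfl fun i _ => ?_]
      · rw [mul_zero]
      · simp [csMixed_apply hΦ, D, mul_comm]
  obtain ⟨A, hA⟩ := exists_injective_on_complement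
    ((csCurv Φ x₀ y₀ (‖ξ‖⁻¹ • ξ)).mulVecLin ∘ₗ (WithLp.linearEquiv 2 ℝ (Fin n → ℝ)).toLinearMap)
    (r := n - 1) (by rw [LinearEquiv.range_comp]; exact hr)
  refine ⟨A, fun k hk => ?_⟩
  obtain ⟨j, hj⟩ := Function.ne_iff.1 (hA k hk)
  refine ⟨EuclideanSpace.single j 1, fun h => hj ?_⟩
  change (csCurv Φ x₀ y₀ (‖ξ‖⁻¹ • ξ)).mulVec (A k) j = 0
  rw [csCurv_mulVec hΦ]
  have h2 : (fun q => fderiv ℝ Φ q (‖ξ‖⁻¹ • ξ, 0)) =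
      (‖ξ‖⁻¹ • fun q => fderiv ℝ Φ q (ξ, 0)) := by
    ext q
    rw [Pi.smul_apply, ← map_smul, Prod.smul_mk, smul_zero]
  have h3 := contDiff_fderiv_apply_const hΦ ((ξ, 0) : V n × V n)
  have h4 : fderiv ℝ (‖ξ‖⁻¹ • fun q => fderiv ℝ Φ q (ξ, 0)) =
      ‖ξ‖⁻¹ • fderiv ℝ fun q => fderiv ℝ Φ q (ξ, 0) := by
    ext1 q
    exact fderiv_const_smul (h3.differentiable (by simp) q) _
  rw [h2, h4, fderiv_const_smul
    ((h3.fderiv_right (m := (⊤ : ℕ∞)) (by simp)).differentiable (by simp) _)]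
  simp [h]

theorem exists_open_hasStrongType (hn : 2 ≤ n) (hΦ : ContDiff ℝ (⊤ : ℕ∞) Φ) {x₀ y₀ : V n} {t₀ : ℝ}
    (ht₀ : t₀ ≠ 0) (hrank : (csMixed Φ x₀ y₀).rank = n - 1)
    (hcurv : ∀ N : V n, ‖N‖ = 1 →
      (∀ j : Fin n,
        (⟪N, (EuclideanSpace.equiv (Fin n) ℝ).symm fun i => csMixed Φ x₀ y₀ i j⟫ : ℝ) = 0) →
      (csCurv Φ x₀ y₀ N).rank = n - 1)
    (hMA : (mongeAmpere Φ x₀ y₀).det ≠ 0) {p : ℝ} (hp : 2 * (n + 1) / (n - 1) ≤ p) :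
    ∃ U : Set ((V n × ℝ) × V n), IsOpen U ∧ ((x₀, t₀), y₀) ∈ U ∧ ∀ A : (V n × ℝ) × V n → ℂ,
      ContDiff ℝ (⊤ : ℕ∞) A → HasCompactSupport A → tsupport A ⊆ U →
        HasStrongType (dilatedPhase Φ) A (n + 1) p := by
  obtain ⟨e, he⟩ := exists_adapted_coordinates hΦ ht₀ hMA
  let E : ((ℝ × V n) × V n) ≃L[ℝ] (V n × ℝ) × V n :=
      e.prodCongr (ContinuousLinearEquiv.refl ℝ (V n))
  have hn1 : (1 : ℝ) < n := by exact_mod_cast hn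
  have hψ : ContDiff ℝ (⊤ : ℕ∞) fun q : (ℝ × V n) × V n => dilatedPhase Φ (e q.1, q.2) :=
    (contDiff_dilatedPhase hΦ).comp E.contDiff
  have hz : e (e.symm (x₀, t₀)) = (x₀, t₀) := e.apply_symm_apply _
  obtain ⟨δ, hδ, key⟩ := weak_type_bound (H := V (n - 1))
    (by rw [finrank_euclideanSpace_fin]; omega) hψ (e.symm (x₀, t₀)) y₀
    (fun ζ hζ => ⟨ζ, by
      have h1 := fderiv_fderiv_dilatedPhase hΦ e.toContinuousLinearMap (e.symm (x₀, t₀), y₀)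
          (0, ζ) ζ
      simp only [ContinuousLinearEquiv.coe_coe, hz] at h1
      rw [h1, fderiv_fderiv_apply_const hΦ]
      exact he ζ hζ⟩)
    (fun u hu => by
      by_contra! hcon
      obtain ⟨h1, h2⟩ := hcon
      obtain ⟨hτ, A, hA⟩ := exists_curved_directions hn hΦ ht₀ hrank hcurv hMA
        (ξ := (e u).1) (τ := (e u).2) (fun h => hu (e.map_eq_zero_iff.1 h)) fun ζ => by
          have h3 := fderiv_fderiv_dilatedPhase hΦ e.toContinuousLinearMap
            (e.symm (x₀, t₀), y₀) u ζ
          simp only [ContinuousLinearEquiv.coe_coe, hz] at h3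
          rw [← fderiv_fderiv_apply_const hΦ, ← h3]
          exact h1 ζ
      obtain ⟨k, hk, hk0⟩ := h2 A
      obtain ⟨ζ, hζ⟩ := hA k hk
      refine hζ ?_
      have h3 := fderiv_fderiv_fderiv_dilatedPhase hΦ e.toContinuousLinearMap
        (e.symm (x₀, t₀), y₀) u (A k) ζ
      simp only [ContinuousLinearEquiv.coe_coe, hz, hτ, zero_mul, zero_add] at h3
      have h4 := hk0 ζ
      rw [h3, fderiv_fderiv_apply_const (contDiff_fderiv_apply_const hΦ _)] at h4
      exact (mul_eq_zero.1 h4).resolve_left ht₀)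
  refine ⟨E.symm ⁻¹' Metric.ball (e.symm (x₀, t₀), y₀) δ,
    Metric.isOpen_ball.preimage E.symm.continuous, Metric.mem_ball_self hδ, fun A hA hAs hAU => ?_⟩
  refine HasStrongType.of_comp_equiv e fun θ hθ hθ1 => ?_
  have hAE : HasCompactSupport (A ∘ E) := hAs.comp_homeomorph E.toHomeomorph
  obtain ⟨C, hC, hweak⟩ := key (A ∘ E) (hA.comp E.contDiff) hAE fun q hq => by
    have h1 := hAU (tsupport_comp_subset_preimage A E.continuous hq)
    simpa using h1
  rw [finrank_euclideanSpace_fin, finrank_euclideanSpace_fin, Nat.cast_sub (by omega),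
    Nat.cast_one] at hweak
  have hn0 : (0 : ℝ) < n - 1 := by linarith
  have hp2 : 2 * (1 + 2 / ((n : ℝ) - 1)) ≤ p := by
    refine le_trans (le_of_eq ?_) hp
    field_simp
    ring
  obtain ⟨C', hC', h⟩ := strong_type_of_weak_type hψ.continuous (hA.comp E.contDiff).continuous hAE
    (by positivity) hC hweak hp2 hθ hθ1
  have hp0 : 0 ≤ p := le_trans (by positivity) hp2
  refine ⟨C', hC', fun lam hlam f hf hfs N hN hN2 hN1 => ?_⟩
  refine le_trans (le_of_eq (lintegral_congr fun z => ?_)) (h lam hlam f hf hfs N hN hN2 hN1)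
  rw [← ENNReal.ofReal_rpow_of_nonneg (norm_nonneg _) hp0, ofReal_norm]
  rfl

end localEstimate

/-- maximal bounds for oscillatory integrals satisfying the `n×n`
Carleson–Sjölin condition and the Monge–Ampère condition: for `2(n+1)/(n−1) ≤ p < ∞`
and `ε > 0`,
`(∫_{ℝⁿ} sup_{μ∈[λ,2λ]}|S_μ f(x)|^p dx)^{1/p} ≤ C_ε λ^{−n/p+ε}‖f‖_{L^p(ℝⁿ)}`. -/
theorem maximal_oscillatory_bound (n : ℕ) (hn : 2 ≤ n)
    (Φ : V n × V n → ℝ) (a : V n × V n → ℂ)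
    (hΦ : ContDiff ℝ (⊤ : ℕ∞) Φ) (haSmooth : ContDiff ℝ (⊤ : ℕ∞) a)
    (haSupp : HasCompactSupport a)
    (hrank : ∀ q ∈ tsupport a, (csMixed Φ q.1 q.2).rank = n - 1)
    (hcurv : ∀ q ∈ tsupport a, ∀ N : V n, ‖N‖ = 1 →
      (∀ j : Fin n,
        (⟪N, (EuclideanSpace.equiv (Fin n) ℝ).symm fun i => csMixed Φ q.1 q.2 i j⟫ : ℝ) = 0) →
      (csCurv Φ q.1 q.2 N).rank = n - 1)
    (hMA : ∀ q ∈ tsupport a, (mongeAmpere Φ q.1 q.2).det ≠ 0) :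
    ∀ p : ℝ, 2 * (n + 1) / (n - 1) ≤ p → ∀ ε : ℝ, 0 < ε →
      ∃ C : ℝ, ∀ lam : ℝ, 1 ≤ lam → ∀ f : SchwartzMap (V n) ℂ,
        (∫⁻ x : V n,
            (⨆ μ : (Set.Icc lam (2 * lam)), (‖oscIntN (μ : ℝ) Φ a (⇑f) x‖₊ : ℝ≥0∞)) ^ p)
          ^ (1 / p)
          ≤ ENNReal.ofReal (C * lam ^ (-(n : ℝ) / p + ε)) *
              eLpNorm (⇑f) (ENNReal.ofReal p) volume := by
  intro p hp ε hε
  have hn1 : (1 : ℝ) < n := by exact_mod_cast hn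
  have hp2 : 2 ≤ p := by
    refine le_trans ?_ hp
    rw [le_div_iff₀ (by linarith)]
    linarith
  have hloc : ∀ q ∈ {q : (V n × ℝ) × V n | (q.1.1, q.2) ∈ tsupport a ∧
      q.1.2 ∈ Set.Icc (1 / 2 : ℝ) (5 / 2)}, ∃ U : Set ((V n × ℝ) × V n), IsOpen U ∧ q ∈ U ∧
      ∀ A : (V n × ℝ) × V n → ℂ, ContDiff ℝ (⊤ : ℕ∞) A → HasCompactSupport A → tsupport A ⊆ U →
        HasStrongType (dilatedPhase Φ) A (n + 1) p := by
    rintro ⟨⟨x₀, t₀⟩, y₀⟩ ⟨hq, ht⟩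
    have ht₀ : t₀ ≠ 0 := fun h => by
      rw [h] at ht
      norm_num at ht
    exact exists_open_hasStrongType hn hΦ ht₀ (hrank _ hq) (hcurv _ hq) (hMA _ hq) hp
  have hK : IsCompact {q : (V n × ℝ) × V n | (q.1.1, q.2) ∈ tsupport a ∧
      q.1.2 ∈ Set.Icc (1 / 2 : ℝ) (5 / 2)} := isCompact_dilated haSupp isCompact_Icc
  have hS := HasStrongType.of_locally (contDiff_dilatedPhase hΦ).continuous (by linarith) hK hloc
  exact maximal_bound_of_hasStrongType hΦ haSmooth haSupp hp2 hS hε
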